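/- (Proposition 3, part 1.) Suppose Assumptions 1, 2 and 3 hold and X and Y are conditionally independent given Z. Let p ≥ 1, J ≥ 1, fix locations (t_j)_{j=1}^J in 𝒳̈ × 𝒴, let (r_n) satisfy n^{(β+γ)/(2β)} = o(r_n), and set every RLS regularization parameter to λ_{r_n} = r_n^{−1/(1+γ)}. Then √n·S̃_{n,r_n} converges in distribution, as n → ∞, to the centered multivariate Gaussian law N(0,Σ) on ℝ^J with Σ = E[u_1 u_1ᵀ]. -/

import Mathlib

open MeasureTheory ProbabilityTheory Filter Topology Asymptotics
open scoped RealInnerProductSpace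

noncomputable section

namespace CIPaper

/-- A positive definite kernel. -/
def PosDefKernel {D : Type*} (k : D → D → ℝ) : Prop :=
  ∀ (n : ℕ) (x : Fin n → D) (c : Fin n → ℝ),
    0 ≤ ∑ i : Fin n, ∑ j : Fin n, c i * c j * k (x i) (x j)

/-- The mean embedding of `ν` with respect to the kernel `k`. -/
def meanEmbed {D : Type*} [MeasurableSpace D] (k : D → D → ℝ) (ν : Measure D) (t : D) : ℝ :=
  ∫ x, k x t ∂ν

/-- A kernel is characteristic if the mean embedding is injective on probability measures. -/
def Characteristic {D : Type*} [MeasurableSpace D] (k : D → D → ℝ) : Prop :=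
  ∀ P Q : Measure D, IsProbabilityMeasure P → IsProbabilityMeasure Q →
    (∀ t, meanEmbed k P t = meanEmbed k Q t) → P = Q

def BoundedKernel {D : Type*} (k : D → D → ℝ) : Prop := ∃ C, ∀ x y, |k x y| ≤ C

/-- Assumption 1 of the paper, for the tensor product kernel built from `kX` and `kY` :
the tensor kernel is positive definite, characteristic, bounded, continuous and analytic. -/
structure Assumption1 {DX DY : Type*} [MeasurableSpace DX] [MeasurableSpace DY]
    [NormedAddCommGroup DX] [NormedSpace ℝ DX] [NormedAddCommGroup DY] [NormedSpace ℝ DY]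
    (kX : DX → DX → ℝ) (kY : DY → DY → ℝ) : Prop where
  posdef : PosDefKernel fun p q : DX × DY => kX p.1 q.1 * kY p.2 q.2
  charac : Characteristic fun p q : DX × DY => kX p.1 q.1 * kY p.2 q.2
  bounded : BoundedKernel fun p q : DX × DY => kX p.1 q.1 * kY p.2 q.2
  continuous : Continuous fun pq : (DX × DY) × (DX × DY) => kX pq.1.1 pq.2.1 * kY pq.1.2 pq.2.2
  analytic : ∀ p : DX × DY, AnalyticOnNhd ℝ (fun q : DX × DY => kX p.1 q.1 * kY p.2 q.2) Set.univ

/-- The random metric `d_{p,J}` between two measures, with locations `t`. -/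
def dpJ {D : Type*} [MeasurableSpace D] (k : D → D → ℝ) (p : ℕ) {J : ℕ}
    (t : Fin J → D) (P Q : Measure D) : ℝ :=
  ((J : ℝ)⁻¹ * ∑ j : Fin J, |meanEmbed k P (t j) - meanEmbed k Q (t j)| ^ p) ^ ((p : ℝ)⁻¹)

/-- `P` is the measure `P_{Ẍ⊗Y|Z}` of the paper : a Borel probability measure with
`P(A×B) = E[E[1_A(Ẍ)|Z]·E[1_B(Y)|Z]]` for all measurable `A`, `B`. -/
def IsCondProdMeasure {Ω : Type*} [MeasurableSpace Ω] (μ : Measure Ω)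
    {DX DZ DY : Type*} [MeasurableSpace DX] [MeasurableSpace DZ] [MeasurableSpace DY]
    (X : Ω → DX) (Z : Ω → DZ) (Y : Ω → DY) (P : Measure ((DX × DZ) × DY)) : Prop :=
  IsProbabilityMeasure P ∧
    ∀ (A : Set (DX × DZ)) (B : Set DY), MeasurableSet A → MeasurableSet B →
      (P (A ×ˢ B)).toReal =
        ∫ ω, ((μ[fun ω' => A.indicator (fun _ => (1 : ℝ)) (X ω', Z ω') |
                MeasurableSpace.comap Z inferInstance]) ω)
            * ((μ[fun ω' => B.indicator (fun _ => (1 : ℝ)) (Y ω') |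
                MeasurableSpace.comap Z inferInstance]) ω) ∂μ

/-- The witness function `Δ`. -/
def witness {Ω : Type*} [MeasurableSpace Ω] (μ : Measure Ω)
    {DX DZ DY : Type*} [MeasurableSpace DZ]
    (kX : DX × DZ → DX × DZ → ℝ) (kY : DY → DY → ℝ)
    (X : Ω → DX) (Z : Ω → DZ) (Y : Ω → DY) (t1 : DX × DZ) (t2 : DY) : ℝ :=
  ∫ ω, (kX t1 (X ω, Z ω) -
          (μ[fun ω' => kX t1 (X ω', Z ω') | MeasurableSpace.comap Z inferInstance]) ω)
      * (kY t2 (Y ω) -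
          (μ[fun ω' => kY t2 (Y ω') | MeasurableSpace.comap Z inferInstance]) ω) ∂μ

/-- Cramér–Wold characterization: `ν` is the centered Gaussian measure on `ℝ^J` with
covariance matrix `S`. -/
def IsCenteredGaussian {J : ℕ} (S : Matrix (Fin J) (Fin J) ℝ) (ν : Measure (Fin J → ℝ)) : Prop :=
  IsProbabilityMeasure ν ∧
    ∀ a : Fin J → ℝ,
      ν.map (fun v => ∑ j, a j * v j) =
        gaussianReal 0 (Real.toNNReal (∑ i, ∑ j, a i * S i j * a j))

/-- Convergence in distribution (weak convergence of the image laws). -/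
def TendstoInDistribution {Ω : Type*} [MeasurableSpace Ω] (μ : Measure Ω) {E : Type*}
    [TopologicalSpace E] [MeasurableSpace E] (W : ℕ → Ω → E) (ν : Measure E) : Prop :=
  ∀ f : BoundedContinuousFunction E ℝ,
    Tendsto (fun n : ℕ => ∫ ω, f (W n ω) ∂μ) atTop (𝓝 (∫ x, f x ∂ν))

/-- The one-sample statistic `u_i(j)` of the paper (oracle version), where `e1`, `e2` are
the conditional mean functions. -/
def uStat {Ω DX DZ DY : Type*} (kX : DX × DZ → DX × DZ → ℝ) (kY : DY → DY → ℝ)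
    (e1 : DX × DZ → DZ → ℝ) (e2 : DY → DZ → ℝ)
    (xS : ℕ → Ω → DX) (zS : ℕ → Ω → DZ) (yS : ℕ → Ω → DY)
    {J : ℕ} (t : Fin J → (DX × DZ) × DY) (i : ℕ) (j : Fin J) (ω : Ω) : ℝ :=
  (kX (t j).1 (xS i ω, zS i ω) - e1 (t j).1 (zS i ω)) *
    (kY (t j).2 (yS i ω) - e2 (t j).2 (zS i ω))

/-- `S_n`, the empirical mean of the `u_i`. -/
def SStat {Ω DX DZ DY : Type*} (kX : DX × DZ → DX × DZ → ℝ) (kY : DY → DY → ℝ)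
    (e1 : DX × DZ → DZ → ℝ) (e2 : DY → DZ → ℝ)
    (xS : ℕ → Ω → DX) (zS : ℕ → Ω → DZ) (yS : ℕ → Ω → DY)
    {J : ℕ} (t : Fin J → (DX × DZ) × DY) (n : ℕ) (ω : Ω) : Fin J → ℝ :=
  fun j => (n : ℝ)⁻¹ * ∑ i ∈ Finset.range n, uStat kX kY e1 e2 xS zS yS t i j ω

/-- The covariance matrix `Σ = E[u₁ u₁ᵀ]`. -/
def covMat {Ω DX DZ DY : Type*} [MeasurableSpace Ω] (μ : Measure Ω)
    (kX : DX × DZ → DX × DZ → ℝ) (kY : DY → DY → ℝ)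
    (e1 : DX × DZ → DZ → ℝ) (e2 : DY → DZ → ℝ)
    (xS : ℕ → Ω → DX) (zS : ℕ → Ω → DZ) (yS : ℕ → Ω → DY)
    {J : ℕ} (t : Fin J → (DX × DZ) × DY) : Matrix (Fin J) (Fin J) ℝ :=
  Matrix.of fun j j' =>
    ∫ ω, uStat kX kY e1 e2 xS zS yS t 0 j ω * uStat kX kY e1 e2 xS zS yS t 0 j' ω ∂μ

/-- The empirical covariance matrix `Σ̂_n` of the oracle `u_i`. -/
def covHat {Ω DX DZ DY : Type*} (kX : DX × DZ → DX × DZ → ℝ) (kY : DY → DY → ℝ)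
    (e1 : DX × DZ → DZ → ℝ) (e2 : DY → DZ → ℝ)
    (xS : ℕ → Ω → DX) (zS : ℕ → Ω → DZ) (yS : ℕ → Ω → DY)
    {J : ℕ} (t : Fin J → (DX × DZ) × DY) (n : ℕ) (ω : Ω) : Matrix (Fin J) (Fin J) ℝ :=
  Matrix.of fun j j' => (n : ℝ)⁻¹ * ∑ i ∈ Finset.range n,
    uStat kX kY e1 e2 xS zS yS t i j ω * uStat kX kY e1 e2 xS zS yS t i j' ω

/-- The regularized least squares estimator built from the first `r` samples `zs` with
targets `target`, kernel `kZ` and regularization parameter `lam`. -/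
def rls {DZ : Type*} (kZ : DZ → DZ → ℝ) (zs : ℕ → DZ) (target : ℕ → ℝ)
    (r : ℕ) (lam : ℝ) (z : DZ) : ℝ :=
  ∑ i : Fin r,
    (((Matrix.of fun i l : Fin r => kZ (zs i) (zs l)) +
        ((r : ℝ) * lam) • (1 : Matrix (Fin r) (Fin r) ℝ))⁻¹.mulVec
      fun i : Fin r => target i) i * kZ (zs i) z

/-- The statistic `ũ_{i,r}(j)` built from the RLS estimators. -/
def uTildeStat {Ω DX DZ DY : Type*} (kX : DX × DZ → DX × DZ → ℝ) (kY : DY → DY → ℝ)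
    {J : ℕ} (kZ1 kZ2 : Fin J → DZ → DZ → ℝ)
    (xS : ℕ → Ω → DX) (zS : ℕ → Ω → DZ) (yS : ℕ → Ω → DY)
    (t : Fin J → (DX × DZ) × DY) (r : ℕ) (lam : ℝ) (i : ℕ) (j : Fin J) (ω : Ω) : ℝ :=
  (kX (t j).1 (xS i ω, zS i ω) -
      rls (kZ1 j) (fun l => zS l ω) (fun l => kX (t j).1 (xS l ω, zS l ω)) r lam (zS i ω)) *
    (kY (t j).2 (yS i ω) -
      rls (kZ2 j) (fun l => zS l ω) (fun l => kY (t j).2 (yS l ω)) r lam (zS i ω))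

/-- `S̃_{n,r}`. -/
def STilde {Ω DX DZ DY : Type*} (kX : DX × DZ → DX × DZ → ℝ) (kY : DY → DY → ℝ)
    {J : ℕ} (kZ1 kZ2 : Fin J → DZ → DZ → ℝ)
    (xS : ℕ → Ω → DX) (zS : ℕ → Ω → DZ) (yS : ℕ → Ω → DY)
    (t : Fin J → (DX × DZ) × DY) (n r : ℕ) (lam : ℝ) (ω : Ω) : Fin J → ℝ :=
  fun j => (n : ℝ)⁻¹ * ∑ i ∈ Finset.range n,
    uTildeStat kX kY kZ1 kZ2 xS zS yS t r lam i j ω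

/-- `Σ_{n,r}`, the empirical covariance matrix of the `ũ_{i,r}`. -/
def covTilde {Ω DX DZ DY : Type*} (kX : DX × DZ → DX × DZ → ℝ) (kY : DY → DY → ℝ)
    {J : ℕ} (kZ1 kZ2 : Fin J → DZ → DZ → ℝ)
    (xS : ℕ → Ω → DX) (zS : ℕ → Ω → DZ) (yS : ℕ → Ω → DY)
    (t : Fin J → (DX × DZ) × DY) (n r : ℕ) (lam : ℝ) (ω : Ω) : Matrix (Fin J) (Fin J) ℝ :=
  Matrix.of fun j j' => (n : ℝ)⁻¹ * ∑ i ∈ Finset.range n,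
    uTildeStat kX kY kZ1 kZ2 xS zS yS t r lam i j ω *
      uTildeStat kX kY kZ1 kZ2 xS zS yS t r lam i j' ω

open scoped Classical in
/-- The inverse square root `M^{-1/2}` of a positive semidefinite matrix. -/
def invSqrtMat {J : ℕ} (M : Matrix (Fin J) (Fin J) ℝ) : Matrix (Fin J) (Fin J) ℝ :=
  if h : M.PosSemidef then
    (h.1.eigenvectorUnitary.1 * Matrix.diagonal ((↑) ∘ Real.sqrt ∘ h.1.eigenvalues) *
      (star h.1.eigenvectorUnitary : Matrix (Fin J) (Fin J) ℝ))⁻¹ else 0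

/-- The chi-square distribution with `J` degrees of freedom, realized as the law of the sum of
squares of `J` independent standard Gaussians. -/
def chiSq (J : ℕ) : Measure ℝ :=
  (Measure.pi fun _ : Fin J => gaussianReal 0 1).map fun v => ∑ j, v j ^ 2

/-- Assumption 2 of the paper for the operator `L` on `L²(P_Z)` :
`Tr((L + λ)⁻¹ L) ≤ Q λ^{-γ}`, the trace of the positive operator being computed in any
Hilbert basis. -/
def TraceAssumption {DZ : Type*} [MeasurableSpace DZ] (PZ : Measure DZ)
    (L : Lp ℝ 2 PZ →L[ℝ] Lp ℝ 2 PZ) (Q γ : ℝ) : Prop :=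
  ∀ lam : ℝ, 0 < lam → ∀ (ι : Type) (e : HilbertBasis ι ℝ (Lp ℝ 2 PZ)),
    ∑' i, ⟪(Ring.inverse (L + lam • (1 : Lp ℝ 2 PZ →L[ℝ] Lp ℝ 2 PZ)) * L) (e i), e i⟫ ≤
      Q * lam ^ (-γ)

/-- `P = L^s` : `P` is self-adjoint and acts as `c ^ s` on every eigenvector of `L`
(this determines the fractional power, via functional calculus, of a positive self-adjoint
compact operator). -/
def IsFracPower {H : Type*} [NormedAddCommGroup H] [InnerProductSpace ℝ H]
    (L : H →L[ℝ] H) (s : ℝ) (P : H →L[ℝ] H) : Prop :=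
  (∀ v w : H, ⟪P v, w⟫ = ⟪v, P w⟫) ∧
    ∀ (c : ℝ) (v : H), L v = c • v → P v = c ^ s • v

end CIPaper

open CIPaper


section

namespace CIProof

lemma posdef_fintype {D ι : Type*} [Fintype ι] {k : D → D → ℝ} (hk : PosDefKernel k)
    (x : ι → D) (c : ι → ℝ) : 0 ≤ ∑ i, ∑ j, c i * c j * k (x i) (x j) := by
  have e := Fintype.equivFin ι
  have h := hk (Fintype.card ι) (fun i => x (e.symm i)) (fun i => c (e.symm i))
  rw [← e.symm.sum_comp]
  simp_rw [← e.symm.sum_comp (fun j => _ * c j * k _ (x j))]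
  exact h

lemma posdef_finset {D : Type*} {k : D → D → ℝ} (hk : PosDefKernel k)
    (s : Finset D) (c : D → ℝ) : 0 ≤ ∑ i ∈ s, ∑ j ∈ s, c i * c j * k i j := by
  have h := posdef_fintype hk (fun i : s => (i : D)) (fun i => c i)
  rw [← Finset.sum_coe_sort]
  refine h.trans_eq (Finset.sum_congr rfl fun i _ => ?_)
  exact Finset.sum_coe_sort s (fun j => c i * c j * k i j)

lemma exists_feature {D : Type} [TopologicalSpace D] [TopologicalSpace.SeparableSpace D]
    (k : D → D → ℝ) (hpd : PosDefKernel k) (hs : ∀ x y, k x y = k y x)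
    (hc : Continuous fun q : D × D => k q.1 q.2) :
    ∃ (H : Type) (_ : NormedAddCommGroup H) (_ : InnerProductSpace ℝ H) (_ : CompleteSpace H)
      (_ : TopologicalSpace.SeparableSpace H) (φ : D → H), Continuous φ ∧
        ∀ z z', ⟪φ z, φ z'⟫ = k z z' := by
  let K : Matrix D D (ℝ →L[ℝ] ℝ) := Matrix.of fun x y => k x y • ContinuousLinearMap.id ℝ ℝ
  have hK : K.PosSemidef := by
    have htf := (RKHS.posSemidef_tfae (K := K)).out 0 2
    refine htf.mpr ⟨?_, ?_⟩
    · ext x y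
      have h1 : star (ContinuousLinearMap.id ℝ ℝ) = ContinuousLinearMap.id ℝ ℝ :=
        star_one (ℝ →L[ℝ] ℝ)
      simp [K, hs x y, h1]
    · intro vv
      have := posdef_finset hpd vv.support (fun i => vv i)
      refine this.trans_eq ?_
      simp only [Finsupp.sum, K, Matrix.of_apply, FunLike.coe_smul, Pi.smul_apply]
      simp only [ContinuousLinearMap.id_apply, smul_eq_mul, RCLike.re_to_real]
      refine Finset.sum_congr rfl fun i _ => Finset.sum_congr rfl fun j _ => ?_
      rw [hs i j]
      simp
      ring
  have : Fact K.PosSemidef := ⟨hK⟩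
  let φ : D → RKHS.OfKernel K := fun z => RKHS.kerFun (RKHS.OfKernel K) z 1
  have hin : ∀ z z', ⟪φ z, φ z'⟫ = k z z' := by
    intro z z'
    have := RKHS.kernel_inner (H := RKHS.OfKernel K) z' z (1:ℝ) 1
    rw [RKHS.OfKernel.kernel_ofKernel] at this
    simp only [φ]
    rw [← this]
    simp [K, hs z z']
  have hcont : Continuous φ := by
    rw [continuous_iff_continuousAt]
    intro z
    rw [ContinuousAt, tendsto_iff_norm_sub_tendsto_zero]
    have h2 : ∀ z', ‖φ z' - φ z‖ = Real.sqrt (k z' z' - 2 * k z' z + k z z) := by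
      intro z'
      rw [← Real.sqrt_sq (norm_nonneg (φ z' - φ z))]
      congr 1
      rw [norm_sub_sq_real, hin, ← real_inner_self_eq_norm_sq, ← real_inner_self_eq_norm_sq,
        hin, hin]
    simp_rw [h2]
    have h3 : Continuous fun z' => Real.sqrt (k z' z' - 2 * k z' z + k z z) := by
      have h4 : Continuous fun z' => k z' z' := hc.comp (continuous_id.prodMk continuous_id)
      have h5 : Continuous fun z' => k z' z := hc.comp (continuous_id.prodMk continuous_const)
      fun_prop
    have := h3.tendsto z
    convert this using 2
    rw [show k z z - 2 * k z z + k z z = 0 by ring, Real.sqrt_zero]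
  have hsep : TopologicalSpace.SeparableSpace (RKHS.OfKernel K) := by
    have hd := RKHS.kerFun_dense (RKHS.OfKernel K)
    have h1 : TopologicalSpace.IsSeparable (Set.range φ) := TopologicalSpace.isSeparable_range hcont
    have h2 := (h1.span (R := ℝ)).closure
    have h3 : Submodule.span ℝ {x | ∃ (x_1 : D) (v : ℝ), (RKHS.kerFun (RKHS.OfKernel K) x_1) v = x}
        ≤ Submodule.span ℝ (Set.range φ) := by
      rw [Submodule.span_le]
      rintro _ ⟨x, v, rfl⟩
      have : (RKHS.kerFun (RKHS.OfKernel K) x) v = v • φ x := by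
        simp only [φ]
        rw [← map_smul]; simp
      rw [this]
      exact Submodule.smul_mem _ _ (Submodule.subset_span ⟨x, rfl⟩)
    have h4 : closure (Submodule.span ℝ (Set.range φ) : Set (RKHS.OfKernel K)) = Set.univ := by
      rw [Set.eq_univ_iff_forall]
      intro y
      have : y ∈ (Submodule.span ℝ {x | ∃ (x_1 : D) (v : ℝ),
        (RKHS.kerFun (RKHS.OfKernel K) x_1) v = x}).topologicalClosure := by
        rw [hd]; trivial
      exact closure_mono h3 this
    rw [h4] at h2
    exact TopologicalSpace.isSeparable_univ_iff.mp h2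
  exact ⟨RKHS.OfKernel K, inferInstance, inferInstance, inferInstance, hsep, φ, hcont, hin⟩

end CIProof
end

section

namespace CIProof
open Matrix

variable {ι : Type*} [Fintype ι] [DecidableEq ι]

/-- Regularised kernel matrix. -/
def Mm (K : Matrix ι ι ℝ) (c : ℝ) : Matrix ι ι ℝ := K + c • 1
/-- Its inverse. -/
def Rm (K : Matrix ι ι ℝ) (c : ℝ) : Matrix ι ι ℝ := (Mm K c)⁻¹
/-- The hat matrix. -/
def Hm (K : Matrix ι ι ℝ) (c : ℝ) : Matrix ι ι ℝ := 1 - c • Rm K c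

/-- Symmetric psd. -/
structure SPD (K : Matrix ι ι ℝ) : Prop where
  symm : Kᵀ = K
  nonneg : ∀ v : ι → ℝ, 0 ≤ v ⬝ᵥ K *ᵥ v

set_option linter.unusedSectionVars false
variable {K : Matrix ι ι ℝ} {c : ℝ}

lemma dotProduct_self_nonneg (v : ι → ℝ) : 0 ≤ v ⬝ᵥ v :=
  Finset.sum_nonneg fun i _ => mul_self_nonneg (v i)

lemma symm_dot {A : Matrix ι ι ℝ} (hA : Aᵀ = A) (u v : ι → ℝ) :
    u ⬝ᵥ A *ᵥ v = (A *ᵥ u) ⬝ᵥ v := by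
  rw [dotProduct_mulVec, ← mulVec_transpose, hA]

lemma SPD.Mm_isUnit (hK : SPD K) (hc : 0 < c) : IsUnit (Mm K c) := by
  rw [← mulVec_injective_iff_isUnit]
  suffices h : ∀ v, (Mm K c) *ᵥ v = 0 → v = 0 from
    (injective_iff_map_eq_zero (Mm K c).mulVecLin).mpr h
  intro v hv
  have h1 : v ⬝ᵥ (Mm K c) *ᵥ v = 0 := by
    have : (Mm K c) *ᵥ v = 0 := hv
    rw [this]; simp
  rw [Mm, add_mulVec, dotProduct_add, smul_mulVec, one_mulVec, dotProduct_smul, smul_eq_mul] at h1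
  have h2 := hK.nonneg v
  have h3 : 0 ≤ v ⬝ᵥ v := dotProduct_self_nonneg v
  have h4 : v ⬝ᵥ v = 0 := by nlinarith [mul_nonneg hc.le h3]
  exact dotProduct_self_eq_zero.mp h4

lemma SPD.M_R (hK : SPD K) (hc : 0 < c) : Mm K c * Rm K c = 1 :=
  Matrix.mul_nonsing_inv _ ((Matrix.isUnit_iff_isUnit_det _).mp (hK.Mm_isUnit hc))

lemma SPD.R_M (hK : SPD K) (hc : 0 < c) : Rm K c * Mm K c = 1 :=
  Matrix.nonsing_inv_mul _ ((Matrix.isUnit_iff_isUnit_det _).mp (hK.Mm_isUnit hc))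

lemma SPD.M_symm (hK : SPD K) : (Mm K c)ᵀ = Mm K c := by
  simp [Mm, hK.symm]

lemma SPD.R_symm (hK : SPD K) : (Rm K c)ᵀ = Rm K c := by
  rw [Rm, Matrix.transpose_nonsing_inv, hK.M_symm]

lemma SPD.H_symm (hK : SPD K) : (Hm K c)ᵀ = Hm K c := by
  simp [Hm, hK.R_symm]

lemma SPD.K_R (hK : SPD K) (hc : 0 < c) : K * Rm K c = Hm K c := by
  have := hK.M_R hc
  rw [Mm, add_mul] at this
  rw [Hm, ← this]; simp

lemma SPD.R_K (hK : SPD K) (hc : 0 < c) : Rm K c * K = Hm K c := by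
  have := hK.R_M hc
  rw [Mm, mul_add] at this
  rw [Hm, ← this]; simp

lemma Mm_mulVec (v : ι → ℝ) : Mm K c *ᵥ v = K *ᵥ v + c • v := by
  simp [Mm, add_mulVec, smul_mulVec]

lemma SPD.exists_pre (hK : SPD K) (hc : 0 < c) (v : ι → ℝ) :
    ∃ u, v = K *ᵥ u + c • u ∧ Rm K c *ᵥ v = u ∧ Hm K c *ᵥ v = K *ᵥ u := by
  refine ⟨Rm K c *ᵥ v, ?_, rfl, ?_⟩
  · rw [← Mm_mulVec, mulVec_mulVec, hK.M_R hc, one_mulVec]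
  · rw [mulVec_mulVec, hK.K_R hc]

/-- `‖Hv‖² ≤ vᵀHv`. -/
lemma SPD.H_sq_le (hK : SPD K) (hc : 0 < c) (v : ι → ℝ) :
    (Hm K c *ᵥ v) ⬝ᵥ (Hm K c *ᵥ v) ≤ v ⬝ᵥ Hm K c *ᵥ v := by
  obtain ⟨u, h1, -, h3⟩ := hK.exists_pre hc v
  rw [h3]
  nth_rw 1 [h1]
  rw [add_dotProduct, smul_dotProduct, smul_eq_mul]
  nlinarith [mul_nonneg hc.le (hK.nonneg u)]

lemma SPD.H_nonneg (hK : SPD K) (hc : 0 < c) (v : ι → ℝ) : 0 ≤ v ⬝ᵥ Hm K c *ᵥ v :=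
  (dotProduct_self_nonneg _).trans (hK.H_sq_le hc v)

/-- `‖cRv‖² ≤ c vᵀRv`. -/
lemma SPD.R_sq_le (hK : SPD K) (hc : 0 < c) (v : ι → ℝ) :
    (c • Rm K c *ᵥ v) ⬝ᵥ (c • Rm K c *ᵥ v) ≤ c * (v ⬝ᵥ Rm K c *ᵥ v) := by
  obtain ⟨u, h1, h2, -⟩ := hK.exists_pre hc v
  rw [h2]
  nth_rw 1 [h1]
  rw [add_dotProduct, smul_dotProduct, smul_dotProduct, dotProduct_smul, dotProduct_comm (K *ᵥ u) u]
  simp only [smul_eq_mul]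
  nlinarith [mul_nonneg hc.le (hK.nonneg u)]

lemma SPD.R_nonneg (hK : SPD K) (hc : 0 < c) (v : ι → ℝ) : 0 ≤ v ⬝ᵥ Rm K c *ᵥ v := by
  have h := (dotProduct_self_nonneg (c • Rm K c *ᵥ v)).trans (hK.R_sq_le hc v)
  by_contra h'
  nlinarith

lemma Hm_mulVec (v : ι → ℝ) : Hm K c *ᵥ v = v - c • Rm K c *ᵥ v := by
  simp [Hm, sub_mulVec, smul_mulVec]

lemma SPD.H_le (hK : SPD K) (hc : 0 < c) (v : ι → ℝ) : v ⬝ᵥ Hm K c *ᵥ v ≤ v ⬝ᵥ v := by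
  rw [Hm_mulVec, dotProduct_sub, dotProduct_smul, smul_eq_mul]
  nlinarith [mul_nonneg hc.le (hK.R_nonneg hc v)]

lemma SPD.cR_le (hK : SPD K) (hc : 0 < c) (v : ι → ℝ) :
    (c • Rm K c *ᵥ v) ⬝ᵥ (c • Rm K c *ᵥ v) ≤ v ⬝ᵥ v := by
  refine (hK.R_sq_le hc v).trans ?_
  have := hK.H_nonneg hc v
  rw [Hm_mulVec, dotProduct_sub, dotProduct_smul, smul_eq_mul] at this
  linarith

lemma SPD.H_contr (hK : SPD K) (hc : 0 < c) (v : ι → ℝ) :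
    (Hm K c *ᵥ v) ⬝ᵥ (Hm K c *ᵥ v) ≤ v ⬝ᵥ v := (hK.H_sq_le hc v).trans (hK.H_le hc v)

lemma col_apply (A : Matrix ι ι ℝ) (a b : ι) : (A *ᵥ Pi.single a 1) b = A b a := by simp

lemma SPD.H_col (hK : SPD K) (hc : 0 < c) (a : ι) : ∑ b, Hm K c b a ^ 2 ≤ Hm K c a a := by
  have := hK.H_sq_le hc (Pi.single a 1)
  rw [single_one_dotProduct] at this
  simpa [dotProduct, sq] using this

lemma SPD.H2_col (hK : SPD K) (hc : 0 < c) (a : ι) :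
    ∑ b, (Hm K c * Hm K c) b a ^ 2 ≤ ∑ b, Hm K c b a ^ 2 := by
  have := hK.H_contr hc (Hm K c *ᵥ Pi.single a 1)
  rw [mulVec_mulVec] at this
  simpa [dotProduct, sq] using this

lemma SPD.H_diag_nonneg (hK : SPD K) (hc : 0 < c) (a : ι) : 0 ≤ Hm K c a a :=
  (Finset.sum_nonneg fun _ _ => sq_nonneg _).trans (hK.H_col hc a)

lemma SPD.H_diag_le (hK : SPD K) (hc : 0 < c) (a : ι) : Hm K c a a ≤ 1 := by
  have := hK.H_le hc (Pi.single a 1)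
  simpa using this

/-- variational bound for the diagonal of the hat matrix -/
lemma SPD.H_diag_var (hK : SPD K) (hc : 0 < c) (a : ι) (w : ι → ℝ) :
    Hm K c a a ≤ c⁻¹ * ((Pi.single a 1 - w) ⬝ᵥ K *ᵥ (Pi.single a 1 - w)) + w ⬝ᵥ w := by
  set e : ι → ℝ := Pi.single a 1 with he
  have h1 : Hm K c a a = e ⬝ᵥ Hm K c *ᵥ e := by simp [he]
  obtain ⟨u, hu, -, h3⟩ := hK.exists_pre hc e
  rw [h1, h3]
  set d := w - K *ᵥ u with hd
  have hw : w = K *ᵥ u + d := by simp [hd]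
  have hew : e - w = c • u - d := by rw [hw]; nth_rw 1 [hu]; abel
  have hs : d ⬝ᵥ K *ᵥ u = u ⬝ᵥ K *ᵥ d := by
    rw [symm_dot hK.symm u d, dotProduct_comm]
  have hp := hK.nonneg d
  have hp2 := dotProduct_self_nonneg d
  rw [hew, hw]
  nth_rw 1 [hu]
  simp only [mulVec_sub, mulVec_smul, add_dotProduct, sub_dotProduct, dotProduct_sub,
    dotProduct_add, smul_dotProduct, dotProduct_smul, smul_eq_mul]
  rw [dotProduct_comm (K *ᵥ u) d, hs]
  have : c⁻¹ * (c * (c * u ⬝ᵥ K *ᵥ u) - c * u ⬝ᵥ K *ᵥ d - (c * u ⬝ᵥ K *ᵥ d - d ⬝ᵥ K *ᵥ d))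
     = c * (u ⬝ᵥ K *ᵥ u) - 2 * u ⬝ᵥ K *ᵥ d + c⁻¹ * d ⬝ᵥ K *ᵥ d := by
    field_simp; ring
  have h4 : 0 ≤ c⁻¹ * d ⬝ᵥ K *ᵥ d := mul_nonneg (inv_nonneg.mpr hc.le) hp
  nlinarith

lemma SPD.s_bound (hK : SPD K) (hc : 0 < c) (o : ι) (v : ι → ℝ)
    (hv : v ⬝ᵥ Mm K c *ᵥ v = - (Mm K c *ᵥ v) o) :
    0 ≤ -(Mm K c *ᵥ v) o ∧ -(Mm K c *ᵥ v) o ≤ K o o + c := by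
  have hp : ∀ u : ι → ℝ, 0 ≤ u ⬝ᵥ Mm K c *ᵥ u := by
    intro u
    rw [Mm_mulVec, dotProduct_add, dotProduct_smul, smul_eq_mul]
    have := hK.nonneg u
    have := dotProduct_self_nonneg u
    positivity
  refine ⟨hv ▸ hp v, ?_⟩
  have h := hp (v + Pi.single o 1)
  rw [mulVec_add, dotProduct_add, add_dotProduct, add_dotProduct,
    symm_dot hK.M_symm v (Pi.single o 1), hv,
    single_one_dotProduct, single_one_dotProduct, dotProduct_single_one, col_apply] at h
  have : Mm K c o o = K o o + c := by simp [Mm]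
  linarith

lemma SPD.R_M_vec (hK : SPD K) (hc : 0 < c) (v : ι → ℝ) : Rm K c *ᵥ (Mm K c *ᵥ v) = v := by
  rw [mulVec_mulVec, hK.R_M hc, one_mulVec]

/-- one point leave-one-out -/
lemma SPD.loo (hK : SPD K) (hc : 1 ≤ c) {κ : ℝ} (o : ι) (hκ : K o o ≤ κ) (v : ι → ℝ)
    (hvo : v o = -1) (hv : ∀ a, a ≠ o → (Mm K c *ᵥ v) a = 0) :
    ∃ s : ℝ, 0 ≤ s ∧ s ≤ 1 + κ ∧ (∀ a, v a = -(s * (c • Rm K c *ᵥ Pi.single o 1) a)) := by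
  have hc0 : 0 < c := by linarith
  have hM : Mm K c *ᵥ v = Pi.single o ((Mm K c *ᵥ v) o) := by
    ext a
    by_cases h : a = o
    · subst h; simp
    · rw [hv a h, Pi.single_eq_of_ne h]
  have h1 : v ⬝ᵥ Mm K c *ᵥ v = - (Mm K c *ᵥ v) o := by
    nth_rw 1 [hM]
    rw [dotProduct_single, hvo]; ring
  obtain ⟨h2, h3⟩ := hK.s_bound hc0 o v h1
  have hκ0 : 0 ≤ κ := by
    have := hK.nonneg (Pi.single o 1)
    rw [single_one_dotProduct, col_apply] at this
    linarith
  refine ⟨-(Mm K c *ᵥ v) o / c, by positivity, ?_, ?_⟩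
  · rw [div_le_iff₀ hc0]
    nlinarith
  · intro a
    have h4 := hK.R_M_vec hc0 v
    rw [hM] at h4
    nth_rw 1 [← h4]
    have : (Pi.single o ((Mm K c *ᵥ v) o) : ι → ℝ) = ((Mm K c *ᵥ v) o) • Pi.single o 1 := by
      ext a; simp [Pi.single_apply]
    rw [this, mulVec_smul]
    simp only [Pi.smul_apply, smul_eq_mul]
    field_simp

lemma SPD.loo_norm (hK : SPD K) (hc : 1 ≤ c) {κ : ℝ} (o : ι) (hκ : K o o ≤ κ) (v : ι → ℝ)
    (hvo : v o = -1) (hv : ∀ a, a ≠ o → (Mm K c *ᵥ v) a = 0) :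
    v ⬝ᵥ v - 1 ≤ (1 + κ) ^ 2 * Hm K c o o := by
  have hc0 : 0 < c := by linarith
  obtain ⟨s, hs0, hs1, hs⟩ := hK.loo hc o hκ v hvo hv
  have h1 : ∀ a, a ≠ o → v a = s * Hm K c a o := by
    intro a ha
    rw [hs a]
    simp [Hm, ha]
  have h2 : v ⬝ᵥ v - 1 = ∑ a ∈ Finset.univ.erase o, v a ^ 2 := by
    rw [dotProduct, ← Finset.add_sum_erase _ _ (Finset.mem_univ o), hvo]
    simp [sq]
  rw [h2]
  have h3 : ∑ a ∈ Finset.univ.erase o, v a ^ 2 ≤ s ^ 2 * ∑ a, Hm K c a o ^ 2 := by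
    rw [Finset.mul_sum]
    rw [← Finset.add_sum_erase (a := o) _ _ (Finset.mem_univ o)]
    have : ∑ a ∈ Finset.univ.erase o, v a ^ 2 = ∑ a ∈ Finset.univ.erase o, s ^ 2 * Hm K c a o ^ 2 :=
      Finset.sum_congr rfl fun a ha => by rw [h1 a (Finset.ne_of_mem_erase ha)]; ring
    rw [this]
    have : 0 ≤ s ^ 2 * Hm K c o o ^ 2 := by positivity
    linarith
  refine h3.trans ?_
  have := hK.H_diag_nonneg hc0 o
  have h5 := hK.H_col hc0 o
  calc _ ≤ s ^ 2 * Hm K c o o := by gcongr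
    _ ≤ _ := by gcongr

lemma SPD.loo_res (hK : SPD K) (hc : 1 ≤ c) {κ : ℝ} (o : ι) (hκ : K o o ≤ κ) (v : ι → ℝ)
    (hvo : v o = -1) (hv : ∀ a, a ≠ o → (Mm K c *ᵥ v) a = 0) (e : ι → ℝ) :
    (v ⬝ᵥ e) ^ 2 ≤ (1 + κ) ^ 2 * ((c • Rm K c *ᵥ e) o) ^ 2 := by
  obtain ⟨s, hs0, hs1, hs⟩ := hK.loo hc o hκ v hvo hv
  have h1 : v = (-s) • (c • Rm K c *ᵥ Pi.single o 1) := by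
    ext a; rw [hs a]; simp
  have h2 : v ⬝ᵥ e = -s * (c • Rm K c *ᵥ e) o := by
    rw [h1, smul_dotProduct, smul_dotProduct, ← symm_dot hK.R_symm, single_one_dotProduct]
    simp
  rw [h2, mul_pow, neg_sq]
  gcongr

lemma cR_single (a b : ι) : (c • Rm K c *ᵥ Pi.single a 1) b = (1 : Matrix ι ι ℝ) b a - Hm K c b a := by
  simp [Hm]

/-- half of the two point analysis -/
lemma SPD.two_aux (hK : SPD K) (hc : 1 ≤ c) {κ : ℝ} (o p : ι) (hop : o ≠ p) (hκ : K o o ≤ κ)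
    (hκp : K p p ≤ κ)
    (v : ι → ℝ) (hvo : v o = -1) (hvp : v p = 0)
    (hv : ∀ a, a ≠ o → a ≠ p → (Mm K c *ᵥ v) a = 0) :
    ∃ s q : ℝ, |s| ≤ 1 + κ ∧ |q| ≤ (1 + κ) ^ 2 * |Hm K c o p| ∧
      v = c • Rm K c *ᵥ (s • Pi.single o 1 + q • Pi.single p 1) := by
  have hc0 : 0 < c := by linarith
  have hκ0 : 0 ≤ κ := by
    have := hK.nonneg (Pi.single o 1)
    rw [single_one_dotProduct, col_apply] at this
    linarith
  set g := Mm K c *ᵥ v with hg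
  have hM : g = g o • Pi.single o 1 + g p • Pi.single p 1 := by
    ext a
    by_cases h : a = o
    · subst h; simp [hop]
    by_cases h' : a = p
    · subst h'; simp [h]
    · rw [hv a h h']; simp [h, h']
  have h1 : v ⬝ᵥ g = - g o := by
    rw [hM, dotProduct_add, dotProduct_smul, dotProduct_smul, dotProduct_single_one,
      dotProduct_single_one, hvo, hvp]; simp [hop]
  obtain ⟨h2, h3⟩ := hK.s_bound hc0 o v h1
  have hve : v = c • Rm K c *ᵥ ((g o / c) • Pi.single o 1 + (g p / c) • Pi.single p 1) := by
    nth_rw 1 [← hK.R_M_vec hc0 v]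
    rw [← mulVec_smul]
    congr 1
    rw [← hg]
    nth_rw 1 [hM]
    rw [smul_add, smul_smul, smul_smul, mul_div_cancel₀ _ hc0.ne', mul_div_cancel₀ _ hc0.ne']
  have hs : |g o / c| ≤ 1 + κ := by
    rw [abs_div, abs_of_pos hc0, div_le_iff₀ hc0, abs_of_nonpos (by linarith)]
    nlinarith
  refine ⟨g o / c, g p / c, hs, ?_, hve⟩
  have hp0 : (0:ℝ) = (c • Rm K c *ᵥ ((g o / c) • Pi.single o 1 + (g p / c) • Pi.single p 1)) p := by
    rw [← hve, hvp]
  rw [mulVec_add, smul_add, mulVec_smul, mulVec_smul, smul_comm c, smul_comm c] at hp0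
  simp only [Pi.add_apply, Pi.smul_apply (g o / c), Pi.smul_apply (g p / c), cR_single] at hp0
  simp only [smul_eq_mul, one_apply_eq, one_apply_ne hop.symm] at hp0
  have hsym : Hm K c p o = Hm K c o p := by
    have := congrFun (congrFun (hK.H_symm (c := c)) o) p
    simpa using this
  rw [hsym] at hp0
  -- lower bound of the diagonal
  have hD : 1 ≤ (1 + κ) * (1 - Hm K c p p) := by
    set d := c • Rm K c *ᵥ (Pi.single p 1 : ι → ℝ) with hd
    have hMd : Mm K c *ᵥ d = c • Pi.single p 1 := by
      rw [hd, mulVec_smul, mulVec_mulVec, hK.M_R hc0, one_mulVec]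
    have hdp : d p = 1 - Hm K c p p := by rw [hd, cR_single, one_apply_eq]
    have hp : ∀ u : ι → ℝ, 0 ≤ u ⬝ᵥ Mm K c *ᵥ u := by
      intro u
      rw [Mm_mulVec, dotProduct_add, dotProduct_smul, smul_eq_mul]
      have := hK.nonneg u
      have := dotProduct_self_nonneg u
      positivity
    have h := hp (Pi.single p 1 - (1 + κ) • d)
    have hMp : Mm K c p p = K p p + c := by simp [Mm]
    have hx : (Pi.single p 1 - (1 + κ) • d) ⬝ᵥ Mm K c *ᵥ (Pi.single p 1 - (1 + κ) • d)
       = K p p + c - 2 * (1 + κ) * c + (1 + κ) ^ 2 * c * (1 - Hm K c p p) := by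
      rw [mulVec_sub, mulVec_smul, hMd, dotProduct_sub, sub_dotProduct, sub_dotProduct,
        smul_dotProduct, symm_dot hK.M_symm d, hMd, single_one_dotProduct, col_apply,
        dotProduct_smul, dotProduct_smul, dotProduct_smul, dotProduct_smul,
        dotProduct_single_one, dotProduct_single_one, smul_dotProduct, dotProduct_single_one]
      simp only [Pi.smul_apply, smul_eq_mul, hdp, Pi.single_eq_same, hMp]
      ring
    rw [hx] at h
    have hb : K p p + c ≤ (1 + κ) * c := by nlinarith
    have hpos : 0 < (1 + κ) * c := by positivity
    have h6 : 0 ≤ ((1 + κ) * c) * ((1 + κ) * (1 - Hm K c p p) - 1) := by nlinarith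
    have := (mul_nonneg_iff_of_pos_left hpos).mp h6
    linarith
  have hq : |g p / c| * (1 - Hm K c p p) = |g o / c| * |Hm K c o p| := by
    have hH : 0 ≤ 1 - Hm K c p p := by linarith [hK.H_diag_le hc0 p]
    have h7 : |g p / c * (1 - Hm K c p p)| = |g o / c * Hm K c o p| := by congr 1; linarith
    rwa [abs_mul, abs_mul, abs_of_nonneg hH] at h7
  have hH : 0 ≤ 1 - Hm K c p p := by linarith [hK.H_diag_le hc0 p]
  calc |g p / c| = |g p / c| * 1 := by ring
    _ ≤ |g p / c| * ((1 + κ) * (1 - Hm K c p p)) := by gcongr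
    _ = (1 + κ) * (|g o / c| * |Hm K c o p|) := by rw [← hq]; ring
    _ ≤ (1 + κ) * ((1 + κ) * |Hm K c o p|) := by gcongr
    _ = _ := by ring

end CIProof
end

section

namespace CIProof
open Matrix
set_option linter.unusedSectionVars false
section
variable {ι : Type*} [Fintype ι] [DecidableEq ι]
variable {K : Matrix ι ι ℝ} {c : ℝ}

lemma SPD.H_abs_le (hK : SPD K) (hc : 0 < c) (a b : ι) : |Hm K c a b| ≤ 1 := by
  have h1 := hK.H_col hc b
  have h2 := hK.H_diag_le hc b
  have h3 : Hm K c a b ^ 2 ≤ ∑ a, Hm K c a b ^ 2 :=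
    Finset.single_le_sum (f := fun a => Hm K c a b ^ 2) (fun _ _ => sq_nonneg _) (Finset.mem_univ a)
  rw [abs_le_one_iff_mul_self_le_one]
  nlinarith

lemma SPD.two_point (hK : SPD K) (hc : 1 ≤ c) {κ : ℝ} (o p : ι) (hop : o ≠ p) (hκ : K o o ≤ κ)
    (hκp : K p p ≤ κ)
    (v : ι → ℝ) (hvo : v o = -1) (hvp : v p = 0)
    (hv : ∀ a, a ≠ o → a ≠ p → (Mm K c *ᵥ v) a = 0)
    (w : ι → ℝ) (hwo : w o = 0) (hwp : w p = -1)
    (hw : ∀ a, a ≠ o → a ≠ p → (Mm K c *ᵥ w) a = 0) :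
    (v ⬝ᵥ w) ^ 2 ≤ 72 * (1 + κ) ^ 8 * (Hm K c o p ^ 2 + (Hm K c * Hm K c) o p ^ 2) := by
  have hc0 : 0 < c := by linarith
  have hκ0 : 0 ≤ κ := by
    have := hK.nonneg (Pi.single o 1)
    rw [single_one_dotProduct, col_apply] at this
    linarith
  have hsym : Hm K c p o = Hm K c o p := by
    have := congrFun (congrFun (hK.H_symm (c := c)) o) p
    simpa using this
  obtain ⟨s1, q1, hs1, hq1, hv1⟩ := hK.two_aux hc o p hop hκ hκp v hvo hvp hv
  obtain ⟨s2, q2, hs2, hq2, hv2⟩ := hK.two_aux hc p o hop.symm hκp hκ w hwp hwo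
    (fun a h1 h2 => hw a h2 h1)
  rw [hsym] at hq2
  set d := c • Rm K c *ᵥ (Pi.single o 1 : ι → ℝ) with hd
  set f := c • Rm K c *ᵥ (Pi.single p 1 : ι → ℝ) with hf
  have e1 : v = s1 • d + q1 • f := by
    rw [hv1, mulVec_add, smul_add, mulVec_smul, mulVec_smul, smul_comm c, smul_comm c]
  have e2 : w = s2 • f + q2 • d := by
    rw [hv2, mulVec_add, smul_add, mulVec_smul, mulVec_smul, smul_comm c, smul_comm c]
  have hdd : |d ⬝ᵥ d| ≤ 1 := by
    rw [abs_of_nonneg (dotProduct_self_nonneg d)]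
    refine (hK.cR_le hc0 (Pi.single o 1)).trans ?_
    simp
  have hff : |f ⬝ᵥ f| ≤ 1 := by
    rw [abs_of_nonneg (dotProduct_self_nonneg f)]
    refine (hK.cR_le hc0 (Pi.single p 1)).trans ?_
    simp
  have hdf : d ⬝ᵥ f = - 2 * Hm K c o p + (Hm K c * Hm K c) o p := by
    have h1 : d = Pi.single o 1 - Hm K c *ᵥ Pi.single o 1 := by rw [Hm_mulVec]; simp [hd]
    have h2 : f = Pi.single p 1 - Hm K c *ᵥ Pi.single p 1 := by rw [Hm_mulVec]; simp [hf]
    rw [h1, h2, sub_dotProduct, dotProduct_sub, dotProduct_sub, single_one_dotProduct,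
      single_one_dotProduct, dotProduct_single_one, ← symm_dot hK.H_symm, mulVec_mulVec,
      single_one_dotProduct, col_apply, col_apply, col_apply, hsym, Pi.single_eq_of_ne hop]
    ring
  have hh := hK.H_abs_le hc0 o p
  set h := Hm K c o p
  set h2 := (Hm K c * Hm K c) o p
  set a := 1 + κ with ha
  have ha1 : 1 ≤ a := by linarith
  have hdf' : |d ⬝ᵥ f| ≤ 2 * |h| + |h2| := by
    rw [hdf]
    refine (abs_add_le _ _).trans ?_
    rw [abs_mul]; norm_num
  have hmain : |v ⬝ᵥ w| ≤ 6 * a ^ 4 * (|h| + |h2|) := by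
    have e : v ⬝ᵥ w = s1 * s2 * (d ⬝ᵥ f) + s1 * q2 * (d ⬝ᵥ d) + q1 * s2 * (f ⬝ᵥ f)
        + q1 * q2 * (d ⬝ᵥ f) := by
      rw [e1, e2]
      simp only [add_dotProduct, dotProduct_add, smul_dotProduct, dotProduct_smul, smul_eq_mul]
      rw [dotProduct_comm f d]; ring
    rw [e]
    have b0 : 0 ≤ |h| := abs_nonneg _
    have b2 : 0 ≤ |h2| := abs_nonneg _
    have t1 : |s1 * s2 * (d ⬝ᵥ f)| ≤ a * a * (2 * |h| + |h2|) := by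
      rw [abs_mul, abs_mul]; gcongr
    have t2 : |s1 * q2 * (d ⬝ᵥ d)| ≤ a * (a ^ 2 * |h|) * 1 := by
      rw [abs_mul, abs_mul]; gcongr
    have t3 : |q1 * s2 * (f ⬝ᵥ f)| ≤ (a ^ 2 * |h|) * a * 1 := by
      rw [abs_mul, abs_mul]; gcongr
    have t4 : |q1 * q2 * (d ⬝ᵥ f)| ≤ (a ^ 2 * 1) * (a ^ 2 * 1) * (2 * |h| + |h2|) := by
      rw [abs_mul, abs_mul]
      have := hq1.trans (mul_le_mul_of_nonneg_left hh (by positivity))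
      have := hq2.trans (mul_le_mul_of_nonneg_left hh (by positivity))
      gcongr
    have c2 : a * a ≤ a ^ 4 := by
      calc a * a = a ^ 2 := by ring
        _ ≤ a ^ 4 := pow_le_pow_right₀ ha1 (by norm_num)
    have c3 : a ^ 3 ≤ a ^ 4 := pow_le_pow_right₀ ha1 (by norm_num)
    calc _ ≤ |s1 * s2 * (d ⬝ᵥ f)| + |s1 * q2 * (d ⬝ᵥ d)| + |q1 * s2 * (f ⬝ᵥ f)|
        + |q1 * q2 * (d ⬝ᵥ f)| := by
          refine (abs_add_le _ _).trans ?_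
          gcongr
          refine (abs_add_le _ _).trans ?_
          gcongr
          exact abs_add_le _ _
      _ ≤ a * a * (2 * |h| + |h2|) + a * (a ^ 2 * |h|) * 1 + (a ^ 2 * |h|) * a * 1
          + (a ^ 2 * 1) * (a ^ 2 * 1) * (2 * |h| + |h2|) := by gcongr
      _ = a * a * (2 * |h| + |h2|) + 2 * a ^ 3 * |h| + a ^ 4 * (2 * |h| + |h2|) := by ring
      _ ≤ a ^ 4 * (2 * |h| + |h2|) + 2 * a ^ 4 * |h| + a ^ 4 * (2 * |h| + |h2|) := by gcongr
      _ ≤ _ := by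
        have : 0 ≤ a ^ 4 * |h2| := by positivity
        linarith
  calc (v ⬝ᵥ w) ^ 2 = |v ⬝ᵥ w| ^ 2 := (sq_abs _).symm
    _ ≤ (6 * a ^ 4 * (|h| + |h2|)) ^ 2 := by gcongr
    _ = 36 * a ^ 8 * (|h| + |h2|) ^ 2 := by ring
    _ ≤ 36 * a ^ 8 * (2 * (|h| ^ 2 + |h2| ^ 2)) := by gcongr; exact add_sq_le
    _ = _ := by rw [sq_abs, sq_abs]; ring

end

/-- kernel matrix -/
def kmat {D ι : Type*} (k : D → D → ℝ) (x : ι → D) : Matrix ι ι ℝ := Matrix.of fun i l => k (x i) (x l)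

variable {D : Type*} {k : D → D → ℝ}

lemma spd_kmat {ι : Type*} [Fintype ι] [DecidableEq ι] (hpd : PosDefKernel k)
    (hs : ∀ x y, k x y = k y x) (x : ι → D) :
    SPD (kmat k x) := by
  refine ⟨?_, fun v => ?_⟩
  · ext i j; simp [kmat, hs (x i) (x j)]
  · refine (posdef_fintype hpd x v).trans_eq ?_
    simp only [dotProduct, mulVec, kmat, Matrix.of_apply, Finset.mul_sum]
    refine Finset.sum_congr rfl fun i _ => Finset.sum_congr rfl fun j _ => ?_
    ring

/-- RLS weights -/
def wvec {ι : Type*} [Fintype ι] [DecidableEq ι] (k : D → D → ℝ) (c : ℝ) (x : ι → D) (z : D) :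
    ι → ℝ := Rm (kmat k x) c *ᵥ fun i => k (x i) z

section opt
variable {I : Type*} [Fintype I] [DecidableEq I]

lemma M_wvec (hpd : PosDefKernel k) (hs : ∀ x y, k x y = k y x) {c : ℝ} (hc : 0 < c)
    (x : I → D) (z : D) (i : I) :
    ∑ l, k (x i) (x l) * wvec k c x z l + c * wvec k c x z i = k (x i) z := by
  have h : Mm (kmat k x) c *ᵥ wvec k c x z = fun i => k (x i) z := by
    rw [wvec, mulVec_mulVec, (spd_kmat hpd hs x).M_R hc, one_mulVec]
  have := congrFun h i
  rw [Mm_mulVec] at this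
  simpa [mulVec, dotProduct, kmat] using this

/-- extension of the weights by -1 at the new point -/
def ext1 (w : I → ℝ) : Option I → ℝ := fun a => a.elim (-1) w

lemma ext1_prop (hpd : PosDefKernel k) (hs : ∀ x y, k x y = k y x) {c : ℝ} (hc : 0 < c)
    (x : Option I → D) (a : Option I) (ha : a ≠ none) :
    (Mm (kmat k x) c *ᵥ ext1 (wvec k c (fun i => x (some i)) (x none))) a = 0 := by
  obtain ⟨i, rfl⟩ := Option.ne_none_iff_exists'.mp ha
  have h := M_wvec hpd hs hc (fun i => x (some i)) (x none) i
  rw [Mm_mulVec]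
  simp only [mulVec, dotProduct, Pi.add_apply, Fintype.sum_option, ext1, Option.elim,
    kmat, Matrix.of_apply, Pi.smul_apply, smul_eq_mul]
  linarith

lemma wvec_norm (hpd : PosDefKernel k) (hs : ∀ x y, k x y = k y x) {c : ℝ} (hc : 1 ≤ c)
    {κ : ℝ} (hκ : ∀ z, k z z ≤ κ) (x : Option I → D) :
    ∑ i, wvec k c (fun i => x (some i)) (x none) i ^ 2 ≤ (1 + κ) ^ 2 * Hm (kmat k x) c none none := by
  have := (spd_kmat hpd hs x).loo_norm hc none (hκ (x none)) (ext1 _) rfl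
    (ext1_prop hpd hs (by linarith) x)
  refine le_trans (le_of_eq ?_) this
  simp [dotProduct, Fintype.sum_option, ext1, sq]

lemma wvec_res (hpd : PosDefKernel k) (hs : ∀ x y, k x y = k y x) {c : ℝ} (hc : 1 ≤ c)
    {κ : ℝ} (hκ : ∀ z, k z z ≤ κ) (x : Option I → D) (e : D → ℝ) :
    (e (x none) - ∑ i, wvec k c (fun i => x (some i)) (x none) i * e (x (some i))) ^ 2 ≤
      (1 + κ) ^ 2 * ((c • Rm (kmat k x) c *ᵥ fun a => e (x a)) none) ^ 2 := by
  have := (spd_kmat hpd hs x).loo_res hc none (hκ (x none)) (ext1 _) rfl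
    (ext1_prop hpd hs (by linarith) x) (fun a => e (x a))
  refine le_trans (le_of_eq ?_) this
  simp only [dotProduct, Fintype.sum_option, ext1, Option.elim]
  ring

/-- two new points -/
def ext2 (w : I → ℝ) (p q : ℝ) : Option (Option I) → ℝ := fun a => a.elim p fun b => b.elim q w

lemma ext2_prop1 (hpd : PosDefKernel k) (hs : ∀ x y, k x y = k y x) {c : ℝ} (hc : 0 < c)
    (x : Option (Option I) → D) (a : Option (Option I)) (ha : a ≠ none) (ha' : a ≠ some none) :
    (Mm (kmat k x) c *ᵥ ext2 (wvec k c (fun i => x (some (some i))) (x none)) (-1) 0) a = 0 := by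
  obtain ⟨b, rfl⟩ := Option.ne_none_iff_exists'.mp ha
  have hb : b ≠ none := fun h => ha' (by rw [h])
  obtain ⟨i, rfl⟩ := Option.ne_none_iff_exists'.mp hb
  have h := M_wvec hpd hs hc (fun i => x (some (some i))) (x none) i
  rw [Mm_mulVec]
  simp only [mulVec, dotProduct, Pi.add_apply, Fintype.sum_option, ext2, Option.elim,
    kmat, Matrix.of_apply, Pi.smul_apply, smul_eq_mul]
  linarith

lemma ext2_prop2 (hpd : PosDefKernel k) (hs : ∀ x y, k x y = k y x) {c : ℝ} (hc : 0 < c)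
    (x : Option (Option I) → D) (a : Option (Option I)) (ha : a ≠ none) (ha' : a ≠ some none) :
    (Mm (kmat k x) c *ᵥ ext2 (wvec k c (fun i => x (some (some i))) (x (some none))) 0 (-1)) a
      = 0 := by
  obtain ⟨b, rfl⟩ := Option.ne_none_iff_exists'.mp ha
  have hb : b ≠ none := fun h => ha' (by rw [h])
  obtain ⟨i, rfl⟩ := Option.ne_none_iff_exists'.mp hb
  have h := M_wvec hpd hs hc (fun i => x (some (some i))) (x (some none)) i
  rw [Mm_mulVec]
  simp only [mulVec, dotProduct, Pi.add_apply, Fintype.sum_option, ext2, Option.elim,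
    kmat, Matrix.of_apply, Pi.smul_apply, smul_eq_mul]
  linarith

lemma wvec_two (hpd : PosDefKernel k) (hs : ∀ x y, k x y = k y x) {c : ℝ} (hc : 1 ≤ c)
    {κ : ℝ} (hκ : ∀ z, k z z ≤ κ) (x : Option (Option I) → D) :
    (∑ i, wvec k c (fun i => x (some (some i))) (x none) i *
        wvec k c (fun i => x (some (some i))) (x (some none)) i) ^ 2 ≤
      72 * (1 + κ) ^ 8 * (Hm (kmat k x) c none (some none) ^ 2 +
        (Hm (kmat k x) c * Hm (kmat k x) c) none (some none) ^ 2) := by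
  have := (spd_kmat hpd hs x).two_point hc none (some none) (by simp) (hκ (x none))
    (hκ (x (some none)))
    _ rfl rfl (ext2_prop1 hpd hs (by linarith) x) _ rfl rfl (ext2_prop2 hpd hs (by linarith) x)
  refine le_trans (le_of_eq ?_) this
  simp [dotProduct, Fintype.sum_option, ext2]

/-- in-sample weights are columns of the hat matrix -/
lemma wvec_self (hpd : PosDefKernel k) (hs : ∀ x y, k x y = k y x) {c : ℝ} (hc : 0 < c)
    (x : I → D) (i : I) : wvec k c x (x i) = Hm (kmat k x) c *ᵥ Pi.single i 1 := by
  rw [← (spd_kmat hpd hs x).R_K hc, ← mulVec_mulVec, wvec]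
  congr 1
  ext l
  rw [col_apply]; rfl

end opt
end CIProof
end

section

namespace CIProof
section spectral

lemma _root_.HasSum.congr_fun' {J E : Type*} [AddCommMonoid E] [TopologicalSpace E] {f g : J → E} {a : E} (h : HasSum f a) (hfg : ∀ j, g j = f j) : HasSum g a := by
  have : g = f := funext hfg
  rwa [this]

lemma orthonormal_countable {E ι : Type*} [NormedAddCommGroup E] [InnerProductSpace ℝ E]
    [TopologicalSpace.SeparableSpace E] {v : ι → E} (hv : Orthonormal ℝ v) : Countable ι := by
  refine Pairwise.countable_of_isOpen_disjoint (s := fun i => Metric.ball (v i) (1/2)) ?_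
    (fun i => Metric.isOpen_ball) (fun i => Metric.nonempty_ball.mpr (by norm_num))
  intro i j hij
  refine Metric.ball_disjoint_ball ?_
  have h1 : ‖v i - v j‖ ^ 2 = 2 := by
    rw [norm_sub_sq_real, hv.1 i, hv.1 j, hv.2 hij]; norm_num
  rw [dist_eq_norm]
  nlinarith [norm_nonneg (v i - v j)]

/-- eigenbasis of a compact self-adjoint operator -/
lemma exists_eigenbasis {E : Type} [NormedAddCommGroup E] [InnerProductSpace ℝ E] [CompleteSpace E]
    (T : E →L[ℝ] E) (hT : IsCompactOperator T) (hs : T.IsSymmetric) :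
    ∃ (ι : Type) (e : HilbertBasis ι ℝ E) (m : ι → ℝ), ∀ i, T (e i) = m i • e i := by
  let V : ℝ → Submodule ℝ E := fun a => Module.End.eigenspace (T : Module.End ℝ E) a
  have hVc : ∀ a, CompleteSpace (V a) := by
    intro a
    have : IsClosed (V a : Set E) := by
      have : (V a : Set E) = {x | T x = a • x} := by
        ext x; simp [V]
      rw [this]
      exact isClosed_eq T.continuous (continuous_const_smul a)
    exact this.completeSpace_coe
  have hb := fun a => exists_hilbertBasis ℝ (V a)
  choose w b hbw using hb
  have hof : OrthogonalFamily ℝ (fun a => V a) (fun a => (V a).subtypeₗᵢ) :=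
    hs.orthogonalFamily_eigenspaces
  have hon : Orthonormal ℝ (fun s : Σ a, w a => (V s.1).subtypeₗᵢ (b s.1 s.2)) :=
    hof.orthonormal_sigma_orthonormal (fun a => (b a).orthonormal)
  have hperp : (Submodule.span ℝ (Set.range (fun s : Σ a, w a => (V s.1).subtypeₗᵢ (b s.1 s.2))))ᗮ = ⊥ := by
    rw [eq_bot_iff, ← ContinuousLinearMap.orthogonalComplement_iSup_eigenspaces_eq_bot hT hs,
      ← Submodule.iInf_orthogonal]
    intro x hx
    rw [Submodule.mem_iInf]
    intro a
    rw [Submodule.mem_orthogonal']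
    intro y hy
    have h1 := ((innerSL ℝ x).comp (V a).subtypeL).hasSum ((b a).hasSum_repr ⟨y, hy⟩)
    have h2 : ∀ i, ((innerSL ℝ x).comp (V a).subtypeL) ((b a).repr ⟨y, hy⟩ i • b a i) = 0 := by
      intro i
      rw [map_smul]
      have : ⟪x, (b a i : E)⟫ = 0 :=
        Submodule.inner_left_of_mem_orthogonal (Submodule.subset_span (Set.mem_range_self (⟨a, i⟩ : Σ a, w a))) hx
      simp [this]
    simp_rw [h2] at h1
    exact (h1.unique hasSum_zero)
  refine ⟨Σ a, w a, HilbertBasis.mkOfOrthogonalEqBot hon hperp, fun s => s.1, fun s => ?_⟩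
  rw [HilbertBasis.coe_mkOfOrthogonalEqBot]
  exact Module.End.mem_eigenspace_iff.mp (b s.1 s.2).2

set_option linter.unusedSectionVars false
variable {D : Type} [TopologicalSpace D] [MeasurableSpace D] [BorelSpace D]
  [SecondCountableTopology D] {P : Measure D} [IsProbabilityMeasure P]
  {H : Type} [NormedAddCommGroup H] [InnerProductSpace ℝ H] [CompleteSpace H]
  [TopologicalSpace.SeparableSpace H]
  {φ : D → H} {κ : ℝ}

/-- mean embedding of a signed density -/
def psi (P : Measure D) (φ : D → H) (g : D → ℝ) : H := ∫ z, g z • φ z ∂P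

lemma norm_phi_le (hκ : ∀ z, ‖φ z‖ ^ 2 ≤ κ) (z : D) : ‖φ z‖ ≤ Real.sqrt κ :=
  Real.le_sqrt_of_sq_le (hκ z)

lemma aesm_phi (hφ : Continuous φ) : AEStronglyMeasurable φ P := hφ.aestronglyMeasurable

lemma integrable_smul_phi (hφ : Continuous φ) (hκ : ∀ z, ‖φ z‖ ^ 2 ≤ κ) {g : D → ℝ}
    (hg : Integrable g P) : Integrable (fun z => g z • φ z) P :=
  by
  refine Integrable.mono' (hg.norm.mul_const (Real.sqrt κ))
    (hg.aestronglyMeasurable.smul (aesm_phi hφ)) (Eventually.of_forall fun z => ?_)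
  rw [norm_smul]
  gcongr
  exact norm_phi_le hκ z

lemma inner_psi (hφ : Continuous φ) (hκ : ∀ z, ‖φ z‖ ^ 2 ≤ κ) {g : D → ℝ}
    (hg : Integrable g P) (h : H) : ⟪h, psi P φ g⟫ = ∫ z, g z * ⟪h, φ z⟫ ∂P := by
  rw [psi, ← integral_inner (integrable_smul_phi hφ hκ hg)]
  simp_rw [inner_smul_right]

lemma Lp_integrable (g : Lp ℝ 2 P) : Integrable g P := (Lp.memLp g).integrable (by norm_num)

lemma memLp_inner (hφ : Continuous φ) (hκ : ∀ z, ‖φ z‖ ^ 2 ≤ κ) (h : H) :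
    MemLp (fun z => ⟪h, φ z⟫) 2 P := by
  refine MemLp.of_bound (C := ‖h‖ * Real.sqrt κ) ?_ (Eventually.of_forall fun z => ?_)
  · exact (continuous_const.inner hφ).aestronglyMeasurable
  · exact (norm_inner_le_norm _ _).trans (by gcongr; exact norm_phi_le hκ z)

/-- coordinates of the feature map -/
def acoord (P : Measure D) [IsProbabilityMeasure P] (hφ : Continuous φ)
    (hκ : ∀ z, ‖φ z‖ ^ 2 ≤ κ) (h : H) : Lp ℝ 2 P :=
  (memLp_inner (P := P) hφ hκ h).toLp _

lemma inner_acoord (hφ : Continuous φ) (hκ : ∀ z, ‖φ z‖ ^ 2 ≤ κ) (h : H) (g : Lp ℝ 2 P) :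
    ⟪acoord P hφ hκ h, g⟫ = ⟪h, psi P φ g⟫ := by
  rw [inner_psi hφ hκ (Lp_integrable g), L2.inner_def]
  refine integral_congr_ae ?_
  filter_upwards [(memLp_inner (P := P) hφ hκ h).coeFn_toLp] with z hz
  rw [acoord, hz]; rfl

/-- the operator is the Gram operator of `psi` -/
lemma L_inner (hφ : Continuous φ) (hκ : ∀ z, ‖φ z‖ ^ 2 ≤ κ) (L : Lp ℝ 2 P →L[ℝ] Lp ℝ 2 P)
    (hL : ∀ g : Lp ℝ 2 P, (L g : D → ℝ) =ᵐ[P] fun z => ∫ z', ⟪φ z, φ z'⟫ * g z' ∂P)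
    (g g' : Lp ℝ 2 P) : ⟪L g, g'⟫ = ⟪psi P φ g, psi P φ g'⟫ := by
  rw [inner_psi hφ hκ (Lp_integrable g'), L2.inner_def]
  refine integral_congr_ae ?_
  filter_upwards [hL g] with z hz
  rw [hz, real_inner_comm (φ z) (psi P φ g), inner_psi hφ hκ (Lp_integrable g)]
  simp only [mul_comm]
  rw [RCLike.inner_apply]
  simp

lemma hasSum_acoord (hφ : Continuous φ) (hκ : ∀ z, ‖φ z‖ ^ 2 ≤ κ) {J : Type*}
    (b : HilbertBasis J ℝ H) :
    HasSum (fun j => ‖acoord P hφ hκ (b j)‖ ^ 2) (∫ z, ‖φ z‖ ^ 2 ∂P) := by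
  have := orthonormal_countable b.orthonormal
  have h1 : ∀ j, ‖acoord P hφ hκ (b j)‖ ^ 2 = ∫ z, ⟪b j, φ z⟫ ^ 2 ∂P := by
    intro j
    rw [← real_inner_self_eq_norm_sq, L2.inner_def]
    refine integral_congr_ae ?_
    filter_upwards [(memLp_inner (P := P) hφ hκ (b j)).coeFn_toLp] with z hz
    rw [acoord, hz, RCLike.inner_apply, sq]; simp
  have hpt : ∀ z, HasSum (fun j => ⟪b j, φ z⟫ ^ 2) (‖φ z‖ ^ 2) := by
    intro z
    have := b.hasSum_inner_mul_inner (φ z) (φ z)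
    rw [real_inner_self_eq_norm_sq] at this
    refine this.congr_fun' fun j => ?_
    rw [real_inner_comm, sq]
  simp_rw [h1]
  refine hasSum_integral_of_dominated_convergence (fun j z => ⟪b j, φ z⟫ ^ 2) ?_ ?_ ?_ ?_ ?_
  · intro j
    exact ((continuous_const.inner hφ).pow 2).aestronglyMeasurable
  · exact fun j => Eventually.of_forall fun z => by simp
  · exact Eventually.of_forall fun z => (hpt z).summable
  · simp_rw [fun z => (hpt z).tsum_eq]
    refine Integrable.of_bound (C := κ) (hφ.norm.pow 2).aestronglyMeasurable
      (Eventually.of_forall fun z => ?_)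
    rw [Real.norm_of_nonneg (by positivity)]; exact hκ z
  · exact Eventually.of_forall hpt

lemma L_hasSum (hφ : Continuous φ) (hκ : ∀ z, ‖φ z‖ ^ 2 ≤ κ) (L : Lp ℝ 2 P →L[ℝ] Lp ℝ 2 P)
    (hL : ∀ g : Lp ℝ 2 P, (L g : D → ℝ) =ᵐ[P] fun z => ∫ z', ⟪φ z, φ z'⟫ * g z' ∂P) {J : Type*}
    (b : HilbertBasis J ℝ H) :
    HasSum (fun j => (innerSL ℝ (acoord P hφ hκ (b j))).smulRight (acoord P hφ hκ (b j))) L := by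
  have hsum : Summable
      (fun j => (innerSL ℝ (acoord P hφ hκ (b j))).smulRight (acoord P hφ hκ (b j))) := by
    refine Summable.of_norm_bounded (hasSum_acoord (P := P) hφ hκ b).summable fun j => ?_
    rw [ContinuousLinearMap.norm_smulRight_apply, innerSL_apply_norm, sq]
  convert hsum.hasSum
  refine ContinuousLinearMap.ext fun g => ext_inner_right ℝ fun g' => ?_
  rw [L_inner hφ hκ L hL]
  have h1 := hsum.hasSum.mapL (ContinuousLinearMap.apply ℝ (Lp ℝ 2 P) g)
  have h2 := h1.mapL (innerSL ℝ g')
  have h3 := b.hasSum_inner_mul_inner (psi P φ g) (psi P φ g')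
  rw [real_inner_comm g']
  refine h3.unique (h2.congr_fun' fun j => ?_)
  simp only [ContinuousLinearMap.apply_apply, ContinuousLinearMap.smulRight_apply, innerSL_apply_apply,
    inner_smul_right]
  rw [inner_acoord, real_inner_comm (acoord P hφ hκ (b j)) g', inner_acoord, real_inner_comm]

end spectral
end CIProof
end

section

namespace CIProof
section spectral2
set_option linter.unusedSectionVars false

lemma rankone_compact {E : Type*} [NormedAddCommGroup E] [InnerProductSpace ℝ E] (a : E) :
    IsCompactOperator ((innerSL ℝ a).smulRight a : E →L[ℝ] E) := by
  have h : IsCompactOperator (innerSL ℝ a : E →L[ℝ] ℝ) := isCompactOperator_of_locallyCompactSpace_dom (innerSL ℝ a)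
  exact h.clm_comp (ContinuousLinearMap.toSpanSingleton ℝ a)

variable {D : Type} [TopologicalSpace D] [MeasurableSpace D] [BorelSpace D]
  [SecondCountableTopology D] {P : Measure D} [IsProbabilityMeasure P]
  {H : Type} [NormedAddCommGroup H] [InnerProductSpace ℝ H] [CompleteSpace H]
  [TopologicalSpace.SeparableSpace H]
  {φ : D → H} {κ : ℝ}

lemma L_compact (hφ : Continuous φ) (hκ : ∀ z, ‖φ z‖ ^ 2 ≤ κ) (L : Lp ℝ 2 P →L[ℝ] Lp ℝ 2 P)
    (hL : ∀ g : Lp ℝ 2 P, (L g : D → ℝ) =ᵐ[P] fun z => ∫ z', ⟪φ z, φ z'⟫ * g z' ∂P) :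
    IsCompactOperator L := by
  obtain ⟨w, b, -⟩ := exists_hilbertBasis ℝ H
  have h := L_hasSum hφ hκ L hL b
  rw [HasSum, SummationFilter.unconditional_filter] at h
  refine isCompactOperator_of_tendsto h (Eventually.of_forall fun s => ?_)
  classical
  induction s using Finset.induction_on with
  | empty => simpa using isCompactOperator_zero
  | insert a s ha ih =>
    rw [Finset.sum_insert ha]
    exact (rankone_compact _).add ih

lemma spectral (hφ : Continuous φ) (hκ : ∀ z, ‖φ z‖ ^ 2 ≤ κ) (L : Lp ℝ 2 P →L[ℝ] Lp ℝ 2 P)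
    (hL : ∀ g : Lp ℝ 2 P, (L g : D → ℝ) =ᵐ[P] fun z => ∫ z', ⟪φ z, φ z'⟫ * g z' ∂P) :
    ∃ (ι : Type) (e : HilbertBasis ι ℝ (Lp ℝ 2 P)) (m : ι → ℝ), (∀ i, 0 ≤ m i) ∧
      (∀ i, L (e i) = m i • e i) ∧ HasSum m (∫ z, ‖φ z‖ ^ 2 ∂P) := by
  have hsym : L.IsSymmetric := by
    intro x y
    change ⟪L x, y⟫ = ⟪x, L y⟫
    rw [L_inner hφ hκ L hL, real_inner_comm, ← L_inner hφ hκ L hL, real_inner_comm]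
  obtain ⟨ι, e, m, hm⟩ := exists_eigenbasis L (L_compact hφ hκ L hL) hsym
  have hme : ∀ i, m i = ⟪L (e i), e i⟫ := by
    intro i
    rw [hm, inner_smul_left, real_inner_self_eq_norm_sq, e.orthonormal.1 i]; simp
  have hmn : ∀ i, 0 ≤ m i := by
    intro i
    rw [hme, L_inner hφ hκ L hL]; exact real_inner_self_nonneg
  refine ⟨ι, e, m, hmn, hm, ?_⟩
  obtain ⟨w, b, -⟩ := exists_hilbertBasis ℝ H
  have hA := hasSum_acoord (P := P) hφ hκ b
  set a := fun j => acoord P hφ hκ (b j) with ha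
  have h1 : ∀ j, HasSum (fun i => ⟪a j, e i⟫ ^ 2) (‖a j‖ ^ 2) := by
    intro j
    have := e.hasSum_inner_mul_inner (a j) (a j)
    rw [real_inner_self_eq_norm_sq] at this
    refine this.congr_fun' fun i => ?_
    rw [real_inner_comm (a j) (e i), sq]
  have h2 : ∀ i, HasSum (fun j => ⟪a j, e i⟫ ^ 2) (m i) := by
    intro i
    rw [hme, L_inner hφ hκ L hL]
    have := b.hasSum_inner_mul_inner (psi P φ (e i)) (psi P φ (e i))
    refine this.congr_fun' fun j => ?_
    rw [ha, inner_acoord, sq, real_inner_comm (b j)]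
  have hs : Summable (fun p : w × ι => ⟪a p.1, e p.2⟫ ^ 2) := by
    rw [summable_prod_of_nonneg (fun p => sq_nonneg _)]
    refine ⟨fun j => (h1 j).summable, ?_⟩
    simp_rw [fun j => (h1 j).tsum_eq]
    exact hA.summable
  have h3 := hs.hasSum.prod_fiberwise h1
  have h4 := (hs.prod_symm.hasSum.prod_fiberwise h2)
  have e1 := h3.unique hA
  have e2 : ∑' (p : ι × w), ⟪a p.swap.1, e p.swap.2⟫ ^ 2 = ∑' (p : w × ι), ⟪a p.1, e p.2⟫ ^ 2 :=
    (Equiv.prodComm ι w).tsum_eq (fun p : w × ι => ⟪a p.1, e p.2⟫ ^ 2)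
  rw [e2, e1] at h4
  exact h4

/-- effective dimension bounds -/
lemma spectral_trace {L : Lp ℝ 2 P →L[ℝ] Lp ℝ 2 P} {Q γ : ℝ} (hT : TraceAssumption P L Q γ)
    {ι : Type} (e : HilbertBasis ι ℝ (Lp ℝ 2 P)) {m : ι → ℝ} (hm : ∀ i, 0 ≤ m i)
    (he : ∀ i, L (e i) = m i • e i) (hLpos : ∀ g, 0 ≤ ⟪L g, g⟫) (hs : Summable m)
    {lam : ℝ} (hlam : 0 < lam) :
    Summable (fun i => m i / (m i + lam)) ∧ ∑' i, m i / (m i + lam) ≤ Q * lam ^ (-γ) := by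
  have hpos : ∀ i, 0 < m i + lam := fun i => by linarith [hm i]
  constructor
  · refine Summable.of_nonneg_of_le (fun i => div_nonneg (hm i) (hpos i).le) (fun i => ?_) (hs.mul_left lam⁻¹)
    rw [div_eq_inv_mul]
    gcongr
    · exact hm i
    · linarith [hm i]
  · refine le_trans (le_of_eq ?_) (hT lam hlam ι e)
    refine tsum_congr fun i => ?_
    have hu : IsUnit (L + lam • (1 : Lp ℝ 2 P →L[ℝ] Lp ℝ 2 P)) := by
      refine ContinuousLinearMap.isUnit_of_forall_le_norm_inner_map _ (c := ⟨lam, hlam.le⟩) hlam ?_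
      intro x
      change ‖x‖ ^ 2 * lam ≤ _
      rw [add_apply, inner_add_left]
      have : ⟪(lam • (1 : Lp ℝ 2 P →L[ℝ] Lp ℝ 2 P)) x, x⟫ = lam * ‖x‖ ^ 2 := by
        rw [smul_apply, one_apply_eq_self, inner_smul_left, real_inner_self_eq_norm_sq]; simp
      rw [this, Real.norm_eq_abs]
      refine le_trans ?_ (le_abs_self _)
      linarith [hLpos x]
    have h1 : (Ring.inverse (L + lam • (1 : Lp ℝ 2 P →L[ℝ] Lp ℝ 2 P))) (e i) = (m i + lam)⁻¹ • e i := by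
      have h2 : (L + lam • (1 : Lp ℝ 2 P →L[ℝ] Lp ℝ 2 P)) ((m i + lam)⁻¹ • e i) = e i := by
        rw [map_smul, add_apply, he, smul_apply,
          one_apply_eq_self, ← add_smul, smul_smul, inv_mul_cancel₀ (hpos i).ne', one_smul]
      have h3 := congrArg (fun T : Lp ℝ 2 P →L[ℝ] Lp ℝ 2 P => T ((m i + lam)⁻¹ • e i)) (Ring.inverse_mul_cancel _ hu)
      simp only [mul_apply_eq_comp, one_apply_eq_self] at h3
      rw [h2] at h3
      exact h3
    rw [mul_apply_eq_comp, he, map_smul, h1, smul_smul, inner_smul_left, real_inner_self_eq_norm_sq,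
      e.orthonormal.1 i, div_eq_mul_inv]
    simp

lemma eff_bounds {ι : Type} {m : ι → ℝ} (hm : ∀ i, 0 ≤ m i) {K : ℝ} (hs : HasSum m K) {lam N : ℝ}
    (hlam : 0 < lam) (h1 : Summable (fun i => m i / (m i + lam)))
    (h2 : ∑' i, m i / (m i + lam) ≤ N) :
    ∃ S : Finset ι, (∀ i, i ∈ S ↔ lam ≤ m i) ∧ (S.card : ℝ) ≤ 2 * N ∧
      K - ∑ i ∈ S, m i ≤ 2 * lam * N := by
  have hpos : ∀ i, 0 < m i + lam := fun i => by linarith [hm i]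
  have hnn : ∀ i, 0 ≤ m i / (m i + lam) := fun i => div_nonneg (hm i) (hpos i).le
  have hfin : {i | lam ≤ m i}.Finite := by
    have := hs.summable.tendsto_cofinite_zero
    have := this.eventually (gt_mem_nhds hlam)
    rw [Filter.eventually_cofinite] at this
    simpa using this
  classical
  refine ⟨hfin.toFinset, by simp, ?_, ?_⟩
  · have h3 : ∑ i ∈ hfin.toFinset, (1/2 : ℝ) ≤ ∑ i ∈ hfin.toFinset, m i / (m i + lam) := by
      refine Finset.sum_le_sum fun i hi => ?_
      simp at hi
      rw [div_le_div_iff₀ (by norm_num) (hpos i)]; linarith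
    have h4 := h1.sum_le_tsum hfin.toFinset (fun i _ => hnn i)
    rw [Finset.sum_const, nsmul_eq_mul] at h3
    linarith
  · set S := hfin.toFinset
    have h5 : HasSum (fun i => if i ∈ S then m i else 0) (∑ i ∈ S, m i) := by
      have := hasSum_sum_of_ne_finset_zero (L := SummationFilter.unconditional ι) (f := fun i => if i ∈ S then m i else 0) (s := S) (by
        intro b hb; simp [hb])
      convert this using 1
      refine Finset.sum_congr rfl fun i hi => by simp [hi]
    have h6 := hs.sub h5
    have h7 := (h1.hasSum.mul_left (2 * lam))
    have h8 := hasSum_le (fun i => ?_) h6 h7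
    · refine h8.trans ?_
      gcongr
    · by_cases hi : i ∈ S
      · simp only [hi, if_true, sub_self]
        have := hnn i; positivity
      · simp only [hi, if_false, sub_zero]
        have hi' : m i < lam := by simpa [S] using hi
        rw [← mul_div_assoc, le_div_iff₀ (hpos i)]
        nlinarith [hm i]

end spectral2
end CIProof
end

section

namespace CIProof
section bm
set_option linter.unusedSectionVars false

/-- bounded strongly measurable functions -/
def BM {α E : Type*} [MeasurableSpace α] [NormedAddCommGroup E] (f : α → E) : Prop :=
  StronglyMeasurable f ∧ ∃ C, ∀ x, ‖f x‖ ≤ C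

variable {α E : Type*} [MeasurableSpace α] [NormedAddCommGroup E]

lemma BM.integrable {f : α → E} (hf : BM f) (μ : Measure α) [IsFiniteMeasure μ] : Integrable f μ := by
  obtain ⟨h, C, hC⟩ := hf
  exact Integrable.of_bound h.aestronglyMeasurable C (Eventually.of_forall hC)

lemma BM.const (c : E) : BM (fun _ : α => c) := ⟨stronglyMeasurable_const, ‖c‖, fun _ => le_rfl⟩

lemma BM.add {f g : α → E} (hf : BM f) (hg : BM g) : BM (fun x => f x + g x) := by
  obtain ⟨h, C, hC⟩ := hf
  obtain ⟨h', C', hC'⟩ := hg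
  exact ⟨h.add h', C + C', fun x => (norm_add_le _ _).trans (add_le_add (hC x) (hC' x))⟩

lemma BM.sub {f g : α → E} (hf : BM f) (hg : BM g) : BM (fun x => f x - g x) := by
  obtain ⟨h, C, hC⟩ := hf
  obtain ⟨h', C', hC'⟩ := hg
  exact ⟨h.sub h', C + C', fun x => (norm_sub_le _ _).trans (add_le_add (hC x) (hC' x))⟩

lemma BM.smul [NormedSpace ℝ E] {f : α → ℝ} {g : α → E} (hf : BM f) (hg : BM g) :
    BM (fun x => f x • g x) := by
  obtain ⟨h, C, hC⟩ := hf
  obtain ⟨h', C', hC'⟩ := hg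
  refine ⟨h.smul h', C * C', fun x => ?_⟩
  rw [norm_smul]
  exact mul_le_mul (hC x) (hC' x) (norm_nonneg _) ((norm_nonneg _).trans (hC x))

lemma BM.mul {f g : α → ℝ} (hf : BM f) (hg : BM g) : BM (fun x => f x * g x) := by
  simpa using hf.smul hg

lemma BM.const_mul {f : α → ℝ} (hf : BM f) (c : ℝ) : BM (fun x => c * f x) := (BM.const c).mul hf

lemma BM.pow {f : α → ℝ} (hf : BM f) (n : ℕ) : BM (fun x => f x ^ n) := by
  induction n with
  | zero => simpa using BM.const (1 : ℝ)
  | succ n ih => simpa [pow_succ] using ih.mul hf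

lemma BM.inner [InnerProductSpace ℝ E] {f g : α → E} (hf : BM f) (hg : BM g) :
    BM (fun x => ⟪f x, g x⟫) := by
  obtain ⟨h, C, hC⟩ := hf
  obtain ⟨h', C', hC'⟩ := hg
  refine ⟨h.inner h', C * C', fun x => (norm_inner_le_norm _ _).trans ?_⟩
  exact mul_le_mul (hC x) (hC' x) (norm_nonneg _) ((norm_nonneg _).trans (hC x))

lemma BM.norm {f : α → E} (hf : BM f) : BM (fun x => ‖f x‖) := by
  obtain ⟨h, C, hC⟩ := hf
  exact ⟨h.norm, C, fun x => by simpa using hC x⟩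

lemma BM.sum {ι : Type*} {s : Finset ι} {f : ι → α → E} (hf : ∀ i ∈ s, BM (f i)) :
    BM (fun x => ∑ i ∈ s, f i x) := by
  classical
  induction s using Finset.induction_on with
  | empty => simpa using BM.const (0 : E)
  | insert a s ha ih =>
    simp_rw [Finset.sum_insert ha]
    exact (hf a (by simp)).add (ih fun i hi => hf i (by simp [hi]))

lemma BM.comp {δ : Type*} [MeasurableSpace δ] {f : α → E} (hf : BM f) {g : δ → α} (hg : Measurable g) :
    BM (fun x => f (g x)) := by
  obtain ⟨h, C, hC⟩ := hf
  exact ⟨h.comp_measurable hg, C, fun x => hC _⟩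

lemma BM.of_measurable {f : α → ℝ} (h : Measurable f) {C : ℝ} (hC : ∀ x, |f x| ≤ C) : BM f :=
  ⟨h.stronglyMeasurable, C, hC⟩

lemma BM.measurable {f : α → ℝ} (h : BM f) : Measurable f := h.1.measurable

lemma BM.sub' {f g : α → E} (hf : BM f) (hg : BM g) : BM (f - g) := hf.sub hg

end bm

set_option linter.unusedSectionVars false
section pim
variable {D : Type*} [MeasurableSpace D]

/-- laws of sub-samples -/
lemma map_inj {Ω κ ι : Type*} [MeasurableSpace Ω] {μ : Measure Ω} [IsProbabilityMeasure μ] [Fintype ι]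
    {P : Measure D} {z : κ → Ω → D}
    (hz : ∀ i, Measurable (z i)) (hi : iIndepFun z μ) (hl : ∀ i, μ.map (z i) = P)
    {s : ι → κ} (hs : Function.Injective s) :
    μ.map (fun ω i => z (s i) ω) = Measure.pi (fun _ : ι => P) := by
  have h := (iIndepFun_iff_map_fun_eq_pi_map (f := fun i => z (s i)) (fun i => (hz (s i)).aemeasurable)).1
    (hi.precomp hs)
  rw [h]
  simp [hl]

lemma integral_inj {Ω κ ι : Type*} [MeasurableSpace Ω] {μ : Measure Ω} [IsProbabilityMeasure μ] [Fintype ι]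
    {P : Measure D} {z : κ → Ω → D}
    (hz : ∀ i, Measurable (z i)) (hi : iIndepFun z μ) (hl : ∀ i, μ.map (z i) = P)
    {s : ι → κ} (hs : Function.Injective s) {F : (ι → D) → ℝ} (hF : Measurable F) :
    ∫ ω, F (fun i => z (s i) ω) ∂μ = ∫ x, F x ∂(Measure.pi (fun _ : ι => P)) := by
  rw [← map_inj hz hi hl hs, integral_map]
  · exact (measurable_pi_lambda _ fun i => hz _).aemeasurable
  · exact hF.aestronglyMeasurable

variable {P : Measure D} [IsProbabilityMeasure P] {ι κ : Type*} [Fintype ι] [Fintype κ]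

lemma pi_indep : iIndepFun (fun (i : ι) (x : ι → D) => x i) (Measure.pi (fun _ : ι => P)) :=
  iIndepFun_pi (X := fun _ => id) fun _ => aemeasurable_id

lemma pi_law (i : ι) : (Measure.pi (fun _ : ι => P)).map (fun x : ι → D => x i) = P :=
  (measurePreserving_eval (fun _ : ι => P) i).map_eq

lemma pi_integral_inj {s : ι → κ} (hs : Function.Injective s) {F : (ι → D) → ℝ} (hF : Measurable F) :
    ∫ x : κ → D, F (fun i => x (s i)) ∂(Measure.pi (fun _ : κ => P)) =
      ∫ x, F x ∂(Measure.pi (fun _ : ι => P)) :=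
  integral_inj (z := fun (i : κ) (x : κ → D) => x i) (fun i => measurable_pi_apply i) pi_indep pi_law hs hF

lemma pi_integral_one {E : Type*} [NormedAddCommGroup E] [NormedSpace ℝ E] (i : ι) {F : D → E} (hF : StronglyMeasurable F) :
    ∫ x : ι → D, F (x i) ∂(Measure.pi (fun _ : ι => P)) = ∫ z, F z ∂P := by
  conv_rhs => rw [← pi_law (P := P) i]
  rw [integral_map (measurable_pi_apply i).aemeasurable hF.aestronglyMeasurable]

lemma pi_pair {i j : ι} (hij : i ≠ j) :
    (Measure.pi (fun _ : ι => P)).map (fun x : ι → D => (x i, x j)) = P.prod P := by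
  have h := (pi_indep (P := P)).indepFun hij
  rw [indepFun_iff_map_prod_eq_prod_map_map (measurable_pi_apply i).aemeasurable
    (measurable_pi_apply j).aemeasurable, pi_law, pi_law] at h
  exact h

lemma pi_integral_pair {i j : ι} (hij : i ≠ j) {F : D × D → ℝ} (hF : BM F) :
    ∫ x : ι → D, F (x i, x j) ∂(Measure.pi (fun _ : ι => P)) = ∫ z, ∫ z', F (z, z') ∂P ∂P := by
  rw [← integral_prod _ (hF.integrable _), ← pi_pair hij, integral_map]
  · exact ((measurable_pi_apply i).prodMk (measurable_pi_apply j)).aemeasurable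
  · exact hF.1.aestronglyMeasurable

/-- add a point -/
def optc (p : (ι → D) × D) : Option ι → D := fun o => o.elim p.2 p.1

lemma measurable_optc : Measurable (optc : (ι → D) × D → Option ι → D) := by
  refine measurable_pi_lambda _ fun o => ?_
  cases o with
  | none => exact measurable_snd
  | some i => exact (measurable_pi_apply i).comp measurable_fst

lemma map_optc : ((Measure.pi (fun _ : ι => P)).prod P).map optc = Measure.pi (fun _ : Option ι => P) := by
  symm
  refine Measure.pi_eq fun s hs => ?_
  rw [Measure.map_apply measurable_optc (MeasurableSet.univ_pi hs)]
  have : optc ⁻¹' (Set.univ.pi s) = (Set.univ.pi fun i => s (some i)) ×ˢ (s none) := by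
    ext x
    simp only [Set.mem_preimage, Set.mem_pi, Set.mem_univ, forall_true_left, Set.mem_prod, optc]
    constructor
    · intro h; exact ⟨fun i => h (some i), h none⟩
    · rintro ⟨h1, h2⟩ (_ | i)
      · exact h2
      · exact h1 i
  rw [this, Measure.prod_prod, Measure.pi_pi, Fintype.prod_option, mul_comm]

lemma pi_integral_option {F : (Option ι → D) → ℝ} (hF : BM F) :
    ∫ x, F x ∂(Measure.pi (fun _ : Option ι => P)) =
      ∫ x, ∫ z, F (optc (x, z)) ∂P ∂(Measure.pi (fun _ : ι => P)) := by
  rw [← map_optc, integral_map measurable_optc.aemeasurable hF.1.aestronglyMeasurable,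
    integral_prod _ ((hF.comp measurable_optc).integrable _)]

end pim

section meas
open Matrix
variable {D : Type*} [MeasurableSpace D] {ι : Type*} [Fintype ι] [DecidableEq ι] {k : D → D → ℝ}

lemma measurable_det {α : Type*} [MeasurableSpace α] {A : α → Matrix ι ι ℝ}
    (hA : ∀ i j, Measurable fun x => A x i j) : Measurable fun x => (A x).det := by
  simp_rw [Matrix.det_apply]
  refine Finset.measurable_sum _ fun σ _ => ?_
  exact (Finset.measurable_prod _ fun i _ => hA _ _).const_smul _

lemma measurable_matinv {α : Type*} [MeasurableSpace α] {A : α → Matrix ι ι ℝ}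
    (hA : ∀ i j, Measurable fun x => A x i j) (i j : ι) : Measurable fun x => (A x)⁻¹ i j := by
  simp_rw [Matrix.inv_def, Matrix.smul_apply, smul_eq_mul, Ring.inverse_eq_inv', Matrix.adjugate_apply]
  refine (measurable_det hA).inv.mul (measurable_det fun a b => ?_)
  by_cases h : a = j
  · subst h; simp
  · simp only [Matrix.updateRow_apply, h, if_false]; exact hA a b

lemma measurable_Rm (hk : Measurable fun q : D × D => k q.1 q.2) (c : ℝ) (i j : ι) :
    Measurable fun x : ι → D => Rm (kmat k x) c i j := by
  refine measurable_matinv (fun a b => ?_) i j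
  simp only [Mm, kmat, Matrix.add_apply, Matrix.of_apply]
  have h : Measurable fun x : ι → D => (x a, x b) :=
    (measurable_pi_apply a).prodMk (measurable_pi_apply b)
  exact (hk.comp h).add_const _

lemma measurable_Hm (hk : Measurable fun q : D × D => k q.1 q.2) (c : ℝ) (i j : ι) :
    Measurable fun x : ι → D => Hm (kmat k x) c i j := by
  simp only [Hm, Matrix.sub_apply, Matrix.smul_apply, smul_eq_mul]
  exact ((measurable_Rm hk c i j).const_mul c).const_sub _

lemma BM_Hm (hk : Measurable fun q : D × D => k q.1 q.2) (hpd : PosDefKernel k)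
    (hs : ∀ x y, k x y = k y x) {c : ℝ} (hc : 0 < c) (i j : ι) :
    BM fun x : ι → D => Hm (kmat k x) c i j :=
  BM.of_measurable (measurable_Hm hk c i j) fun x => (spd_kmat hpd hs x).H_abs_le hc i j

lemma BM_cRm (hk : Measurable fun q : D × D => k q.1 q.2) (hpd : PosDefKernel k)
    (hs : ∀ x y, k x y = k y x) {c : ℝ} (hc : 0 < c) (i j : ι) :
    BM fun x : ι → D => c * Rm (kmat k x) c i j := by
  have h : ∀ x : ι → D, c * Rm (kmat k x) c i j = (1 : Matrix ι ι ℝ) i j - Hm (kmat k x) c i j := by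
    intro x; simp [Hm]
  simp_rw [h]
  exact (BM.const _).sub (BM_Hm hk hpd hs hc i j)

/-- relabelling -/
lemma kmat_equiv {κ : Type*} (σ : κ ≃ ι) (x : ι → D) :
    kmat k (fun a => x (σ a)) = (kmat k x).submatrix σ σ := rfl

lemma Rm_equiv {κ : Type*} [Fintype κ] [DecidableEq κ] (σ : κ ≃ ι) (x : ι → D) (c : ℝ) :
    Rm (kmat k (fun a => x (σ a))) c = (Rm (kmat k x) c).submatrix σ σ := by
  rw [Rm, Rm, ← Matrix.inv_submatrix_equiv, Mm, Mm, kmat_equiv]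
  congr 1
  ext a b
  simp [Matrix.one_apply]

lemma Hm_equiv {κ : Type*} [Fintype κ] [DecidableEq κ] (σ : κ ≃ ι) (x : ι → D) (c : ℝ) :
    Hm (kmat k (fun a => x (σ a))) c = (Hm (kmat k x) c).submatrix σ σ := by
  rw [Hm, Hm, Rm_equiv]
  ext a b
  simp [Matrix.one_apply]

end meas
end CIProof
end

section

namespace CIProof
set_option linter.unusedSectionVars false
section samp
variable {D : Type} [TopologicalSpace D] [MeasurableSpace D] [BorelSpace D]
  [SecondCountableTopology D] {P : Measure D} [IsProbabilityMeasure P]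
  {H : Type} [NormedAddCommGroup H] [InnerProductSpace ℝ H] [CompleteSpace H]
  [TopologicalSpace.SeparableSpace H]
  {φ : D → H} {κ : ℝ} {ι : Type*} [Fintype ι] [DecidableEq ι]

lemma integral_iid_sq {V : D → H} (hV : BM V) (h0 : ∫ z, V z ∂P = 0) :
    ∫ x : ι → D, ‖∑ j, V (x j)‖ ^ 2 ∂(Measure.pi (fun _ : ι => P)) =
      Fintype.card ι * ∫ z, ‖V z‖ ^ 2 ∂P := by
  have hVi : ∀ i : ι, BM (fun x : ι → D => V (x i)) := fun i => hV.comp (measurable_pi_apply i)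
  have h1 : ∀ x : ι → D, ‖∑ j, V (x j)‖ ^ 2 = ∑ i, ∑ j, ⟪V (x i), V (x j)⟫ := by
    intro x
    rw [← real_inner_self_eq_norm_sq, sum_inner]
    simp_rw [inner_sum]
  simp_rw [h1]
  rw [integral_finsetSum _ fun i _ => (BM.sum fun j _ => (hVi i).inner (hVi j)).integrable _]
  have h2 : ∀ i : ι, ∫ x : ι → D, ∑ j, ⟪V (x i), V (x j)⟫ ∂(Measure.pi (fun _ : ι => P)) = ∫ z, ‖V z‖ ^ 2 ∂P := by
    intro i
    rw [integral_finsetSum _ fun j _ => ((hVi i).inner (hVi j)).integrable _, Finset.sum_eq_single i]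
    · simp_rw [real_inner_self_eq_norm_sq]
      exact pi_integral_one (F := fun z => ‖V z‖ ^ 2) i (hV.norm.pow 2).1
    · intro j _ hj
      rw [pi_integral_pair (F := fun p => ⟪V p.1, V p.2⟫) hj.symm
        ((hV.comp measurable_fst).inner (hV.comp measurable_snd))]
      refine integral_eq_zero_of_ae (Eventually.of_forall fun z => ?_)
      simp only
      rw [integral_inner (hV.integrable P), h0]; simp
    · simp
  simp_rw [h2]
  simp

lemma BM_phi (hφ : Continuous φ) (hκ : ∀ z, ‖φ z‖ ^ 2 ≤ κ) : BM φ := by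
  refine ⟨hφ.stronglyMeasurable, Real.sqrt κ, norm_phi_le hκ⟩

lemma samp [Nonempty ι] (hφ : Continuous φ) (hκ : ∀ z, ‖φ z‖ ^ 2 ≤ κ) {q : D → ℝ} (hq : BM q) :
    ∫ x : ι → D, ‖(Fintype.card ι : ℝ)⁻¹ • ∑ j, q (x j) • φ (x j) - psi P φ q‖ ^ 2
      ∂(Measure.pi (fun _ : ι => P)) ≤ κ * (∫ z, q z ^ 2 ∂P) / Fintype.card ι := by
  have hM : (0 : ℝ) < Fintype.card ι := by exact_mod_cast Fintype.card_pos
  set M : ℝ := ((Fintype.card ι : ℕ) : ℝ)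
  have hφ' := BM_phi hφ hκ
  have hqφ : BM fun z => q z • φ z := hq.smul hφ'
  set V : D → H := fun z => q z • φ z - psi P φ q with hVd
  have hV : BM V := hqφ.sub (BM.const _)
  have h0 : ∫ z, V z ∂P = 0 := by
    rw [hVd, integral_sub (hqφ.integrable P) (integrable_const _)]
    simp [psi]
  have h1 : ∀ x : ι → D, ‖M⁻¹ • ∑ j, q (x j) • φ (x j) - psi P φ q‖ ^ 2 = M⁻¹ ^ 2 * ‖∑ j, V (x j)‖ ^ 2 := by
    intro x
    have : M⁻¹ • ∑ j, q (x j) • φ (x j) - psi P φ q = M⁻¹ • ∑ j, V (x j) := by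
      simp only [hVd, Finset.sum_sub_distrib, Finset.sum_const, Finset.card_univ, smul_sub]
      congr 1
      rw [← Nat.cast_smul_eq_nsmul ℝ, smul_smul, inv_mul_cancel₀ hM.ne', one_smul]
    rw [this, norm_smul, mul_pow, Real.norm_of_nonneg (by positivity)]
  simp_rw [h1]
  rw [integral_const_mul, integral_iid_sq hV h0]
  have h2 : ∫ z, ‖V z‖ ^ 2 ∂P ≤ κ * ∫ z, q z ^ 2 ∂P := by
    have h3 : ∀ z, ‖V z‖ ^ 2 = ‖q z • φ z‖ ^ 2 - 2 * ⟪q z • φ z, psi P φ q⟫ + ‖psi P φ q‖ ^ 2 := by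
      intro z
      rw [hVd]; exact norm_sub_sq_real _ _
    have b1 := hqφ.norm.pow 2
    have b2 := (hqφ.inner (BM.const (psi P φ q))).const_mul 2
    have i1 := b1.integrable P
    simp_rw [h3]
    rw [integral_add ((b1.sub b2).integrable P) (integrable_const _),
      integral_sub (b1.integrable P) (b2.integrable P), integral_const_mul]
    have h4 : ∫ z, ⟪q z • φ z, psi P φ q⟫ ∂P = ‖psi P φ q‖ ^ 2 := by
      simp_rw [real_inner_comm (psi P φ q)]
      rw [integral_inner (hqφ.integrable P), ← real_inner_self_eq_norm_sq]; rfl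
    have h5 : ∫ z, ‖q z • φ z‖ ^ 2 ∂P ≤ κ * ∫ z, q z ^ 2 ∂P := by
      rw [← integral_const_mul]
      refine integral_mono i1 (((hq.pow 2).const_mul κ).integrable P) fun z => ?_
      simp only
      rw [norm_smul, mul_pow, Real.norm_eq_abs, sq_abs, mul_comm]
      exact mul_le_mul_of_nonneg_right (hκ z) (sq_nonneg _)
    rw [h4]
    simp
    nlinarith [sq_nonneg ‖psi P φ q‖]
  calc _ ≤ M⁻¹ ^ 2 * (M * (κ * ∫ z, q z ^ 2 ∂P)) := by gcongr
    _ = _ := by field_simp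

/-- Expected diagonal of the hat matrix -/
lemma T0 [Nonempty ι] {k : D → D → ℝ} (hpd : PosDefKernel k) (hk : ∀ z z', ⟪φ z, φ z'⟫ = k z z')
    (hφ : Continuous φ) (hκ : ∀ z, ‖φ z‖ ^ 2 ≤ κ) {σ : Type*} (S : Finset σ) {f : σ → D → ℝ}
    (hf : ∀ s ∈ S, BM (f s)) [DecidableEq σ]
    (ho : ∀ s ∈ S, ∀ s' ∈ S, ∫ z, f s z * f s' z ∂P = if s = s' then 1 else 0) {c : ℝ} (hc : 0 < c) :
    ∫ x : Option ι → D, Hm (kmat k x) c none none ∂(Measure.pi (fun _ : Option ι => P)) ≤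
      c⁻¹ * (∫ z, ‖φ z‖ ^ 2 ∂P - ∑ s ∈ S, ‖psi P φ (f s)‖ ^ 2 + κ * S.card / Fintype.card ι)
        + S.card / Fintype.card ι := by
  have hM : (0 : ℝ) < Fintype.card ι := by exact_mod_cast Fintype.card_pos
  have hks : ∀ x y, k x y = k y x := fun x y => by rw [← hk, ← hk, real_inner_comm]
  have hkm : Measurable fun q : D × D => k q.1 q.2 := by
    simp_rw [← hk]
    exact ((hφ.comp continuous_fst).inner (hφ.comp continuous_snd)).measurable
  set M : ℝ := ((Fintype.card ι : ℕ) : ℝ) with hMd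
  have hφ' := BM_phi hφ hκ
  let h : σ → (ι → D) → H := fun s x => M⁻¹ • ∑ j, f s (x j) • φ (x j)
  let w : (ι → D) → D → ι → ℝ := fun x z j => M⁻¹ * ∑ s ∈ S, f s z * f s (x j)
  have hpt : ∀ (x : ι → D) (z : D), Hm (kmat k (optc (x, z))) c none none ≤
      c⁻¹ * ‖φ z - ∑ s ∈ S, f s z • h s x‖ ^ 2 + ∑ j, w x z j ^ 2 := by
    intro x z
    have h1 := (spd_kmat hpd hks (optc (x, z))).H_diag_var hc none (fun o : Option ι => o.elim 0 (w x z))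
    refine h1.trans (le_of_eq ?_)
    congr 1
    · congr 1
      have h2 : φ z - ∑ s ∈ S, f s z • h s x = ∑ o : Option ι,
          ((Pi.single none 1 : Option ι → ℝ) - fun o : Option ι => o.elim 0 (w x z)) o • φ (optc (x, z) o) := by
        rw [Fintype.sum_option]
        simp only [Pi.sub_apply, Pi.single_eq_same, Option.elim_none, sub_zero, one_smul, optc,
          Option.elim_some]
        rw [sub_eq_add_neg]
        congr 1
        rw [← Finset.sum_neg_distrib]
        simp only [ne_eq, reduceCtorEq, not_false_eq_true, Pi.single_eq_of_ne, zero_sub, w, h,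
          Finset.smul_sum, neg_smul, Finset.mul_sum, Finset.sum_smul, Finset.sum_neg_distrib]
        rw [Finset.sum_comm]
        simp only [smul_smul]
        congr 1
        refine Finset.sum_congr rfl fun j _ => Finset.sum_congr rfl fun s _ => ?_
        congr 1; ring
      rw [h2, ← real_inner_self_eq_norm_sq, sum_inner]
      simp_rw [inner_sum, inner_smul_left, inner_smul_right, hk]
      simp only [dotProduct, Matrix.mulVec, Finset.mul_sum, kmat, Matrix.of_apply]
      refine Finset.sum_congr rfl fun a _ => Finset.sum_congr rfl fun b _ => ?_
      simp; exact Or.inl (by ring)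
    · simp [dotProduct, Fintype.sum_option, sq]
  have hhB : ∀ s ∈ S, BM (h s) := by
    intro s hs
    refine (BM.const (M⁻¹)).smul (BM.sum fun j _ => ?_)
    exact ((hf s hs).comp (measurable_pi_apply j)).smul (hφ'.comp (measurable_pi_apply j))
  -- inner integrals
  have hz1 : ∀ x : ι → D, ∫ z, ‖φ z - ∑ s ∈ S, f s z • h s x‖ ^ 2 ∂P =
      ∫ z, ‖φ z‖ ^ 2 ∂P - ∑ s ∈ S, ‖psi P φ (f s)‖ ^ 2 + ∑ s ∈ S, ‖h s x - psi P φ (f s)‖ ^ 2 := by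
    intro x
    have e1 : ∀ z, ‖φ z - ∑ s ∈ S, f s z • h s x‖ ^ 2 = ‖φ z‖ ^ 2 - 2 * ∑ s ∈ S, ⟪f s z • φ z, h s x⟫
        + ∑ s ∈ S, ∑ s' ∈ S, (f s z * f s' z) * ⟪h s x, h s' x⟫ := by
      intro z
      rw [norm_sub_sq_real, ← real_inner_self_eq_norm_sq (∑ s ∈ S, f s z • h s x), inner_sum, sum_inner]
      simp_rw [inner_sum, inner_smul_left, inner_smul_right]
      simp [mul_assoc]
    simp_rw [e1]
    have b1 := hφ'.norm.pow 2
    have b2 : BM fun z => 2 * ∑ s ∈ S, ⟪f s z • φ z, h s x⟫ :=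
      (BM.sum fun s hs => ((hf s hs).smul hφ').inner (BM.const _)).const_mul 2
    have b3 : ∀ s ∈ S, ∀ s' ∈ S, BM fun z => (f s z * f s' z) * ⟪h s x, h s' x⟫ :=
      fun s hs s' hs' => ((hf s hs).mul (hf s' hs')).mul (BM.const _)
    rw [integral_add ((b1.sub b2).integrable P) ((BM.sum fun s hs => BM.sum fun s' hs' => b3 s hs s' hs').integrable P),
      integral_sub (b1.integrable P) (b2.integrable P), integral_const_mul,
      integral_finsetSum _ fun s hs => (((hf s hs).smul hφ').inner (BM.const _)).integrable P,
      integral_finsetSum _ fun s hs => (BM.sum fun s' hs' => b3 s hs s' hs').integrable P]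
    have e2 : ∀ s ∈ S, ∫ z, ⟪f s z • φ z, h s x⟫ ∂P = ⟪psi P φ (f s), h s x⟫ := by
      intro s hs
      simp_rw [real_inner_comm (h s x)]
      rw [integral_inner (((hf s hs).smul hφ').integrable P), psi]
    have e3 : ∀ s ∈ S, ∫ z, ∑ s' ∈ S, (f s z * f s' z) * ⟪h s x, h s' x⟫ ∂P = ‖h s x‖ ^ 2 := by
      intro s hs
      rw [integral_finsetSum _ fun s' hs' => (b3 s hs s' hs').integrable P, Finset.sum_eq_single s]
      · rw [integral_mul_const, ho s hs s hs, real_inner_self_eq_norm_sq]; simp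
      · intro s' hs' hne
        rw [integral_mul_const, ho s hs s' hs', if_neg hne.symm, zero_mul]
      · intro h; exact absurd hs h
    rw [Finset.sum_congr rfl e2, Finset.sum_congr rfl e3]
    simp_rw [norm_sub_sq_real, Finset.sum_add_distrib, Finset.sum_sub_distrib, ← Finset.mul_sum]
    simp_rw [real_inner_comm (h _ x)]
    ring
  have hz2 : ∀ x : ι → D, ∫ z, ∑ j, w x z j ^ 2 ∂P = M⁻¹ ^ 2 * ∑ j, ∑ s ∈ S, f s (x j) ^ 2 := by
    intro x
    have hw : ∀ j, BM fun z => w x z j ^ 2 := fun j =>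
      ((BM.sum fun s hs => (hf s hs).mul (BM.const _)).const_mul _).pow 2
    rw [integral_finsetSum _ fun j _ => (hw j).integrable P, Finset.mul_sum]
    refine Finset.sum_congr rfl fun j _ => ?_
    have e1 : ∀ z, w x z j ^ 2 = M⁻¹ ^ 2 * ∑ s ∈ S, ∑ s' ∈ S, (f s z * f s' z) * (f s (x j) * f s' (x j)) := by
      intro z
      simp only [w]
      rw [mul_pow, sq (∑ s ∈ S, f s z * f s (x j)), Finset.sum_mul_sum]
      congr 1
      refine Finset.sum_congr rfl fun s _ => Finset.sum_congr rfl fun s' _ => by ring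
    simp_rw [e1]
    have b3 : ∀ s ∈ S, ∀ s' ∈ S, BM fun z => (f s z * f s' z) * (f s (x j) * f s' (x j)) :=
      fun s hs s' hs' => ((hf s hs).mul (hf s' hs')).mul (BM.const _)
    rw [integral_const_mul,
      integral_finsetSum _ fun s hs => (BM.sum fun s' hs' => b3 s hs s' hs').integrable P]
    congr 1
    refine Finset.sum_congr rfl fun s hs => ?_
    rw [integral_finsetSum _ fun s' hs' => (b3 s hs s' hs').integrable P, Finset.sum_eq_single s]
    · rw [integral_mul_const, ho s hs s hs]; simp [sq]
    · intro s' hs' hne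
      rw [integral_mul_const, ho s hs s' hs', if_neg hne.symm, zero_mul]
    · intro h; exact absurd hs h
  have hHB := BM_Hm (ι := Option ι) hkm hpd hks hc none none
  rw [pi_integral_option hHB]
  have hb1 : ∀ x : ι → D, BM fun z => ‖φ z - ∑ s ∈ S, f s z • h s x‖ ^ 2 := fun x =>
    ((hφ'.sub (BM.sum fun s hs => (hf s hs).smul (BM.const _))).norm).pow 2
  have hb2 : ∀ x : ι → D, BM fun z => ∑ j, w x z j ^ 2 := fun x =>
    BM.sum fun j _ => ((BM.sum fun s hs => (hf s hs).mul (BM.const _)).const_mul _).pow 2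
  have hin : ∀ x : ι → D, ∫ z, Hm (kmat k (optc (x, z))) c none none ∂P ≤
      c⁻¹ * (∫ z, ‖φ z‖ ^ 2 ∂P - ∑ s ∈ S, ‖psi P φ (f s)‖ ^ 2 + ∑ s ∈ S, ‖h s x - psi P φ (f s)‖ ^ 2)
        + M⁻¹ ^ 2 * ∑ j, ∑ s ∈ S, f s (x j) ^ 2 := by
    intro x
    rw [← hz1, ← hz2, ← integral_const_mul, ← integral_add (((hb1 x).const_mul _).integrable P) ((hb2 x).integrable P)]
    have hm : Measurable fun z => optc (x, z) := measurable_optc.comp (measurable_const.prodMk measurable_id)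
    exact integral_mono ((hHB.comp hm).integrable P)
      ((((hb1 x).const_mul _).add (hb2 x)).integrable P) (hpt x)
  have hBs : ∀ s ∈ S, BM fun x : ι → D => ‖h s x - psi P φ (f s)‖ ^ 2 := fun s hs =>
    (((hhB s hs).sub (BM.const _)).norm).pow 2
  have hBf : ∀ j : ι, ∀ s ∈ S, BM fun x : ι → D => f s (x j) ^ 2 := fun j s hs =>
    ((hf s hs).comp (measurable_pi_apply j)).pow 2
  have B1 : BM fun x : ι → D => c⁻¹ * (∫ z, ‖φ z‖ ^ 2 ∂P - ∑ s ∈ S, ‖psi P φ (f s)‖ ^ 2 + ∑ s ∈ S, ‖h s x - psi P φ (f s)‖ ^ 2) :=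
    ((BM.const _).add (BM.sum hBs)).const_mul _
  have B2 : BM fun x : ι → D => M⁻¹ ^ 2 * ∑ j, ∑ s ∈ S, f s (x j) ^ 2 :=
    (BM.sum fun j _ => BM.sum (hBf j)).const_mul _
  have step : ∫ x : ι → D, ∫ z, Hm (kmat k (optc (x, z))) c none none ∂P ∂(Measure.pi (fun _ : ι => P)) ≤
      ∫ x : ι → D, (c⁻¹ * (∫ z, ‖φ z‖ ^ 2 ∂P - ∑ s ∈ S, ‖psi P φ (f s)‖ ^ 2 + ∑ s ∈ S, ‖h s x - psi P φ (f s)‖ ^ 2)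
        + M⁻¹ ^ 2 * ∑ j, ∑ s ∈ S, f s (x j) ^ 2) ∂(Measure.pi (fun _ : ι => P)) :=
    integral_mono (((hHB.comp measurable_optc).integrable ((Measure.pi (fun _ : ι => P)).prod P)).integral_prod_left)
      ((B1.add B2).integrable _) hin
  refine step.trans ?_
  rw [integral_add (B1.integrable _) (B2.integrable _), integral_const_mul, integral_const_mul,
    integral_add (integrable_const _) ((BM.sum hBs).integrable _), integral_finsetSum _ fun s hs => (hBs s hs).integrable _,
    integral_finsetSum _ fun j _ => (BM.sum (hBf j)).integrable _]
  have f1 : ∀ s ∈ S, ∫ z, f s z ^ 2 ∂P = 1 := by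
    intro s hs
    simp_rw [sq]
    rw [ho s hs s hs, if_pos rfl]
  have e4 : ∑ s ∈ S, ∫ x : ι → D, ‖h s x - psi P φ (f s)‖ ^ 2 ∂(Measure.pi (fun _ : ι => P)) ≤ κ * S.card / M := by
    calc _ ≤ ∑ s ∈ S, κ / M := Finset.sum_le_sum fun s hs => by
          have := samp (ι := ι) (P := P) hφ hκ (hf s hs)
          rw [f1 s hs, mul_one] at this
          exact this
      _ = _ := by rw [Finset.sum_const, nsmul_eq_mul]; ring
  have e5 : M⁻¹ ^ 2 * ∑ j : ι, ∫ x : ι → D, ∑ s ∈ S, f s (x j) ^ 2 ∂(Measure.pi (fun _ : ι => P)) = S.card / M := by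
    have : ∀ j : ι, ∫ x : ι → D, ∑ s ∈ S, f s (x j) ^ 2 ∂(Measure.pi (fun _ : ι => P)) = S.card := by
      intro j
      rw [integral_finsetSum _ fun s hs => (hBf j s hs).integrable _]
      have : ∀ s ∈ S, ∫ x : ι → D, f s (x j) ^ 2 ∂(Measure.pi (fun _ : ι => P)) = 1 := by
        intro s hs
        rw [pi_integral_one (F := fun z => f s z ^ 2) j ((hf s hs).pow 2).1, f1 s hs]
      rw [Finset.sum_congr rfl this]; simp
    simp_rw [this]
    rw [Finset.sum_const, Finset.card_univ, nsmul_eq_mul, ← hMd]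
    field_simp
  rw [e5]
  simp only [integral_const, probReal_univ, one_smul]
  gcongr

end samp
end CIProof
end

section

namespace CIProof
set_option linter.unusedSectionVars false
section eig
variable {D : Type} [TopologicalSpace D] [MeasurableSpace D] [BorelSpace D]
  [SecondCountableTopology D] {P : Measure D} [IsProbabilityMeasure P]
  {H : Type} [NormedAddCommGroup H] [InnerProductSpace ℝ H] [CompleteSpace H]
  [TopologicalSpace.SeparableSpace H]
  {φ : D → H} {κ : ℝ}

/-- bounded continuous representative of an eigenfunction -/
def efun (P : Measure D) (φ : D → H) {σ : Type} (e : σ → Lp ℝ 2 P) (m : σ → ℝ) (i : σ) (z : D) : ℝ :=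
  (m i)⁻¹ * ⟪φ z, psi P φ (e i)⟫

lemma BM_efun (hφ : Continuous φ) (hκ : ∀ z, ‖φ z‖ ^ 2 ≤ κ) {σ : Type} (e : σ → Lp ℝ 2 P) (m : σ → ℝ) (i : σ) :
    BM (efun P φ e m i) :=
  ((BM_phi hφ hκ).inner (BM.const _)).const_mul _

lemma psi_congr {g g' : D → ℝ} (h : g =ᵐ[P] g') : psi P φ g = psi P φ g' := by
  refine integral_congr_ae ?_
  filter_upwards [h] with z hz
  rw [hz]

lemma efun_ae (hφ : Continuous φ) (hκ : ∀ z, ‖φ z‖ ^ 2 ≤ κ) {L : Lp ℝ 2 P →L[ℝ] Lp ℝ 2 P}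
    (hL : ∀ g : Lp ℝ 2 P, (L g : D → ℝ) =ᵐ[P] fun z => ∫ z', ⟪φ z, φ z'⟫ * g z' ∂P)
    {σ : Type} {e : σ → Lp ℝ 2 P} {m : σ → ℝ} {i : σ} (he : L (e i) = m i • e i) (hm : 0 < m i) :
    efun P φ e m i =ᵐ[P] e i := by
  have h1 := hL (e i)
  rw [he] at h1
  filter_upwards [h1, Lp.coeFn_smul (m i) (e i)] with z h1 h2
  rw [efun, inner_psi hφ hκ (Lp_integrable (e i))]
  rw [h2] at h1
  simp only [Pi.smul_apply, smul_eq_mul] at h1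
  have h3 : ∫ z', e i z' * ⟪φ z, φ z'⟫ ∂P = ∫ z', ⟪φ z, φ z'⟫ * e i z' ∂P := by
    congr 1; ext z'; ring
  rw [h3, ← h1]
  field_simp

variable {L : Lp ℝ 2 P →L[ℝ] Lp ℝ 2 P} {σ : Type} {e : HilbertBasis σ ℝ (Lp ℝ 2 P)} {m : σ → ℝ}

lemma efun_ortho [DecidableEq σ] (hφ : Continuous φ) (hκ : ∀ z, ‖φ z‖ ^ 2 ≤ κ)
    (hL : ∀ g : Lp ℝ 2 P, (L g : D → ℝ) =ᵐ[P] fun z => ∫ z', ⟪φ z, φ z'⟫ * g z' ∂P)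
    (he : ∀ i, L (e i) = m i • e i) {i j : σ} (hi : 0 < m i) (hj : 0 < m j) :
    ∫ z, efun P φ e m i z * efun P φ e m j z ∂P = if i = j then 1 else 0 := by
  have h1 := orthonormal_iff_ite.mp e.orthonormal i j
  rw [← h1, L2.inner_def]
  refine integral_congr_ae ?_
  filter_upwards [efun_ae hφ hκ hL (he i) hi, efun_ae hφ hκ hL (he j) hj] with z h1 h2
  simp only [h1, h2, RCLike.inner_apply, conj_trivial]
  ring

lemma psi_efun_ortho [DecidableEq σ] (hφ : Continuous φ) (hκ : ∀ z, ‖φ z‖ ^ 2 ≤ κ)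
    (hL : ∀ g : Lp ℝ 2 P, (L g : D → ℝ) =ᵐ[P] fun z => ∫ z', ⟪φ z, φ z'⟫ * g z' ∂P)
    (he : ∀ i, L (e i) = m i • e i) {i j : σ} (hi : 0 < m i) (hj : 0 < m j) :
    ⟪psi P φ (efun P φ e m i), psi P φ (efun P φ e m j)⟫ = if i = j then m i else 0 := by
  rw [psi_congr (efun_ae hφ hκ hL (he i) hi), psi_congr (efun_ae hφ hκ hL (he j) hj),
    ← L_inner hφ hκ L hL, he, inner_smul_left, orthonormal_iff_ite.mp e.orthonormal i j]
  simp

lemma hat_diag0 {k : D → D → ℝ} (hpd : PosDefKernel k) (hk : ∀ z z', ⟪φ z, φ z'⟫ = k z z')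
    (hφ : Continuous φ) (hκ : ∀ z, ‖φ z‖ ^ 2 ≤ κ)
    (hL : ∀ g : Lp ℝ 2 P, (L g : D → ℝ) =ᵐ[P] fun z => ∫ z', ⟪φ z, φ z'⟫ * g z' ∂P)
    {Q γ : ℝ} (hT : TraceAssumption P L Q γ) {ι : Type} [Fintype ι] [DecidableEq ι] [Nonempty ι]
    {lam c : ℝ} (hlam : 0 < lam) (hc : 0 < c) :
    ∫ x : Option ι → D, Hm (kmat k x) c none none ∂(Measure.pi (fun _ : Option ι => P)) ≤
      c⁻¹ * (2 * lam * (Q * lam ^ (-γ)) + κ * (2 * (Q * lam ^ (-γ))) / Fintype.card ι)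
        + 2 * (Q * lam ^ (-γ)) / Fintype.card ι := by
  classical
  obtain ⟨σ, e, m, hm, he, hs⟩ := spectral hφ hκ L hL
  have hLpos : ∀ g, 0 ≤ ⟪L g, g⟫ := fun g => by
    rw [L_inner hφ hκ L hL]; exact real_inner_self_nonneg
  obtain ⟨t1, t2⟩ := spectral_trace hT e hm he hLpos hs.summable hlam
  obtain ⟨S, hS, hc1, hc2⟩ := eff_bounds hm hs hlam t1 t2
  have hpos : ∀ s ∈ S, 0 < m s := fun s h => lt_of_lt_of_le hlam ((hS s).mp h)
  have hκ0 : 0 ≤ κ := by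
    have : Nonempty D := by
      by_contra h
      rw [not_nonempty_iff] at h
      have := measure_univ (μ := P)
      rw [Set.univ_eq_empty_iff.mpr h] at this
      simp at this
    exact (sq_nonneg _).trans (hκ (Classical.arbitrary D))
  have h1 := T0 (P := P) (ι := ι) hpd hk hφ hκ S (f := fun s => efun P φ e m s) (fun s _ => BM_efun hφ hκ e m s)
    (fun s hs s' hs' => efun_ortho hφ hκ hL he (hpos s hs) (hpos s' hs')) hc
  refine h1.trans ?_
  have h2 : ∑ s ∈ S, ‖psi P φ (efun P φ e m s)‖ ^ 2 = ∑ s ∈ S, m s := by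
    refine Finset.sum_congr rfl fun s hs => ?_
    rw [← real_inner_self_eq_norm_sq, psi_efun_ortho hφ hκ hL he (hpos s hs) (hpos s hs), if_pos rfl]
  rw [h2]
  gcongr

/-- expected leverage bound -/
lemma hat_diag1 {k : D → D → ℝ} (hpd : PosDefKernel k) (hk : ∀ z z', ⟪φ z, φ z'⟫ = k z z')
    (hφ : Continuous φ) (hκ : ∀ z, ‖φ z‖ ^ 2 ≤ κ) (hκ0 : 0 ≤ κ)
    (hL : ∀ g : Lp ℝ 2 P, (L g : D → ℝ) =ᵐ[P] fun z => ∫ z', ⟪φ z, φ z'⟫ * g z' ∂P)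
    {Q γ : ℝ} (hQ : 0 < Q) (hT : TraceAssumption P L Q γ) {ι : Type} [Fintype ι] [DecidableEq ι]
    {lam : ℝ} {r : ℕ} (hr : 2 ≤ r) (hrι : r ≤ Fintype.card ι) (hlam : 0 < lam)
    (h1 : lam ^ (-γ) = r * lam) (h2 : (r : ℝ)⁻¹ ≤ lam) (a : ι) :
    ∫ x : ι → D, Hm (kmat k x) (r * lam) a a ∂(Measure.pi (fun _ : ι => P)) ≤
      (6 + 4 * κ) * Q * lam := by
  have hr0 : (0 : ℝ) < r := by positivity
  have hc : 0 < (r : ℝ) * lam := by positivity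
  have hks : ∀ x y, k x y = k y x := fun x y => by rw [← hk, ← hk, real_inner_comm]
  have hkm : Measurable fun q : D × D => k q.1 q.2 := by
    simp_rw [← hk]
    exact ((hφ.comp continuous_fst).inner (hφ.comp continuous_snd)).measurable
  let τ : Option {b // b ≠ a} ≃ ι := Equiv.optionSubtypeNe a
  have hcard : Fintype.card {b // b ≠ a} + 1 = Fintype.card ι := by
    rw [← Fintype.card_option, Fintype.card_congr τ]
  have : Nonempty {b // b ≠ a} := by
    rw [← Fintype.card_pos_iff]; omega
  have e1 : ∫ x : ι → D, Hm (kmat k x) (r * lam) a a ∂(Measure.pi (fun _ : ι => P)) =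
      ∫ x : Option {b // b ≠ a} → D, Hm (kmat k x) (r * lam) none none ∂(Measure.pi (fun _ => P)) := by
    rw [← pi_integral_inj (P := P) (s := τ) τ.injective
      (F := fun x => Hm (kmat k x) (r * lam) none none) (measurable_Hm hkm _ _ _)]
    congr 1
    ext x
    rw [Hm_equiv]
    simp [τ]
  rw [e1]
  refine (hat_diag0 hpd hk hφ hκ hL hT hlam hc).trans ?_
  set M : ℝ := (Fintype.card {b // b ≠ a} : ℝ)
  have hM : (r : ℝ) ≤ 2 * M := by
    have : r ≤ 2 * Fintype.card {b // b ≠ a} := by omega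
    simp only [M]
    exact_mod_cast this
  have hM0 : 0 < M := by linarith
  rw [h1]
  have i1 : ((r : ℝ) * lam)⁻¹ * (2 * lam * (Q * (r * lam)) + κ * (2 * (Q * (r * lam))) / M) = 2 * Q * lam + 2 * κ * Q * M⁻¹ := by
    field_simp
  rw [i1]
  have i2 : M⁻¹ ≤ 2 * (r : ℝ)⁻¹ := by
    rw [inv_le_iff_one_le_mul₀ hM0, mul_assoc, inv_mul_eq_div, ← mul_div_assoc, le_div_iff₀ hr0]
    linarith
  have i3 : 2 * (Q * (r * lam)) / M ≤ 4 * Q * lam := by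
    rw [div_le_iff₀ hM0]
    nlinarith [mul_pos hQ hlam]
  have i4 : 2 * κ * Q * M⁻¹ ≤ 4 * κ * Q * lam := by
    have : M⁻¹ ≤ 2 * lam := by linarith
    have h0 : 0 ≤ 2 * κ * Q := by positivity
    nlinarith [mul_le_mul_of_nonneg_left this h0]
  linarith

end eig
end CIProof
end

section

namespace CIProof
set_option linter.unusedSectionVars false
section bias
variable {D : Type} [TopologicalSpace D] [MeasurableSpace D] [BorelSpace D]
  [SecondCountableTopology D] {P : Measure D} [IsProbabilityMeasure P]
  {H : Type} [NormedAddCommGroup H] [InnerProductSpace ℝ H] [CompleteSpace H]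
  [TopologicalSpace.SeparableSpace H]
  {φ : D → H} {κ : ℝ} {k : D → D → ℝ} {ι : Type} [Fintype ι] [DecidableEq ι]

/-- the residual of ridge regression, squared -/
def resid (k : D → D → ℝ) (c : ℝ) (x : ι → D) (v : ι → ℝ) : ℝ :=
  (c • Rm (kmat k x) c).mulVec v ⬝ᵥ (c • Rm (kmat k x) c).mulVec v

lemma dot_self (v : ι → ℝ) : v ⬝ᵥ v = ∑ i, v i ^ 2 := by simp [dotProduct, sq]

lemma resid_add (c : ℝ) (x : ι → D) (v w : ι → ℝ) :
    resid k c x (v + w) ≤ 2 * resid k c x v + 2 * resid k c x w := by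
  rw [resid, resid, resid, Matrix.mulVec_add, dot_self, dot_self, dot_self, Finset.mul_sum,
    Finset.mul_sum, ← Finset.sum_add_distrib]
  refine Finset.sum_le_sum fun i _ => ?_
  simp only [Pi.add_apply]
  nlinarith [sq_nonneg ((c • Rm (kmat k x) c).mulVec v i - (c • Rm (kmat k x) c).mulVec w i)]

lemma gram_dot (hk : ∀ z z', ⟪φ z, φ z'⟫ = k z z') (x : ι → D) (a : ι → ℝ) :
    ‖∑ i, a i • φ (x i)‖ ^ 2 = a ⬝ᵥ (kmat k x).mulVec a := by
  rw [← real_inner_self_eq_norm_sq, sum_inner]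
  simp_rw [inner_sum, inner_smul_left, inner_smul_right, hk]
  simp only [dotProduct, Matrix.mulVec, Finset.mul_sum, kmat, Matrix.of_apply]
  refine Finset.sum_congr rfl fun i _ => Finset.sum_congr rfl fun j _ => ?_
  simp only [conj_trivial]; ring

lemma resid_feature (hpd : PosDefKernel k) (hk : ∀ z z', ⟪φ z, φ z'⟫ = k z z') {c : ℝ} (hc : 0 < c)
    (x : ι → D) (f : H) : resid k c x (fun i => ⟪φ (x i), f⟫) ≤ c * ‖f‖ ^ 2 := by
  have hks : ∀ x y, k x y = k y x := fun x y => by rw [← hk, ← hk, real_inner_comm]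
  have hS := spd_kmat hpd hks x
  set v : ι → ℝ := fun i => ⟪φ (x i), f⟫ with hv
  rw [resid, Matrix.smul_mulVec]
  refine (hS.R_sq_le hc v).trans (mul_le_mul_of_nonneg_left ?_ hc.le)
  set a := (Rm (kmat k x) c).mulVec v with ha
  have h1 : (kmat k x).mulVec a + c • a = v := by
    rw [← Mm_mulVec, ha, Matrix.mulVec_mulVec, hS.M_R hc, Matrix.one_mulVec]
  have h2 : ‖∑ i, a i • φ (x i)‖ ^ 2 = v ⬝ᵥ a - c * (a ⬝ᵥ a) := by
    rw [gram_dot hk, ← h1, add_dotProduct, smul_dotProduct, smul_eq_mul, dotProduct_comm]; ring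
  have h3 : v ⬝ᵥ a = ⟪∑ i, a i • φ (x i), f⟫ := by
    rw [sum_inner]
    simp only [dotProduct, inner_smul_left, hv]
    refine Finset.sum_congr rfl fun i _ => ?_
    simp only [conj_trivial]; ring
  have h4 : 0 ≤ a ⬝ᵥ a := by rw [dot_self]; positivity
  have h5 : v ⬝ᵥ a ≤ ‖∑ i, a i • φ (x i)‖ * ‖f‖ := by rw [h3]; exact real_inner_le_norm _ _
  nlinarith [sq_nonneg (‖∑ i, a i • φ (x i)‖ - ‖f‖), mul_nonneg hc.le h4]

lemma kmeas (hk : ∀ z z', ⟪φ z, φ z'⟫ = k z z') (hφ : Continuous φ) : Measurable fun q : D × D => k q.1 q.2 := by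
  simp_rw [← hk]
  exact ((hφ.comp continuous_fst).inner (hφ.comp continuous_snd)).measurable

lemma ksymm (hk : ∀ z z', ⟪φ z, φ z'⟫ = k z z') : ∀ x y, k x y = k y x :=
  fun x y => by rw [← hk, ← hk, real_inner_comm]

lemma BM_cRv (hk : ∀ z z', ⟪φ z, φ z'⟫ = k z z') (hφ : Continuous φ) (hpd : PosDefKernel k) {c : ℝ} (hc : 0 < c)
    {v : (ι → D) → ι → ℝ} (hv : ∀ i, BM fun x => v x i) (i : ι) :
    BM fun x : ι → D => (c • Rm (kmat k x) c).mulVec (v x) i := by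
  simp only [Matrix.mulVec, dotProduct, Matrix.smul_apply, smul_eq_mul]
  exact BM.sum fun j _ => (BM_cRm (kmeas hk hφ) hpd (ksymm hk) hc i j).mul (hv j)

lemma BM_resid (hk : ∀ z z', ⟪φ z, φ z'⟫ = k z z') (hφ : Continuous φ) (hpd : PosDefKernel k) {c : ℝ} (hc : 0 < c)
    {v : (ι → D) → ι → ℝ} (hv : ∀ i, BM fun x => v x i) :
    BM fun x : ι → D => resid k c x (v x) := by
  simp only [resid, dot_self]
  exact BM.sum fun i _ => (BM_cRv hk hφ hpd hc hv i).pow 2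

lemma BM_eval {q : D → ℝ} (hq : BM q) (i : ι) : BM fun x : ι → D => q (x i) := hq.comp (measurable_pi_apply i)

lemma sum_eval {q : D → ℝ} (hq : BM q) : ∫ x : ι → D, ∑ i, q (x i) ^ 2 ∂(Measure.pi (fun _ : ι => P)) =
    Fintype.card ι * ∫ z, q z ^ 2 ∂P := by
  rw [integral_finsetSum _ fun i _ => ((BM_eval hq i).pow 2).integrable _]
  simp_rw [fun i : ι => pi_integral_one (P := P) (F := fun z => q z ^ 2) i (hq.pow 2).1]
  simp

lemma N_triv (hk : ∀ z z', ⟪φ z, φ z'⟫ = k z z') (hφ : Continuous φ) (hpd : PosDefKernel k) {c : ℝ} (hc : 0 < c)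
    {v : D → ℝ} (hv : BM v) :
    ∫ x : ι → D, resid k c x (fun i => v (x i)) ∂(Measure.pi (fun _ : ι => P)) ≤ Fintype.card ι * ∫ z, v z ^ 2 ∂P := by
  rw [← sum_eval hv]
  refine integral_mono ((BM_resid hk hφ hpd hc (BM_eval hv)).integrable _)
    ((BM.sum fun i _ => (BM_eval hv i).pow 2).integrable _) fun x => ?_
  have := (spd_kmat hpd (ksymm hk) x).cR_le hc (fun i => v (x i))
  simp only
  rw [← dot_self (fun i => v (x i)), resid, Matrix.smul_mulVec]
  exact this

lemma N_feature (hk : ∀ z z', ⟪φ z, φ z'⟫ = k z z') (hφ : Continuous φ) (hκ : ∀ z, ‖φ z‖ ^ 2 ≤ κ) (hpd : PosDefKernel k) {c : ℝ} (hc : 0 < c)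
    (f : H) :
    ∫ x : ι → D, resid k c x (fun i => ⟪φ (x i), f⟫) ∂(Measure.pi (fun _ : ι => P)) ≤ c * ‖f‖ ^ 2 := by
  have : BM fun z => ⟪φ z, f⟫ := (BM_phi hφ hκ).inner (BM.const _)
  have h := integral_mono (μ := Measure.pi (fun _ : ι => P)) ((BM_resid hk hφ hpd hc (BM_eval this)).integrable _)
    (integrable_const (c * ‖f‖ ^ 2)) fun x => resid_feature hpd hk hc x f
  simpa using h

lemma N_psi [Nonempty ι] (hk : ∀ z z', ⟪φ z, φ z'⟫ = k z z') (hφ : Continuous φ) (hκ : ∀ z, ‖φ z‖ ^ 2 ≤ κ)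
    (hpd : PosDefKernel k) {c : ℝ} (hc : 0 < c) {q : D → ℝ} (hq : BM q) :
    ∫ x : ι → D, resid k c x (fun i => ⟪φ (x i), psi P φ q⟫) ∂(Measure.pi (fun _ : ι => P)) ≤
      2 * (c ^ 2 / Fintype.card ι) * (∫ z, q z ^ 2 ∂P) + 2 * c * (κ * (∫ z, q z ^ 2 ∂P) / Fintype.card ι) := by
  have hM : (0 : ℝ) < Fintype.card ι := by exact_mod_cast Fintype.card_pos
  set M : ℝ := ((Fintype.card ι : ℕ) : ℝ) with hMd
  have hφ' := BM_phi hφ hκ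
  let mn : (ι → D) → H := fun x => M⁻¹ • ∑ j, q (x j) • φ (x j)
  have hmn : BM mn := (BM.const (M⁻¹)).smul (BM.sum fun j _ =>
    (BM_eval hq j).smul (hφ'.comp (measurable_pi_apply j)))
  have hpt : ∀ x : ι → D, resid k c x (fun i => ⟪φ (x i), psi P φ q⟫) ≤
      2 * ((c / M) ^ 2 * ∑ i, q (x i) ^ 2) + 2 * (c * ‖mn x - psi P φ q‖ ^ 2) := by
    intro x
    have hS := spd_kmat hpd (ksymm hk) x
    have h1 : (fun i => ⟪φ (x i), psi P φ q⟫) = (fun i => ⟪φ (x i), mn x⟫) + fun i => ⟪φ (x i), psi P φ q - mn x⟫ := by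
      ext i
      simp [inner_sub_right]
    rw [h1]
    refine (resid_add c x _ _).trans ?_
    have h2 : resid k c x (fun i => ⟪φ (x i), mn x⟫) ≤ (c / M) ^ 2 * ∑ i, q (x i) ^ 2 := by
      have h3 : (fun i => ⟪φ (x i), mn x⟫) = M⁻¹ • (kmat k x).mulVec (fun i => q (x i)) := by
        ext i
        simp only [mn, inner_smul_right, inner_sum, hk, Pi.smul_apply, smul_eq_mul, Matrix.mulVec,
          dotProduct, kmat, Matrix.of_apply]
        congr 1
        refine Finset.sum_congr rfl fun j _ => mul_comm _ _
      have h4 : (c • Rm (kmat k x) c).mulVec (fun i => ⟪φ (x i), mn x⟫) =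
          (c / M) • (Hm (kmat k x) c).mulVec (fun i => q (x i)) := by
        rw [h3, Matrix.mulVec_smul, Matrix.smul_mulVec, Matrix.mulVec_mulVec, hS.R_K hc, smul_smul]
        congr 1; field_simp
      rw [resid, h4, smul_dotProduct, dotProduct_smul, smul_eq_mul, smul_eq_mul, ← mul_assoc, ← sq]
      refine mul_le_mul_of_nonneg_left ?_ (sq_nonneg _)
      rw [← dot_self]
      exact hS.H_contr hc _
    have h5 := resid_feature hpd hk hc x (psi P φ q - mn x)
    rw [norm_sub_rev] at h5
    linarith
  have hI := integral_mono (μ := Measure.pi (fun _ : ι => P))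
    ((BM_resid hk hφ hpd hc (BM_eval (hφ'.inner (BM.const (psi P φ q))))).integrable _)
    ((((BM.sum fun i _ => (BM_eval hq i).pow 2).const_mul ((c / M) ^ 2)).const_mul 2).add
      ((((hmn.sub (BM.const _)).norm.pow 2).const_mul c).const_mul 2) |>.integrable _) hpt
  refine hI.trans ?_
  rw [integral_add ((((BM.sum fun i _ => (BM_eval hq i).pow 2).const_mul ((c / M) ^ 2)).const_mul 2).integrable _)
    (((((hmn.sub (BM.const _)).norm.pow 2).const_mul c).const_mul 2).integrable _), integral_const_mul,
    integral_const_mul, integral_const_mul, integral_const_mul, sum_eval hq]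
  have := samp (ι := ι) (P := P) hφ hκ hq
  have e1 : 2 * ((c / M) ^ 2 * (M * ∫ z, q z ^ 2 ∂P)) = 2 * (c ^ 2 / M) * (∫ z, q z ^ 2 ∂P) := by
    field_simp
  rw [← hMd, e1, mul_assoc 2 c]
  gcongr

end bias
end CIProof
end

section

namespace CIProof
set_option linter.unusedSectionVars false
section bias2
variable {D : Type} [TopologicalSpace D] [MeasurableSpace D] [BorelSpace D]
  [SecondCountableTopology D] {P : Measure D} [IsProbabilityMeasure P]
  {H : Type} [NormedAddCommGroup H] [InnerProductSpace ℝ H] [CompleteSpace H]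
  [TopologicalSpace.SeparableSpace H]
  {φ : D → H} {κ : ℝ} {k : D → D → ℝ} {ι : Type} [Fintype ι] [DecidableEq ι]
  {L : Lp ℝ 2 P →L[ℝ] Lp ℝ 2 P} {σ : Type} {e : HilbertBasis σ ℝ (Lp ℝ 2 P)} {m : σ → ℝ}

/-- finite combination of eigenfunctions -/
def qfun (P : Measure D) (φ : D → H) {σ : Type} (e : HilbertBasis σ ℝ (Lp ℝ 2 P)) (m : σ → ℝ) (S : Finset σ) (a : σ → ℝ)
    (z : D) : ℝ := ∑ i ∈ S, a i * efun P φ e m i z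

lemma BM_qfun (hφ : Continuous φ) (hκ : ∀ z, ‖φ z‖ ^ 2 ≤ κ) (S : Finset σ) (a : σ → ℝ) : BM (qfun P φ e m S a) :=
  BM.sum fun i _ => (BM_efun hφ hκ e m i).const_mul _

lemma qfun_sq (hφ : Continuous φ) (hκ : ∀ z, ‖φ z‖ ^ 2 ≤ κ)
    (hL : ∀ g : Lp ℝ 2 P, (L g : D → ℝ) =ᵐ[P] fun z => ∫ z', ⟪φ z, φ z'⟫ * g z' ∂P)
    (he : ∀ i, L (e i) = m i • e i) (S : Finset σ) (hS : ∀ i ∈ S, 0 < m i) (a : σ → ℝ) :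
    ∫ z, qfun P φ e m S a z ^ 2 ∂P = ∑ i ∈ S, a i ^ 2 := by
  classical
  have h1 : ∀ z, qfun P φ e m S a z ^ 2 = ∑ i ∈ S, ∑ j ∈ S, a i * a j * (efun P φ e m i z * efun P φ e m j z) := by
    intro z
    rw [qfun, sq, Finset.sum_mul_sum]
    refine Finset.sum_congr rfl fun i _ => Finset.sum_congr rfl fun j _ => by ring
  have hb : ∀ i j, BM fun z => a i * a j * (efun P φ e m i z * efun P φ e m j z) := fun i j =>
    ((BM_efun hφ hκ e m i).mul (BM_efun hφ hκ e m j)).const_mul _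
  simp_rw [h1]
  rw [integral_finsetSum _ fun i _ => (BM.sum fun j _ => hb i j).integrable P]
  refine Finset.sum_congr rfl fun i hi => ?_
  rw [integral_finsetSum _ fun j _ => (hb i j).integrable P, Finset.sum_eq_single i]
  · rw [integral_const_mul, efun_ortho hφ hκ hL he (hS i hi) (hS i hi)]; simp [sq]
  · intro j hj hne
    rw [integral_const_mul, efun_ortho hφ hκ hL he (hS i hi) (hS j hj), if_neg hne.symm, mul_zero]
  · intro h; exact absurd hi h

lemma psi_qfun (hφ : Continuous φ) (hκ : ∀ z, ‖φ z‖ ^ 2 ≤ κ) (S : Finset σ) (a : σ → ℝ) :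
    psi P φ (qfun P φ e m S a) = ∑ i ∈ S, a i • psi P φ (efun P φ e m i) := by
  simp only [psi, qfun, Finset.sum_smul]
  rw [integral_finsetSum _ fun i _ => (((BM_efun hφ hκ e m i).const_mul (a i)).smul (BM_phi hφ hκ)).integrable P]
  refine Finset.sum_congr rfl fun i _ => ?_
  rw [← integral_smul]
  simp [smul_smul]

lemma psi_qfun_sq (hφ : Continuous φ) (hκ : ∀ z, ‖φ z‖ ^ 2 ≤ κ)
    (hL : ∀ g : Lp ℝ 2 P, (L g : D → ℝ) =ᵐ[P] fun z => ∫ z', ⟪φ z, φ z'⟫ * g z' ∂P)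
    (he : ∀ i, L (e i) = m i • e i) (S : Finset σ) (hS : ∀ i ∈ S, 0 < m i) (a : σ → ℝ) :
    ‖psi P φ (qfun P φ e m S a)‖ ^ 2 = ∑ i ∈ S, a i ^ 2 * m i := by
  classical
  rw [psi_qfun hφ hκ, ← real_inner_self_eq_norm_sq, sum_inner]
  refine Finset.sum_congr rfl fun i hi => ?_
  rw [inner_sum, Finset.sum_eq_single i]
  · rw [inner_smul_left, inner_smul_right, psi_efun_ortho hφ hκ hL he (hS i hi) (hS i hi)]; simp; ring
  · intro j hj hne
    rw [inner_smul_left, inner_smul_right, psi_efun_ortho hφ hκ hL he (hS i hi) (hS j hj), if_neg hne.symm]; simp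
  · intro h; exact absurd hi h

lemma inner_psi_qfun (hφ : Continuous φ) (hκ : ∀ z, ‖φ z‖ ^ 2 ≤ κ)
    (hL : ∀ g : Lp ℝ 2 P, (L g : D → ℝ) =ᵐ[P] fun z => ∫ z', ⟪φ z, φ z'⟫ * g z' ∂P)
    (he : ∀ i, L (e i) = m i • e i) (S : Finset σ) (hS : ∀ i ∈ S, 0 < m i) (a : σ → ℝ) :
    (fun z => ⟪φ z, psi P φ (qfun P φ e m S a)⟫) =ᵐ[P] ((∑ i ∈ S, (a i * m i) • e i : Lp ℝ 2 P) : D → ℝ) := by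
  have h1 : ∀ᵐ z ∂P, ∀ i ∈ S, efun P φ e m i z = e i z :=
    (eventually_all_finset S).mpr fun i hi => efun_ae hφ hκ hL (he i) (hS i hi)
  have h2 : ∀ᵐ z ∂P, ∀ i ∈ S, (((a i * m i) • e i : Lp ℝ 2 P) : D → ℝ) z = a i * m i * e i z :=
    (eventually_all_finset S).mpr fun i hi => Lp.coeFn_smul (a i * m i) (e i)
  have h3 : ∀ i ∈ S, ∀ z, ⟪φ z, psi P φ (efun P φ e m i)⟫ = m i * efun P φ e m i z := by
    intro i hi z
    rw [psi_congr (efun_ae hφ hκ hL (he i) (hS i hi)), efun, mul_inv_cancel_left₀ (hS i hi).ne']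
  filter_upwards [h1, h2, Lp.coeFn_finsetSum S (fun i => ((a i * m i) • e i : Lp ℝ 2 P))] with z h1 h2 h4
  rw [h4, psi_qfun hφ hκ, inner_sum, Finset.sum_apply]
  refine Finset.sum_congr rfl fun i hi => ?_
  rw [h2 i hi, inner_smul_right, h3 i hi, h1 i hi]; ring

lemma L2_sq (g : Lp ℝ 2 P) : ‖g‖ ^ 2 = ∫ z, g z ^ 2 ∂P := by
  rw [← real_inner_self_eq_norm_sq, L2.inner_def]
  refine integral_congr_ae (Eventually.of_forall fun z => ?_)
  simp [sq]

lemma bias_main (hpd : PosDefKernel k) (hk : ∀ z z', ⟪φ z, φ z'⟫ = k z z') (hφ : Continuous φ) (hκ : ∀ z, ‖φ z‖ ^ 2 ≤ κ) (hκ0 : 0 ≤ κ)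
    (hL : ∀ g : Lp ℝ 2 P, (L g : D → ℝ) =ᵐ[P] fun z => ∫ z', ⟪φ z, φ z'⟫ * g z' ∂P)
    {Lβ : Lp ℝ 2 P →L[ℝ] Lp ℝ 2 P} {β : ℝ} (hβ1 : 1 < β) (hβ2 : β ≤ 2) (hLβ : IsFracPower L (β / 2) Lβ)
    {u : D → ℝ} (hu : BM u) (g : Lp ℝ 2 P) (hg : (Lβ g : D → ℝ) =ᵐ[P] u) :
    ∃ C, 0 ≤ C ∧ ∀ (ι : Type) [Fintype ι] [DecidableEq ι] [Nonempty ι] (lam c : ℝ), 0 < lam → 0 < c →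
      c ≤ Fintype.card ι * lam → 1 ≤ Fintype.card ι * lam →
      ∫ x : ι → D, resid k c x (fun i => u (x i)) ∂(Measure.pi (fun _ : ι => P)) ≤
        Fintype.card ι * (C * lam ^ β) := by
  classical
  obtain ⟨σ, e, m, hm, he, hs⟩ := spectral hφ hκ L hL
  refine ⟨2 + 4 * (2 + 2 * κ) * ‖g‖ ^ 2 + 4 * ‖g‖ ^ 2, by positivity, ?_⟩
  intro ι _ _ _ lam c hlam hc hcl h1l
  have hM : (0 : ℝ) < Fintype.card ι := by exact_mod_cast Fintype.card_pos
  set M : ℝ := ((Fintype.card ι : ℕ) : ℝ) with hMd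
  have hlb : 0 < lam ^ β := Real.rpow_pos_of_pos hlam _
  -- truncation
  have hsum : HasSum (fun i => Lβ (e.repr g i • e i)) (Lβ g) := (e.hasSum_repr g).mapL Lβ
  obtain ⟨F, hF⟩ := ((Metric.tendsto_nhds.mp hsum (Real.sqrt (lam ^ β)) (Real.sqrt_pos.mpr hlb))).exists
  have hF2 : ‖Lβ g - ∑ i ∈ F, Lβ (e.repr g i • e i)‖ ^ 2 ≤ lam ^ β := by
    rw [dist_comm, dist_eq_norm] at hF
    calc _ ≤ Real.sqrt (lam ^ β) ^ 2 := by gcongr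
      _ = _ := Real.sq_sqrt hlb.le
  have hLe : ∀ i, Lβ (e.repr g i • e i) = (e.repr g i * m i ^ (β / 2)) • e i := by
    intro i
    rw [map_smul, hLβ.2 (m i) (e i) (he i), smul_smul]
  let S := F.filter fun i => 0 < m i
  let A := S.filter fun i => lam ≤ m i
  let B := S.filter fun i => ¬ lam ≤ m i
  let a : σ → ℝ := fun i => e.repr g i * m i ^ (β / 2 - 1)
  have hS : ∀ i ∈ S, 0 < m i := fun i hi => (Finset.mem_filter.mp hi).2
  have hA : ∀ i ∈ A, 0 < m i := fun i hi => hS i (Finset.mem_filter.mp hi).1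
  have hB : ∀ i ∈ B, 0 < m i := fun i hi => hS i (Finset.mem_filter.mp hi).1
  have hFS : ∑ i ∈ F, Lβ (e.repr g i • e i) = ∑ i ∈ S, (a i * m i) • e i := by
    rw [Finset.sum_filter]
    refine Finset.sum_congr rfl fun i _ => ?_
    rw [hLe]
    split_ifs with h
    · congr 1
      simp only [a]
      rw [mul_assoc, ← Real.rpow_add_one h.ne']
      ring_nf
    · have : m i = 0 := le_antisymm (not_lt.mp h) (hm i)
      rw [this, Real.zero_rpow (by linarith), mul_zero, zero_smul]
  have hgs : ∀ T : Finset σ, ∑ i ∈ T, e.repr g i ^ 2 ≤ ‖g‖ ^ 2 := by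
    intro T
    have := e.orthonormal.sum_inner_products_le (s := T) g
    simpa [e.repr_apply_apply] using this
  let v : Finset σ → D → ℝ := fun T z => ⟪φ z, psi P φ (qfun P φ e m T a)⟫
  have hv : ∀ T, BM (v T) := fun T => (BM_phi hφ hκ).inner (BM.const _)
  have hvS : ∀ z, v S z = v A z + v B z := by
    intro z
    simp only [v]
    rw [← inner_add_right, psi_qfun hφ hκ, psi_qfun hφ hκ, psi_qfun hφ hκ,
      Finset.sum_filter_add_sum_filter_not]
  have herr : ∫ z, (u z - v S z) ^ 2 ∂P ≤ lam ^ β := by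
    rw [hFS, L2_sq] at hF2
    refine le_trans (le_of_eq (integral_congr_ae ?_)) hF2
    filter_upwards [hg, inner_psi_qfun hφ hκ hL he S hS a, Lp.coeFn_sub (Lβ g) (∑ i ∈ S, (a i * m i) • e i)] with z h1 h2 h3
    rw [h3, Pi.sub_apply, h1, ← h2]
  have hqA : ∫ z, qfun P φ e m A a z ^ 2 ∂P ≤ lam ^ (β - 2) * ‖g‖ ^ 2 := by
    rw [qfun_sq hφ hκ hL he A hA]
    calc _ ≤ ∑ i ∈ A, lam ^ (β - 2) * e.repr g i ^ 2 := by
          refine Finset.sum_le_sum fun i hi => ?_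
          have h1 : lam ≤ m i := (Finset.mem_filter.mp hi).2
          have h2 : (m i ^ (β / 2 - 1)) ^ 2 = m i ^ (β - 2) := by
            rw [← Real.rpow_natCast, ← Real.rpow_mul (hm i)]; congr 1; push_cast; ring
          simp only [a]
          rw [mul_pow, h2, mul_comm]
          exact mul_le_mul_of_nonneg_right (Real.rpow_le_rpow_of_nonpos hlam h1 (by linarith)) (sq_nonneg _)
      _ ≤ _ := by
          rw [← Finset.mul_sum]
          exact mul_le_mul_of_nonneg_left (hgs A) (by positivity)
  have hqB : ‖psi P φ (qfun P φ e m B a)‖ ^ 2 ≤ lam ^ (β - 1) * ‖g‖ ^ 2 := by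
    rw [psi_qfun_sq hφ hκ hL he B hB]
    calc _ ≤ ∑ i ∈ B, lam ^ (β - 1) * e.repr g i ^ 2 := by
          refine Finset.sum_le_sum fun i hi => ?_
          have h1 : m i ≤ lam := (not_le.mp (Finset.mem_filter.mp hi).2).le
          have h2 : (m i ^ (β / 2 - 1)) ^ 2 * m i = m i ^ (β - 1) := by
            rw [← Real.rpow_natCast, ← Real.rpow_mul (hm i), ← Real.rpow_add_one (hB i hi).ne']; congr 1; push_cast; ring
          simp only [a]
          rw [mul_pow, mul_assoc, h2, mul_comm]
          exact mul_le_mul_of_nonneg_right (Real.rpow_le_rpow (hm i) h1 (by linarith)) (sq_nonneg _)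
      _ ≤ _ := by
          rw [← Finset.mul_sum]
          exact mul_le_mul_of_nonneg_left (hgs B) (by positivity)
  have hpt : ∀ x : ι → D, resid k c x (fun i => u (x i)) ≤ 2 * resid k c x (fun i => u (x i) - v S (x i)) +
      (4 * resid k c x (fun i => v A (x i)) + 4 * resid k c x (fun i => v B (x i))) := by
    intro x
    have h1 := resid_add (k := k) c x (fun i => u (x i) - v S (x i)) (fun i => v S (x i))
    have h2 := resid_add (k := k) c x (fun i => v A (x i)) (fun i => v B (x i))
    have h3 : (fun i => u (x i) - v S (x i)) + (fun i => v S (x i)) = fun i => u (x i) := by ext i; simp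
    have h4 : (fun i => v A (x i)) + (fun i => v B (x i)) = fun i => v S (x i) := by ext i; simp [hvS]
    rw [h3] at h1
    rw [h4] at h2
    linarith
  have b0 := BM_resid (ι := ι) hk hφ hpd hc (BM_eval hu)
  have b1 := BM_resid (ι := ι) hk hφ hpd hc (BM_eval (hu.sub (hv S)))
  have b2 := BM_resid (ι := ι) hk hφ hpd hc (BM_eval (hv A))
  have b3 := BM_resid (ι := ι) hk hφ hpd hc (BM_eval (hv B))
  have hI := integral_mono (μ := Measure.pi (fun _ : ι => P)) (b0.integrable _)
    (((b1.const_mul 2).add ((b2.const_mul 4).add (b3.const_mul 4))).integrable _) hpt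
  rw [integral_add ((b1.const_mul 2).integrable _) (((b2.const_mul 4).add (b3.const_mul 4)).integrable _),
    integral_add ((b2.const_mul 4).integrable _) ((b3.const_mul 4).integrable _), integral_const_mul,
    integral_const_mul, integral_const_mul] at hI
  have n1 := N_triv (ι := ι) (P := P) hk hφ hpd hc (hu.sub (hv S))
  have n2 := N_psi (ι := ι) (P := P) hk hφ hκ hpd hc (BM_qfun (e := e) (m := m) hφ hκ A a)
  have n3 := N_feature (ι := ι) (P := P) hk hφ hκ hpd hc (psi P φ (qfun P φ e m B a))
  rw [← hMd] at n1 n2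
  have n1' : M * ∫ z, (u z - v S z) ^ 2 ∂P ≤ M * lam ^ β := by gcongr
  have p2 : lam ^ (β - 2) * lam ^ 2 = lam ^ β := by
    rw [← Real.rpow_natCast, ← Real.rpow_add hlam]; congr 1; push_cast; ring
  have p1 : lam ^ (β - 1) * lam = lam ^ β := by
    rw [← Real.rpow_add_one hlam.ne']; congr 1; ring
  set qA := ∫ z, qfun P φ e m A a z ^ 2 ∂P
  have hqA0 : 0 ≤ qA := integral_nonneg fun z => sq_nonneg _
  have n2' : 2 * (c ^ 2 / M) * qA + 2 * c * (κ * qA / M) ≤ M * ((2 + 2 * κ) * ‖g‖ ^ 2 * lam ^ β) := by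
    have t1 : c ^ 2 / M ≤ M * lam ^ 2 := by
      rw [div_le_iff₀ hM]
      nlinarith [mul_pos hM hlam]
    have t2 : c / M ≤ M * lam ^ 2 := by
      rw [div_le_iff₀ hM]
      nlinarith [mul_pos hM hlam]
    calc _ = (2 * (c ^ 2 / M) + 2 * κ * (c / M)) * qA := by ring
      _ ≤ (2 * (M * lam ^ 2) + 2 * κ * (M * lam ^ 2)) * (lam ^ (β - 2) * ‖g‖ ^ 2) := by gcongr
      _ = _ := by rw [← p2]; ring
  have n3' : c * ‖psi P φ (qfun P φ e m B a)‖ ^ 2 ≤ M * (‖g‖ ^ 2 * lam ^ β) := by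
    calc _ ≤ (M * lam) * (lam ^ (β - 1) * ‖g‖ ^ 2) := by gcongr
      _ = _ := by rw [← p1]; ring
  have n2'' := n2.trans n2'
  have n3'' := n3.trans n3'
  have n1'' := n1.trans n1'
  refine hI.trans ?_
  calc _ ≤ 2 * (M * lam ^ β) + (4 * (M * ((2 + 2 * κ) * ‖g‖ ^ 2 * lam ^ β)) + 4 * (M * (‖g‖ ^ 2 * lam ^ β))) := by
        gcongr
    _ = _ := by ring

end bias2
end CIProof
end

section

namespace CIProof
set_option linter.unusedSectionVars false

/-- kernel facts at a fixed sample size -/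
structure KF {D : Type} [MeasurableSpace D] (P : Measure D) [IsProbabilityMeasure P] (k : D → D → ℝ) (r : ℕ)
    (lam κ Cl : ℝ) : Prop where
  pd : PosDefKernel k
  symm : ∀ x y, k x y = k y x
  meas : Measurable fun q : D × D => k q.1 q.2
  diag : ∀ z, k z z ≤ κ
  κ0 : 0 ≤ κ
  r2 : 2 ≤ r
  lam0 : 0 < lam
  c1 : 1 ≤ r * lam
  Cl0 : 0 ≤ Cl
  lev : ∀ (ι : Type) [Fintype ι] [DecidableEq ι], r ≤ Fintype.card ι → ∀ a : ι,
    ∫ x : ι → D, Hm (kmat k x) (r * lam) a a ∂(Measure.pi (fun _ : ι => P)) ≤ Cl * lam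

/-- bias facts at a fixed sample size -/
structure BF {D : Type} [MeasurableSpace D] (P : Measure D) [IsProbabilityMeasure P] (k : D → D → ℝ) (r : ℕ)
    (lam : ℝ) (u : D → ℝ) (Cb : ℝ) : Prop where
  bm : BM u
  Cb0 : 0 ≤ Cb
  bd : ∀ (ι : Type) [Fintype ι] [DecidableEq ι], r ≤ Fintype.card ι →
    ∫ x : ι → D, resid k (r * lam) x (fun i => u (x i)) ∂(Measure.pi (fun _ : ι => P)) ≤ Fintype.card ι * Cb

section ex
variable {D : Type} [MeasurableSpace D] {P : Measure D} [IsProbabilityMeasure P]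
  {ι : Type} [Fintype ι] [DecidableEq ι]

lemma BM_ev {q : D → ℝ} (hq : BM q) (i : ι) : BM fun x : ι → D => q (x i) := hq.comp (measurable_pi_apply i)

lemma exch1 {F : (ι → D) → ι → ℝ} (hF : ∀ a, Measurable fun x => F x a)
    (he : ∀ (τ : ι ≃ ι) (x : ι → D) (a : ι), F (fun b => x (τ b)) a = F x (τ a)) (a b : ι) :
    ∫ x, F x a ∂(Measure.pi (fun _ : ι => P)) = ∫ x, F x b ∂(Measure.pi (fun _ : ι => P)) := by
  rw [← pi_integral_inj (P := P) (s := Equiv.swap a b) (Equiv.injective _) (hF a)]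
  congr 1
  ext x
  rw [he, Equiv.swap_apply_left]

lemma exch2 {F : (ι → D) → ι → ι → ℝ} (hF : ∀ a b, Measurable fun x => F x a b)
    (he : ∀ (τ : ι ≃ ι) (x : ι → D) (a b : ι), F (fun b => x (τ b)) a b = F x (τ a) (τ b)) {a b b' : ι}
    (hb : b ≠ a) (hb' : b' ≠ a) :
    ∫ x, F x b a ∂(Measure.pi (fun _ : ι => P)) = ∫ x, F x b' a ∂(Measure.pi (fun _ : ι => P)) := by
  rw [← pi_integral_inj (P := P) (s := Equiv.swap b b') (Equiv.injective _) (hF b a)]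
  congr 1
  ext x
  rw [he, Equiv.swap_apply_left, Equiv.swap_apply_of_ne_of_ne hb.symm hb'.symm]

variable {k : D → D → ℝ} {r : ℕ} {lam κ Cl Cb : ℝ} {u : D → ℝ}

lemma KF.c0 (h : KF P k r lam κ Cl) : 0 < (r : ℝ) * lam := by linarith [h.c1]

lemma KF.BM_H (h : KF P k r lam κ Cl) (a b : ι) : BM fun x : ι → D => Hm (kmat k x) (r * lam) a b :=
  BM_Hm h.meas h.pd h.symm h.c0 a b

lemma KF.BM_H2 (h : KF P k r lam κ Cl) (a b : ι) :
    BM fun x : ι → D => (Hm (kmat k x) (r * lam) * Hm (kmat k x) (r * lam)) a b := by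
  simp only [Matrix.mul_apply]
  exact BM.sum fun i _ => (h.BM_H a i).mul (h.BM_H i b)

lemma KF.BM_cRv (h : KF P k r lam κ Cl) {v : (ι → D) → ι → ℝ} (hv : ∀ i, BM fun x => v x i) (i : ι) :
    BM fun x : ι → D => (((r * lam : ℝ)) • Rm (kmat k x) (r * lam)).mulVec (v x) i := by
  simp only [Matrix.mulVec, dotProduct, Matrix.smul_apply, smul_eq_mul]
  exact BM.sum fun j _ => (BM_cRm h.meas h.pd h.symm h.c0 i j).mul (hv j)

lemma bias_idx (h : KF P k r lam κ Cl) (hb : BF P k r lam u Cb) (hr : r ≤ Fintype.card ι) (a : ι) :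
    ∫ x : ι → D, ((((r * lam : ℝ)) • Rm (kmat k x) (r * lam)).mulVec (fun i => u (x i)) a) ^ 2
      ∂(Measure.pi (fun _ : ι => P)) ≤ Cb := by
  have hBM : ∀ a : ι, BM fun x : ι → D => ((((r * lam : ℝ)) • Rm (kmat k x) (r * lam)).mulVec (fun i => u (x i)) a) ^ 2 :=
    fun a => (h.BM_cRv (BM_ev hb.bm) a).pow 2
  have h1 := hb.bd ι hr
  simp only [resid, dot_self] at h1
  rw [integral_finsetSum _ fun i _ => (hBM i).integrable _] at h1
  have h2 : ∀ b : ι, ∫ x : ι → D, ((((r * lam : ℝ)) • Rm (kmat k x) (r * lam)).mulVec (fun i => u (x i)) b) ^ 2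
      ∂(Measure.pi (fun _ : ι => P)) = ∫ x : ι → D, ((((r * lam : ℝ)) • Rm (kmat k x) (r * lam)).mulVec (fun i => u (x i)) a) ^ 2
      ∂(Measure.pi (fun _ : ι => P)) := by
    intro b
    refine exch1 (F := fun x a => ((((r * lam : ℝ)) • Rm (kmat k x) (r * lam)).mulVec (fun i => u (x i)) a) ^ 2)
      (fun a => (hBM a).measurable) ?_ b a
    intro τ x a
    simp only [Rm_equiv, Matrix.mulVec, dotProduct, Matrix.smul_apply, Matrix.submatrix_apply]
    congr 1
    exact Equiv.sum_comp τ (fun i => ((r * lam : ℝ)) • Rm (kmat k x) (r * lam) (τ a) i * u (x i))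
  simp_rw [h2] at h1
  rw [Finset.sum_const, Finset.card_univ, nsmul_eq_mul] at h1
  have : Nonempty ι := ⟨a⟩
  have hM : (0 : ℝ) < Fintype.card ι := by exact_mod_cast Fintype.card_pos
  exact le_of_mul_le_mul_left h1 hM

lemma off_aux {F : (ι → D) → ι → ι → ℝ} (hF : ∀ a b, BM fun x => F x a b) (h0 : ∀ x a b, 0 ≤ F x a b)
    (he : ∀ (τ : ι ≃ ι) (x : ι → D) (a b : ι), F (fun b => x (τ b)) a b = F x (τ a) (τ b)) {a b : ι}
    (hab : b ≠ a) {C : ℝ} (hC : ∫ x, ∑ b, F x b a ∂(Measure.pi (fun _ : ι => P)) ≤ C) :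
    ((Fintype.card ι - 1 : ℕ) : ℝ) * ∫ x, F x b a ∂(Measure.pi (fun _ : ι => P)) ≤ C := by
  rw [integral_finsetSum _ fun i _ => (hF i a).integrable _] at hC
  refine le_trans ?_ hC
  rw [← Finset.sum_erase_add _ _ (Finset.mem_univ a)]
  have h1 : ∑ b' ∈ Finset.univ.erase a, ∫ x, F x b' a ∂(Measure.pi (fun _ : ι => P)) =
      ∑ b' ∈ Finset.univ.erase a, ∫ x, F x b a ∂(Measure.pi (fun _ : ι => P)) :=
    Finset.sum_congr rfl fun b' hb' => exch2 (fun a b => (hF a b).measurable) he (Finset.ne_of_mem_erase hb') hab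
  rw [h1, Finset.sum_const, Finset.card_erase_of_mem (Finset.mem_univ a), Finset.card_univ, nsmul_eq_mul]
  have h2 : 0 ≤ ∫ x, F x a a ∂(Measure.pi (fun _ : ι => P)) := integral_nonneg fun x => h0 x a a
  linarith

lemma H_off (h : KF P k r lam κ Cl) (hr : r + 1 ≤ Fintype.card ι) {a b : ι} (hab : b ≠ a) :
    ∫ x : ι → D, (Hm (kmat k x) (r * lam) b a ^ 2 +
      (Hm (kmat k x) (r * lam) * Hm (kmat k x) (r * lam)) b a ^ 2) ∂(Measure.pi (fun _ : ι => P)) ≤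
      2 * Cl * lam / r := by
  have hr0 : (0 : ℝ) < r := by exact_mod_cast (by have := h.r2; omega : 0 < r)
  have hb : ∀ a b : ι, BM fun x : ι → D => (Hm (kmat k x) (r * lam) a b ^ 2 +
      (Hm (kmat k x) (r * lam) * Hm (kmat k x) (r * lam)) a b ^ 2) := fun a b =>
    ((h.BM_H a b).pow 2).add ((h.BM_H2 a b).pow 2)
  have h1 := off_aux (P := P) (F := fun x a b => (Hm (kmat k x) (r * lam) a b ^ 2 +
      (Hm (kmat k x) (r * lam) * Hm (kmat k x) (r * lam)) a b ^ 2)) hb (fun x a b => by positivity)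
      (fun τ x a b => by
        simp only [Hm_equiv, Matrix.submatrix_apply, Matrix.mul_apply]
        congr 2
        exact Equiv.sum_comp τ (fun i => Hm (kmat k x) (r * lam) (τ a) i * Hm (kmat k x) (r * lam) i (τ b)))
      hab (C := 2 * (Cl * lam)) (by
        refine le_trans (integral_mono ((BM.sum fun b _ => hb b a).integrable _)
          (((h.BM_H a a).const_mul 2).integrable _) fun x => ?_) ?_
        · have hS := spd_kmat h.pd h.symm x
          simp only
          rw [Finset.sum_add_distrib]
          linarith [hS.H_col h.c0 a, hS.H2_col h.c0 a]
        · rw [integral_const_mul]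
          have := h.lev ι (by omega) a
          linarith)
  have h2 : (r : ℝ) ≤ ((Fintype.card ι - 1 : ℕ) : ℝ) := by exact_mod_cast (by omega : r ≤ Fintype.card ι - 1)
  rw [le_div_iff₀ hr0]
  have h3 : 0 ≤ ∫ x : ι → D, (Hm (kmat k x) (r * lam) b a ^ 2 +
      (Hm (kmat k x) (r * lam) * Hm (kmat k x) (r * lam)) b a ^ 2) ∂(Measure.pi (fun _ : ι => P)) :=
    integral_nonneg fun x => by positivity
  nlinarith [mul_le_mul_of_nonneg_right h2 h3]

/-- smoothing weights of sample point i -/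
def Wr (k : D → D → ℝ) (r : ℕ) (lam : ℝ) (zs : ℕ → D) (i : ℕ) : Fin r → ℝ :=
  wvec k (r * lam) (fun l : Fin r => zs l) (zs i)

lemma Wr_norm (h : KF P k r lam κ Cl) (zs : ℕ → D) (i : ℕ) : ∑ l, Wr k r lam zs i l ^ 2 ≤ (1 + κ) ^ 2 := by
  have h1 := wvec_norm h.pd h.symm h.c1 h.diag (fun o : Option (Fin r) => o.elim (zs i) fun l => zs l)
  refine h1.trans ?_
  have := (spd_kmat h.pd h.symm (fun o : Option (Fin r) => o.elim (zs i) fun l => zs l)).H_diag_le h.c0 none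
  nlinarith [sq_nonneg (1 + κ)]

lemma BM_Wr (h : KF P k r lam κ Cl) (i : ℕ) (l : Fin r) : BM fun zs : ℕ → D => Wr k r lam zs i l := by
  refine BM.of_measurable (C := 1 + κ) ?_ fun zs => ?_
  · simp only [Wr, wvec, Matrix.mulVec, dotProduct]
    refine Finset.measurable_sum _ fun j _ => Measurable.mul ?_ ?_
    · exact (measurable_Rm (ι := Fin r) h.meas (r * lam) l j).comp
        (measurable_pi_lambda _ fun a => measurable_pi_apply (a : ℕ))
    · have hm : Measurable fun zs : ℕ → D => (zs j, zs i) :=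
        (measurable_pi_apply (j : ℕ)).prodMk (measurable_pi_apply i)
      exact h.meas.comp hm
  · have h1 := Wr_norm h zs i
    have h2 : Wr k r lam zs i l ^ 2 ≤ ∑ l, Wr k r lam zs i l ^ 2 :=
      Finset.single_le_sum (f := fun l => Wr k r lam zs i l ^ 2) (fun _ _ => sq_nonneg _) (Finset.mem_univ l)
    exact abs_le_of_sq_le_sq (h2.trans h1) (by linarith [h.κ0])

variable {Ω : Type*} [MeasurableSpace Ω] {μ : Measure Ω} [IsProbabilityMeasure μ] {z : ℕ → Ω → D}

/-- G1 -/
lemma G1 (h : KF P k r lam κ Cl) (hb : BF P k r lam u Cb) (hz : ∀ i, Measurable (z i)) (hi : iIndepFun z μ)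
    (hl : ∀ i, μ.map (z i) = P) (i : ℕ) :
    ∫ ω, (u (z i ω) - ∑ l, Wr k r lam (fun i => z i ω) i l * u (z l ω)) ^ 2 ∂μ ≤ (1 + κ) ^ 2 * Cb := by
  have hC := hb.Cb0
  have hκ := h.κ0
  by_cases hir : i < r
  · have hs : Function.Injective (fun l : Fin r => (l : ℕ)) := Fin.val_injective
    have h1 := integral_inj hz hi hl hs ((h.BM_cRv (ι := Fin r) (BM_ev hb.bm) ⟨i, hir⟩).pow 2).measurable
    have h2 := bias_idx h hb (ι := Fin r) (by simp) ⟨i, hir⟩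
    rw [← h1] at h2
    refine le_trans (le_of_eq ?_) (h2.trans (le_mul_of_one_le_left hC (by nlinarith)))
    congr 1
    ext ω
    have hS := spd_kmat h.pd h.symm (fun l : Fin r => z l ω)
    have h3 := wvec_self h.pd h.symm h.c0 (fun l : Fin r => z l ω) ⟨i, hir⟩
    simp only [Wr]
    simp only at h3
    rw [h3]
    congr 1
    have h4 : ((r * lam : ℝ)) • Rm (kmat k fun l : Fin r => z l ω) (r * lam) = 1 - Hm (kmat k fun l : Fin r => z l ω) (r * lam) := by
      rw [Hm]; abel
    rw [h4, Matrix.sub_mulVec, Matrix.one_mulVec]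
    simp only [Pi.sub_apply, col_apply]
    congr 1
    simp only [Matrix.mulVec, dotProduct]
    refine Finset.sum_congr rfl fun l _ => ?_
    congr 1
    have := congrFun (congrFun (hS.H_symm (c := r * lam)) l) ⟨i, hir⟩
    simpa using this.symm
  · have hs : Function.Injective (fun o : Option (Fin r) => o.elim i fun l => (l : ℕ)) := by
      intro a b hab
      cases a with
      | none => cases b with
        | none => rfl
        | some b => simp at hab; omega
      | some a => cases b with
        | none => simp at hab; omega
        | some b => simp at hab; rw [Fin.ext hab]
    have h1 := integral_inj hz hi hl hs ((h.BM_cRv (ι := Option (Fin r)) (BM_ev hb.bm) none).pow 2).measurable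
    have h2 := bias_idx h hb (ι := Option (Fin r)) (by simp) none
    rw [← h1] at h2
    refine le_trans ?_ (mul_le_mul_of_nonneg_left h2 (sq_nonneg (1 + κ)))
    rw [← integral_const_mul]
    have hmz : Measurable fun ω => fun i => z i ω := measurable_pi_lambda _ hz
    have hu : ∀ j, BM fun ω => u (z j ω) := fun j => hb.bm.comp (hz j)
    refine integral_mono (((hu i).sub (BM.sum fun l _ => ((BM_Wr h i l).comp hmz).mul (hu l))).pow 2 |>.integrable _)
      ((((h.BM_cRv (ι := Option (Fin r)) (BM_ev hb.bm) none).pow 2).comp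
        (measurable_pi_lambda _ fun o : Option (Fin r) => hz (o.elim i fun l => (l : ℕ)))).const_mul _ |>.integrable _) fun ω => ?_
    have := wvec_res h.pd h.symm h.c1 h.diag (fun o : Option (Fin r) => z (o.elim i fun l => (l : ℕ)) ω) u
    simp only [Matrix.smul_mulVec] 
    exact this

end ex
end CIProof
end

section

namespace CIProof
set_option linter.unusedSectionVars false
section ex
variable {D : Type} [MeasurableSpace D] {P : Measure D} [IsProbabilityMeasure P]
variable {k : D → D → ℝ} {r : ℕ} {lam κ Cl Cb : ℝ} {u : D → ℝ}
variable {Ω : Type*} [MeasurableSpace Ω] {μ : Measure Ω} [IsProbabilityMeasure μ] {z : ℕ → Ω → D}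

lemma opt_inj1 {i r : ℕ} (hir : r ≤ i) : Function.Injective (fun o : Option (Fin r) => o.elim i fun l => (l : ℕ)) := by
  intro a b hab
  cases a with
  | none => cases b with
    | none => rfl
    | some b => simp at hab; omega
  | some a => cases b with
    | none => simp at hab; omega
    | some b => simp at hab; rw [Fin.ext hab]

lemma opt_inj2 {i j r : ℕ} (hir : r ≤ i) (hjr : r ≤ j) (hij : i ≠ j) :
    Function.Injective (fun o : Option (Option (Fin r)) => o.elim i fun o => o.elim j fun l => (l : ℕ)) := by
  intro a b hab
  rcases a with _ | _ | a <;> rcases b with _ | _ | b <;> simp at hab ⊢ <;> first | omega | exact Fin.ext hab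

lemma KF.BM_W (h : KF P k r lam κ Cl) (hz : ∀ i, Measurable (z i)) (i : ℕ) (l : Fin r) :
    BM fun ω => Wr k r lam (fun i => z i ω) i l :=
  (BM_Wr h i l).comp (measurable_pi_lambda _ hz)

lemma Wr_in (h : KF P k r lam κ Cl) (zs : ℕ → D) (i : Fin r) (l : Fin r) :
    Wr k r lam zs i l = Hm (kmat k (fun l : Fin r => zs l)) (r * lam) l i := by
  have := congrFun (wvec_self h.pd h.symm h.c0 (fun l : Fin r => zs l) i) l
  rw [col_apply] at this
  exact this

lemma Wr_dot_in (h : KF P k r lam κ Cl) (zs : ℕ → D) (i : Fin r) (v : Fin r → ℝ) :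
    ∑ l, Wr k r lam zs i l * v l = (Hm (kmat k (fun l : Fin r => zs l)) (r * lam)).mulVec v i := by
  have hS := spd_kmat h.pd h.symm (fun l : Fin r => zs l)
  simp only [Matrix.mulVec, dotProduct]
  refine Finset.sum_congr rfl fun l _ => ?_
  rw [Wr_in h]
  have := congrFun (congrFun (hS.H_symm (c := r * lam)) l) i
  rw [← this, Matrix.transpose_apply]

/-- G2 -/
lemma G2 (h : KF P k r lam κ Cl) (hz : ∀ i, Measurable (z i)) (hi : iIndepFun z μ)
    (hl : ∀ i, μ.map (z i) = P) (i : ℕ) :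
    ∫ ω, ∑ l, Wr k r lam (fun i => z i ω) i l ^ 2 ∂μ ≤ (1 + κ) ^ 2 * (Cl * lam) := by
  have hC : 0 ≤ Cl * lam := mul_nonneg h.Cl0 h.lam0.le
  have hκ := h.κ0
  have hBM : BM fun ω => ∑ l, Wr k r lam (fun i => z i ω) i l ^ 2 := BM.sum fun l _ => (h.BM_W hz i l).pow 2
  by_cases hir : i < r
  · have hs : Function.Injective (fun l : Fin r => (l : ℕ)) := Fin.val_injective
    have hb := h.BM_H (ι := Fin r) ⟨i, hir⟩ ⟨i, hir⟩
    have h1 := integral_inj hz hi hl hs hb.measurable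
    have h2 := h.lev (Fin r) (by simp) ⟨i, hir⟩
    rw [← h1] at h2
    refine le_trans ?_ (h2.trans (le_mul_of_one_le_left hC (by nlinarith)))
    refine integral_mono (hBM.integrable _)
      ((hb.comp (measurable_pi_lambda _ fun l : Fin r => hz l)).integrable _) fun ω => ?_
    refine le_trans (le_of_eq ?_) ((spd_kmat h.pd h.symm (fun l : Fin r => z l ω)).H_col h.c0 ⟨i, hir⟩)
    refine Finset.sum_congr rfl fun l _ => ?_
    rw [← Wr_in h (fun i => z i ω) ⟨i, hir⟩ l]
  · have hb := h.BM_H (ι := Option (Fin r)) none none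
    have hs := opt_inj1 (not_lt.mp hir)
    have h1 := integral_inj hz hi hl hs hb.measurable
    have h2 := h.lev (Option (Fin r)) (by simp) none
    rw [← h1] at h2
    refine le_trans ?_ (mul_le_mul_of_nonneg_left h2 (sq_nonneg (1 + κ)))
    rw [← integral_const_mul]
    refine integral_mono (hBM.integrable _)
      (((hb.comp (measurable_pi_lambda _ fun o : Option (Fin r) => hz (o.elim i fun l => (l : ℕ)))).const_mul _).integrable _)
      fun ω => ?_
    exact wvec_norm h.pd h.symm h.c1 h.diag (fun o : Option (Fin r) => z (o.elim i fun l => (l : ℕ)) ω)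

/-- contraction: in-sample rows against any vector -/
lemma in_contr (h : KF P k r lam κ Cl) (zs : ℕ → D) (v : Fin r → ℝ) :
    ∑ i : Fin r, (∑ l, Wr k r lam zs i l * v l) ^ 2 ≤ ∑ l, v l ^ 2 := by
  have hS := spd_kmat h.pd h.symm (fun l : Fin r => zs l)
  simp_rw [Wr_dot_in h, ← dot_self]
  exact hS.H_contr h.c0 v

lemma G3_off (h : KF P k r lam κ Cl) (hz : ∀ i, Measurable (z i)) (hi : iIndepFun z μ)
    (hl : ∀ i, μ.map (z i) = P) {i j : ℕ} (hir : r ≤ i) (hjr : r ≤ j) (hij : i ≠ j) :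
    ∫ ω, (∑ l, Wr k r lam (fun i => z i ω) i l * Wr k r lam (fun i => z i ω) j l) ^ 2 ∂μ ≤
      72 * (1 + κ) ^ 8 * (2 * Cl * lam / r) := by
  have hκ := h.κ0
  have hb := ((h.BM_H (ι := Option (Option (Fin r))) none (some none)).pow 2).add
    ((h.BM_H2 (ι := Option (Option (Fin r))) none (some none)).pow 2)
  have hs := opt_inj2 hir hjr hij
  have h1 := integral_inj hz hi hl hs hb.measurable
  have h2 := H_off h (ι := Option (Option (Fin r))) (by simp) (a := some none) (b := none) (by simp)
  rw [← h1] at h2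
  refine le_trans ?_ (mul_le_mul_of_nonneg_left h2 (by positivity : (0 : ℝ) ≤ 72 * (1 + κ) ^ 8))
  rw [← integral_const_mul]
  refine integral_mono (((BM.sum fun l _ => (h.BM_W hz i l).mul (h.BM_W hz j l)).pow 2).integrable _)
    (((hb.comp (measurable_pi_lambda _ fun o : Option (Option (Fin r)) =>
      hz (o.elim i fun o => o.elim j fun l => (l : ℕ)))).const_mul _).integrable _)
    fun ω => ?_
  exact wvec_two h.pd h.symm h.c1 h.diag (fun o : Option (Option (Fin r)) =>
    z (o.elim i fun o => o.elim j fun l => (l : ℕ)) ω)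

/-- pointwise decomposition of the Gram sum -/
lemma G3_pt (h : KF P k r lam κ Cl) (zs : ℕ → D) {n : ℕ} (hrn : r ≤ n) :
    ∑ i ∈ Finset.range n, ∑ j ∈ Finset.range n, (∑ l, Wr k r lam zs i l * Wr k r lam zs j l) ^ 2 ≤
      (2 + (1 + κ) ^ 2) * ∑ i ∈ Finset.range n, ∑ l, Wr k r lam zs i l ^ 2 +
      ∑ i ∈ Finset.Ico r n, ∑ j ∈ (Finset.Ico r n).erase i, (∑ l, Wr k r lam zs i l * Wr k r lam zs j l) ^ 2 := by
  set G : ℕ → ℕ → ℝ := fun i j => (∑ l, Wr k r lam zs i l * Wr k r lam zs j l) ^ 2 with hG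
  set w : ℕ → ℝ := fun i => ∑ l, Wr k r lam zs i l ^ 2 with hw
  have hw0 : ∀ i, 0 ≤ w i := fun i => Finset.sum_nonneg fun _ _ => sq_nonneg _
  have hGs : ∀ i j, G i j = G j i := fun i j => by
    simp only [hG]; congr 1; exact Finset.sum_congr rfl fun l _ => mul_comm _ _
  have hin : ∀ j, ∑ i ∈ Finset.range r, G i j ≤ w j := by
    intro j
    rw [Finset.sum_range (fun i => G i j)]
    exact in_contr h zs (Wr k r lam zs j)
  have hsplit : ∀ f : ℕ → ℝ, ∑ i ∈ Finset.range n, f i = ∑ i ∈ Finset.range r, f i + ∑ i ∈ Finset.Ico r n, f i :=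
    fun f => (Finset.sum_range_add_sum_Ico f hrn).symm
  have hd : ∀ i, G i i ≤ (1 + κ) ^ 2 * w i := by
    intro i
    have h1 : G i i = w i * w i := by
      simp only [hG, hw]; rw [← sq]; congr 1; exact Finset.sum_congr rfl fun l _ => by ring
    rw [h1]
    exact mul_le_mul_of_nonneg_right (Wr_norm h zs i) (hw0 i)
  have e1 : ∑ i ∈ Finset.range n, ∑ j ∈ Finset.range n, G i j =
      ∑ j ∈ Finset.range n, ∑ i ∈ Finset.range r, G i j + (∑ i ∈ Finset.Ico r n, ∑ j ∈ Finset.range r, G j i +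
        ∑ i ∈ Finset.Ico r n, ∑ j ∈ Finset.Ico r n, G i j) := by
    rw [hsplit (fun i => ∑ j ∈ Finset.range n, G i j), Finset.sum_comm]
    congr 1
    rw [← Finset.sum_add_distrib]
    refine Finset.sum_congr rfl fun i _ => ?_
    rw [hsplit]
    congr 1
    exact Finset.sum_congr rfl fun j _ => hGs i j
  have e2 : ∑ i ∈ Finset.Ico r n, ∑ j ∈ Finset.Ico r n, G i j ≤ ∑ i ∈ Finset.Ico r n, (1 + κ) ^ 2 * w i +
      ∑ i ∈ Finset.Ico r n, ∑ j ∈ (Finset.Ico r n).erase i, G i j := by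
    rw [← Finset.sum_add_distrib]
    refine Finset.sum_le_sum fun i hi => ?_
    rw [← Finset.add_sum_erase _ _ hi]
    linarith [hd i]
  have e3 : ∑ j ∈ Finset.range n, ∑ i ∈ Finset.range r, G i j ≤ ∑ j ∈ Finset.range n, w j :=
    Finset.sum_le_sum fun j _ => hin j
  have e4 : ∑ i ∈ Finset.Ico r n, ∑ j ∈ Finset.range r, G j i ≤ ∑ i ∈ Finset.Ico r n, w i :=
    Finset.sum_le_sum fun j _ => hin j
  have e5 : ∑ i ∈ Finset.Ico r n, w i ≤ ∑ j ∈ Finset.range n, w j := by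
    rw [hsplit w]
    linarith [Finset.sum_nonneg (s := Finset.range r) fun i _ => hw0 i]
  rw [← Finset.mul_sum] at e2
  change ∑ i ∈ Finset.range n, ∑ j ∈ Finset.range n, G i j ≤ (2 + (1 + κ) ^ 2) * ∑ i ∈ Finset.range n, w i +
    ∑ i ∈ Finset.Ico r n, ∑ j ∈ (Finset.Ico r n).erase i, G i j
  rw [e1]
  have e6 : (1 + κ) ^ 2 * ∑ i ∈ Finset.Ico r n, w i ≤ (1 + κ) ^ 2 * ∑ j ∈ Finset.range n, w j :=
    mul_le_mul_of_nonneg_left e5 (sq_nonneg _)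
  linarith

/-- G3 -/
lemma G3 (h : KF P k r lam κ Cl) (hz : ∀ i, Measurable (z i)) (hi : iIndepFun z μ)
    (hl : ∀ i, μ.map (z i) = P) {n : ℕ} (hrn : r ≤ n) :
    ∫ ω, ∑ i ∈ Finset.range n, ∑ j ∈ Finset.range n,
      (∑ l, Wr k r lam (fun i => z i ω) i l * Wr k r lam (fun i => z i ω) j l) ^ 2 ∂μ ≤
      (2 + (1 + κ) ^ 2) * (n * ((1 + κ) ^ 2 * (Cl * lam))) + n ^ 2 * (72 * (1 + κ) ^ 8 * (2 * Cl * lam / r)) := by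
  have hbG : ∀ i j, BM fun ω => (∑ l, Wr k r lam (fun i => z i ω) i l * Wr k r lam (fun i => z i ω) j l) ^ 2 :=
    fun i j => (BM.sum fun l _ => (h.BM_W hz i l).mul (h.BM_W hz j l)).pow 2
  have hbw : ∀ i, BM fun ω => ∑ l, Wr k r lam (fun i => z i ω) i l ^ 2 := fun i => BM.sum fun l _ => (h.BM_W hz i l).pow 2
  have h1 := integral_mono (μ := μ) ((BM.sum fun i _ => BM.sum fun j _ => hbG i j).integrable _)
    ((((BM.sum fun i _ => hbw i).const_mul (2 + (1 + κ) ^ 2)).add (BM.sum fun i _ => BM.sum fun j _ => hbG i j)).integrable _)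
    fun ω => G3_pt h (fun i => z i ω) hrn
  refine h1.trans ?_
  rw [integral_add (((BM.sum fun i _ => hbw i).const_mul (2 + (1 + κ) ^ 2)).integrable _)
    ((BM.sum fun i _ => BM.sum fun j _ => hbG i j).integrable _), integral_const_mul,
    integral_finsetSum _ fun i _ => (hbw i).integrable _,
    integral_finsetSum _ fun i _ => (BM.sum fun j _ => hbG i j).integrable _]
  refine add_le_add (mul_le_mul_of_nonneg_left ?_ (by positivity)) ?_
  · calc _ ≤ ∑ i ∈ Finset.range n, (1 + κ) ^ 2 * (Cl * lam) := Finset.sum_le_sum fun i _ => G2 h hz hi hl i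
      _ = _ := by simp
  · have hC : 0 ≤ 72 * (1 + κ) ^ 8 * (2 * Cl * lam / r) := by
      have := h.Cl0; have := h.lam0; have := h.κ0
      positivity
    have hcard : ((Finset.Ico r n).card : ℝ) ≤ n := by
      rw [Nat.card_Ico]; exact_mod_cast Nat.sub_le _ _
    calc _ ≤ ∑ i ∈ Finset.Ico r n, ∑ j ∈ (Finset.Ico r n).erase i, 72 * (1 + κ) ^ 8 * (2 * Cl * lam / r) := by
          refine Finset.sum_le_sum fun i hi' => ?_
          rw [integral_finsetSum _ fun j _ => (hbG i j).integrable _]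
          refine Finset.sum_le_sum fun j hj => ?_
          have hj' := Finset.mem_erase.mp hj
          exact G3_off h hz hi hl (Finset.mem_Ico.mp hi').1 (Finset.mem_Ico.mp hj'.2).1 hj'.1.symm
      _ ≤ ∑ i ∈ Finset.Ico r n, n * (72 * (1 + κ) ^ 8 * (2 * Cl * lam / r)) := by
          refine Finset.sum_le_sum fun i hi' => ?_
          rw [Finset.sum_const, nsmul_eq_mul]
          refine mul_le_mul_of_nonneg_right (le_trans ?_ hcard) hC
          exact_mod_cast Finset.card_le_card (Finset.erase_subset _ _)
      _ ≤ _ := by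
          rw [Finset.sum_const, nsmul_eq_mul, sq, mul_assoc (n : ℝ) n]
          exact mul_le_mul_of_nonneg_right hcard (mul_nonneg (Nat.cast_nonneg n) hC)

end ex
end CIProof
end

section

namespace CIProof
set_option linter.unusedSectionVars false
section noise
variable {A : Type} [MeasurableSpace A] {Pw : Measure A} [IsProbabilityMeasure Pw]
variable {Ω : Type*} [MeasurableSpace Ω] {μ : Measure Ω} [IsProbabilityMeasure μ] {w : ℕ → Ω → A}

lemma indep_update (hw : ∀ i, Measurable (w i)) (hi : iIndepFun w μ) (a : ℕ) (c : A) :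
    IndepFun (w a) (fun ω => Function.update (fun i => w i ω) a c) μ := by
  have h := indep_iSup_of_disjoint (m := fun i => MeasurableSpace.comap (w i) inferInstance)
    (fun i => (hw i).comap_le) hi (S := {a}) (T := {a}ᶜ) (Set.disjoint_compl_right_iff_subset.mpr le_rfl)
  rw [IndepFun_iff_Indep]
  refine indep_of_indep_of_le_right (indep_of_indep_of_le_left h ?_) ?_
  · simp
  · rw [← measurable_iff_comap_le]
    refine @measurable_pi_lambda _ _ _ (⨆ i ∈ ({a}ᶜ : Set ℕ), MeasurableSpace.comap (w i) inferInstance) _ _ fun i => ?_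
    by_cases hia : i = a
    · subst hia
      simp only [Function.update_self]
      exact @measurable_const _ _ _ (⨆ q ∈ ({i}ᶜ : Set ℕ), MeasurableSpace.comap (w q) inferInstance) c
    · simp only [Function.update_of_ne hia]
      rw [measurable_iff_comap_le]
      exact le_iSup₂_of_le i hia le_rfl

/-- noise factor integrates to zero against everything not depending on the erased coordinate -/
lemma zero_int (hw : ∀ i, Measurable (w i)) (hi : iIndepFun w μ) (hl : ∀ i, μ.map (w i) = Pw)
    {f : A → ℝ} (hf : BM f) {η : A → A}
    (h0 : ∀ ψ : A → ℝ, BM ψ → ∫ v, f v * ψ (η v) ∂Pw = 0)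
    (a : ℕ) {Φ : (ℕ → A) → ℝ} (hΦ : BM Φ) (hinv : ∀ v, Φ (Function.update v a (η (v a))) = Φ v) :
    ∫ ω, f (w a ω) * Φ (fun i => w i ω) ∂μ = 0 := by
  have hne : Nonempty A := ProbabilityMeasure.nonempty ⟨Pw, inferInstance⟩
  obtain ⟨c⟩ := hne
  have hind := indep_update hw hi a c
  have hmU : Measurable fun ω => Function.update (fun i => w i ω) a c := by
    refine measurable_pi_lambda _ fun i => ?_
    by_cases hia : i = a
    · subst hia; simp
    · simp only [Function.update_of_ne hia]; exact hw i
  have hup : Measurable fun q : A × (ℕ → A) => Function.update q.2 a q.1 := by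
    refine measurable_pi_lambda _ fun i => ?_
    by_cases hia : i = a
    · subst hia; simp only [Function.update_self]; exact measurable_fst
    · simp only [Function.update_of_ne hia]; exact (measurable_pi_apply i).comp measurable_snd
  have hF : BM fun q : A × (ℕ → A) => f q.1 * Φ (Function.update q.2 a q.1) :=
    (hf.comp measurable_fst).mul (hΦ.comp hup)
  have h1 : ∫ ω, f (w a ω) * Φ (fun i => w i ω) ∂μ =
      ∫ ω, (fun q : A × (ℕ → A) => f q.1 * Φ (Function.update q.2 a q.1)) (w a ω, Function.update (fun i => w i ω) a c) ∂μ := by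
    congr 1; ext ω; simp
  rw [h1, ← integral_map (φ := fun ω => (w a ω, Function.update (fun i => w i ω) a c))
    ((hw a).prodMk hmU).aemeasurable hF.1.aestronglyMeasurable,
    (indepFun_iff_map_prod_eq_prod_map_map (hw a).aemeasurable hmU.aemeasurable).1 hind, hl]
  have : IsProbabilityMeasure (μ.map fun ω => Function.update (fun i => w i ω) a c) :=
    Measure.isProbabilityMeasure_map hmU.aemeasurable
  rw [integral_prod_symm _ (hF.integrable _)]
  refine integral_eq_zero_of_ae (Eventually.of_forall fun v => ?_)
  have h2 := h0 (fun x => Φ (Function.update v a x)) (hΦ.comp (hup.comp (measurable_id.prodMk measurable_const)))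
  simp only [Pi.zero_apply]
  rw [← h2]
  congr 1; ext x
  have := hinv (Function.update v a x)
  simp only [Function.update_self, Function.update_idem] at this
  rw [this]

variable {D : Type} [MeasurableSpace D]

/-- noise facts -/
structure NF (Pw : Measure A) (f1 f2 : A → ℝ) (η1 η2 : A → A) (ζ : A → D) (B : ℝ) : Prop where
  b1 : BM f1
  b2 : BM f2
  B1 : ∀ v, f1 v ^ 2 ≤ B
  B2 : ∀ v, f2 v ^ 2 ≤ B
  m1 : Measurable η1
  m2 : Measurable η2
  mζ : Measurable ζ
  i1 : ∀ v, f1 (η2 v) = f1 v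
  i2 : ∀ v, f2 (η1 v) = f2 v
  z1 : ∀ v, ζ (η1 v) = ζ v
  z2 : ∀ v, ζ (η2 v) = ζ v
  s1 : ∀ ψ : A → ℝ, BM ψ → ∫ v, f1 v * ψ (η1 v) ∂Pw = 0
  s2 : ∀ ψ : A → ℝ, BM ψ → ∫ v, f2 v * ψ (η2 v) ∂Pw = 0

variable {f1 f2 : A → ℝ} {η1 η2 : A → A} {ζ : A → D} {B : ℝ}

lemma NF.swap (h : NF Pw f1 f2 η1 η2 ζ B) : NF Pw f2 f1 η2 η1 ζ B :=
  ⟨h.b2, h.b1, h.B2, h.B1, h.m2, h.m1, h.mζ, h.i2, h.i1, h.z2, h.z1, h.s2, h.s1⟩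

lemma NF.B0 (h : NF Pw f1 f2 η1 η2 ζ B) : 0 ≤ B := by
  have hne : Nonempty A := ProbabilityMeasure.nonempty ⟨Pw, inferInstance⟩
  obtain ⟨c⟩ := hne
  exact (sq_nonneg _).trans (h.B1 c)

lemma ev_inv {E : Type*} {g : A → E} {η : A → A} (h : ∀ v, g (η v) = g v) (v : ℕ → A) (a i : ℕ) :
    g (Function.update v a (η (v a)) i) = g (v i) := by
  by_cases hia : i = a
  · subst hia; simp [h]
  · simp [Function.update_of_ne hia]

lemma BM_at {f : A → ℝ} (hf : BM f) (i : ℕ) : BM fun v : ℕ → A => f (v i) := hf.comp (measurable_pi_apply i)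

lemma NF.BMz (h : NF Pw f1 f2 η1 η2 ζ B) {m : (ℕ → D) → ℝ} (hm : BM m) : BM fun v : ℕ → A => m fun i => ζ (v i) :=
  hm.comp (measurable_pi_lambda _ fun i => h.mζ.comp (measurable_pi_apply i))

/-- Lemma Q -/
lemma NF.Q (h : NF Pw f1 f2 η1 η2 ζ B) (hw : ∀ i, Measurable (w i)) (hi : iIndepFun w μ) (hl : ∀ i, μ.map (w i) = Pw)
    {I K : Type*} [Fintype I] [Fintype K] [DecidableEq I] [DecidableEq K] {s : I → ℕ} (hs : Function.Injective s) {s' : K → ℕ} (hs' : Function.Injective s')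
    {m : I → K → (ℕ → D) → ℝ} (hm : ∀ a b, BM (m a b)) :
    ∫ ω, (∑ a, ∑ b, f1 (w (s a) ω) * m a b (fun i => ζ (w i ω)) * f2 (w (s' b) ω)) ^ 2 ∂μ ≤
      B ^ 2 * ∫ ω, ∑ a, ∑ b, m a b (fun i => ζ (w i ω)) ^ 2 ∂μ := by
  have hmw : Measurable fun ω i => w i ω := measurable_pi_lambda _ hw
  have hM : ∀ a b, BM fun v : ℕ → A => m a b fun i => ζ (v i) := fun a b => h.BMz (hm a b)
  have hF1 : ∀ i, BM fun v : ℕ → A => f1 (v i) := BM_at h.b1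
  have hF2 : ∀ i, BM fun v : ℕ → A => f2 (v i) := BM_at h.b2
  have hT : ∀ a b a' b', BM fun ω => (f1 (w (s a) ω) * m a b (fun i => ζ (w i ω)) * f2 (w (s' b) ω)) *
      (f1 (w (s a') ω) * m a' b' (fun i => ζ (w i ω)) * f2 (w (s' b') ω)) := fun a b a' b' =>
    ((((hF1 (s a)).mul (hM a b)).mul (hF2 (s' b))).mul (((hF1 (s a')).mul (hM a' b')).mul (hF2 (s' b')))).comp hmw
  have hz : ∀ a b a' b', (a, b) ≠ (a', b') → ∫ ω, (f1 (w (s a) ω) * m a b (fun i => ζ (w i ω)) * f2 (w (s' b) ω)) *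
      (f1 (w (s a') ω) * m a' b' (fun i => ζ (w i ω)) * f2 (w (s' b') ω)) ∂μ = 0 := by
    intro a b a' b' hne
    by_cases haa : a = a'
    · have hbb : s' b' ≠ s' b := fun hb => hne (by rw [haa, hs' hb])
      have := zero_int hw hi hl h.b2 h.s2 (s' b)
        (Φ := fun v => f1 (v (s a)) * m a b (fun i => ζ (v i)) * (f1 (v (s a')) * m a' b' (fun i => ζ (v i)) * f2 (v (s' b'))))
        (((hF1 _).mul (hM a b)).mul (((hF1 _).mul (hM a' b')).mul (hF2 _))) (fun v => by
          simp only [ev_inv h.i1, ev_inv h.z2, Function.update_of_ne hbb])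
      rw [← this]
      congr 1; ext ω; ring
    · have haa' : s a' ≠ s a := fun ha => haa (hs ha).symm
      have := zero_int hw hi hl h.b1 h.s1 (s a)
        (Φ := fun v => m a b (fun i => ζ (v i)) * f2 (v (s' b)) * (f1 (v (s a')) * m a' b' (fun i => ζ (v i)) * f2 (v (s' b'))))
        (((hM a b).mul (hF2 _)).mul (((hF1 _).mul (hM a' b')).mul (hF2 _))) (fun v => by
          simp only [ev_inv h.i2, ev_inv h.z1, Function.update_of_ne haa'])
      rw [← this]
      congr 1; ext ω; ring
  have hexp : ∀ ω, (∑ a, ∑ b, f1 (w (s a) ω) * m a b (fun i => ζ (w i ω)) * f2 (w (s' b) ω)) ^ 2 =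
      ∑ p : I × K, ∑ p' : I × K, (f1 (w (s p.1) ω) * m p.1 p.2 (fun i => ζ (w i ω)) * f2 (w (s' p.2) ω)) *
      (f1 (w (s p'.1) ω) * m p'.1 p'.2 (fun i => ζ (w i ω)) * f2 (w (s' p'.2) ω)) := by
    intro ω
    rw [← Fintype.sum_prod_type' (f := fun a b => f1 (w (s a) ω) * m a b (fun i => ζ (w i ω)) * f2 (w (s' b) ω)), sq, Finset.sum_mul_sum]
  simp_rw [hexp]
  rw [integral_finsetSum _ fun p _ => (BM.sum fun p' _ => hT p.1 p.2 p'.1 p'.2).integrable _]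
  have h2 : ∀ p : I × K, ∫ ω, ∑ p' : I × K, (f1 (w (s p.1) ω) * m p.1 p.2 (fun i => ζ (w i ω)) * f2 (w (s' p.2) ω)) *
      (f1 (w (s p'.1) ω) * m p'.1 p'.2 (fun i => ζ (w i ω)) * f2 (w (s' p'.2) ω)) ∂μ ≤ B ^ 2 * ∫ ω, m p.1 p.2 (fun i => ζ (w i ω)) ^ 2 ∂μ := by
    intro p
    rw [integral_finsetSum _ fun p' _ => (hT p.1 p.2 p'.1 p'.2).integrable _,
      Finset.sum_eq_single p (fun p' _ hne => hz _ _ _ _ (fun he => hne (by simpa [eq_comm] using he))) (by simp)]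
    rw [← integral_const_mul]
    refine integral_mono ((hT _ _ _ _).integrable _) ((((hM p.1 p.2).comp hmw).pow 2).const_mul _ |>.integrable _) fun ω => ?_
    have e1 := h.B1 (w (s p.1) ω)
    have e2 := h.B2 (w (s' p.2) ω)
    have e3 : f1 (w (s p.1) ω) ^ 2 * f2 (w (s' p.2) ω) ^ 2 ≤ B * B := mul_le_mul e1 e2 (sq_nonneg _) h.B0
    have := mul_le_mul_of_nonneg_right e3 (sq_nonneg (m p.1 p.2 (fun i => ζ (w i ω))))
    simp only
    nlinarith
  refine (Finset.sum_le_sum fun p _ => h2 p).trans (le_of_eq ?_)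
  rw [← Finset.mul_sum]
  congr 1
  rw [integral_finsetSum _ fun a _ => (BM.sum fun b _ => ((hM a b).comp hmw).pow 2).integrable _, Fintype.sum_prod_type]
  refine Finset.sum_congr rfl fun a _ => ?_
  rw [integral_finsetSum _ fun b _ => (((hM a b).comp hmw).pow 2).integrable _]

/-- Lemma V -/
lemma NF.V (h : NF Pw f1 f2 η1 η2 ζ B) (hw : ∀ i, Measurable (w i)) (hi : iIndepFun w μ) (hl : ∀ i, μ.map (w i) = Pw)
    {I : Type*} [Fintype I] [DecidableEq I] {s : I → ℕ} (hs : Function.Injective s)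
    {m : I → (ℕ → D) → ℝ} (hm : ∀ a, BM (m a)) :
    ∫ ω, (∑ a, m a (fun i => ζ (w i ω)) * f1 (w (s a) ω)) ^ 2 ∂μ ≤
      B * ∫ ω, ∑ a, m a (fun i => ζ (w i ω)) ^ 2 ∂μ := by
  have hmw : Measurable fun ω i => w i ω := measurable_pi_lambda _ hw
  have hM : ∀ a, BM fun v : ℕ → A => m a fun i => ζ (v i) := fun a => h.BMz (hm a)
  have hF1 : ∀ i, BM fun v : ℕ → A => f1 (v i) := BM_at h.b1
  have hT : ∀ a a', BM fun ω => (m a (fun i => ζ (w i ω)) * f1 (w (s a) ω)) *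
      (m a' (fun i => ζ (w i ω)) * f1 (w (s a') ω)) := fun a a' =>
    (((hM a).mul (hF1 _)).mul ((hM a').mul (hF1 _))).comp hmw
  have hz : ∀ a a', a ≠ a' → ∫ ω, (m a (fun i => ζ (w i ω)) * f1 (w (s a) ω)) *
      (m a' (fun i => ζ (w i ω)) * f1 (w (s a') ω)) ∂μ = 0 := by
    intro a a' haa
    have haa' : s a' ≠ s a := fun ha => haa (hs ha).symm
    have := zero_int hw hi hl h.b1 h.s1 (s a)
        (Φ := fun v => m a (fun i => ζ (v i)) * (f1 (v (s a')) * m a' (fun i => ζ (v i))))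
        ((hM a).mul ((hF1 _).mul (hM a'))) (fun v => by
          simp only [ev_inv h.z1, Function.update_of_ne haa'])
    rw [← this]
    congr 1; ext ω; ring
  simp_rw [sq (∑ a, _), Finset.sum_mul_sum]
  rw [integral_finsetSum _ fun a _ => (BM.sum fun a' _ => hT a a').integrable _,
    integral_finsetSum _ fun a _ => (((hM a).comp hmw).pow 2).integrable _, Finset.mul_sum]
  refine Finset.sum_le_sum fun a _ => ?_
  rw [integral_finsetSum _ fun a' _ => (hT a a').integrable _,
    Finset.sum_eq_single a (fun p' _ hne => hz _ _ hne.symm) (by simp), ← integral_const_mul]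
  refine integral_mono ((hT _ _).integrable _) ((((hM a).comp hmw).pow 2).const_mul _ |>.integrable _) fun ω => ?_
  have := mul_le_mul_of_nonneg_right (h.B1 (w (s a) ω)) (sq_nonneg (m a (fun i => ζ (w i ω))))
  simp only
  nlinarith

/-- Cauchy-Schwarz -/
lemma cs_int {f g : Ω → ℝ} (hf : BM f) (hg : BM g) {a b : ℝ} (ha : ∫ ω, f ω ^ 2 ∂μ ≤ a) (hb : ∫ ω, g ω ^ 2 ∂μ ≤ b) :
    ∫ ω, |f ω * g ω| ∂μ ≤ √a * √b := by
  have hmem : ∀ {f : Ω → ℝ}, BM f → MemLp f (ENNReal.ofReal 2) μ := fun {f} hf => by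
    obtain ⟨hm, C, hC⟩ := hf
    exact MemLp.of_bound hm.aestronglyMeasurable C (Eventually.of_forall hC)
  have := integral_mul_norm_le_Lp_mul_Lq (μ := μ) (p := 2) (q := 2) (Real.HolderConjugate.two_two) (hmem hf) (hmem hg)
  simp only [abs_mul, Real.norm_eq_abs, Real.rpow_two, sq_abs, ← Real.sqrt_eq_rpow] at this ⊢
  refine this.trans ?_
  exact mul_le_mul (Real.sqrt_le_sqrt ha) (Real.sqrt_le_sqrt hb) (Real.sqrt_nonneg _) (Real.sqrt_nonneg _)

lemma cs_one {f : Ω → ℝ} (hf : BM f) {a : ℝ} (ha : ∫ ω, f ω ^ 2 ∂μ ≤ a) : ∫ ω, |f ω| ∂μ ≤ √a := by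
  have := cs_int (μ := μ) hf (BM.const (1 : ℝ)) ha (b := 1) (by simp)
  simpa using this

end noise
end CIProof
end

section

namespace CIProof
set_option linter.unusedSectionVars false

/-- bias of sample i -/
def bb {D : Type} (k : D → D → ℝ) (r : ℕ) (lam : ℝ) (u : D → ℝ) (i : ℕ) (zs : ℕ → D) : ℝ :=
  u (zs i) - ∑ l, Wr k r lam zs i l * u (zs l)

/-- smoothed noise of sample i -/
def gg {A D : Type} (k : D → D → ℝ) (r : ℕ) (lam : ℝ) (ζ : A → D) (f : A → ℝ) (i : ℕ) (v : ℕ → A) : ℝ :=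
  ∑ l, Wr k r lam (fun i => ζ (v i)) i l * f (v l)

section rem
variable {A : Type} [MeasurableSpace A] {Pw : Measure A} [IsProbabilityMeasure Pw]
variable {Ω : Type*} [MeasurableSpace Ω] {μ : Measure Ω} [IsProbabilityMeasure μ] {w : ℕ → Ω → A}
variable {D : Type} [MeasurableSpace D] {P : Measure D} [IsProbabilityMeasure P]
variable {f1 f2 : A → ℝ} {η1 η2 : A → A} {ζ : A → D} {B : ℝ}
variable {k1 k2 : D → D → ℝ} {r : ℕ} {lam κ Cl Cb : ℝ} {u1 u2 : D → ℝ}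

/-- everything together -/
structure RF (μ : Measure Ω) (w : ℕ → Ω → A) (Pw : Measure A) (P : Measure D) [IsProbabilityMeasure P] (f1 f2 : A → ℝ) (η1 η2 : A → A) (ζ : A → D) (B : ℝ)
    (k1 k2 : D → D → ℝ) (r : ℕ) (lam κ Cl Cb : ℝ) (u1 u2 : D → ℝ) : Prop where
  nf : NF Pw f1 f2 η1 η2 ζ B
  hw : ∀ i, Measurable (w i)
  hi : iIndepFun w μ
  hl : ∀ i, μ.map (w i) = Pw
  hP : Pw.map ζ = P
  K1 : KF P k1 r lam κ Cl
  K2 : KF P k2 r lam κ Cl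
  F1 : BF P k1 r lam u1 Cb
  F2 : BF P k2 r lam u2 Cb

lemma RF.swap (h : RF μ w Pw P f1 f2 η1 η2 ζ B k1 k2 r lam κ Cl Cb u1 u2) :
    RF μ w Pw P f2 f1 η2 η1 ζ B k2 k1 r lam κ Cl Cb u2 u1 :=
  ⟨h.nf.swap, h.hw, h.hi, h.hl, h.hP, h.K2, h.K1, h.F2, h.F1⟩

lemma RF.zm
    (h : RF μ w Pw P f1 f2 η1 η2 ζ B k1 k2 r lam κ Cl Cb u1 u2) (i : ℕ) : Measurable fun ω => ζ (w i ω) := h.nf.mζ.comp (h.hw i)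

lemma RF.zi
    (h : RF μ w Pw P f1 f2 η1 η2 ζ B k1 k2 r lam κ Cl Cb u1 u2) : iIndepFun (fun i ω => ζ (w i ω)) μ := h.hi.comp (fun _ => ζ) fun _ => h.nf.mζ

lemma RF.zl
    (h : RF μ w Pw P f1 f2 η1 η2 ζ B k1 k2 r lam κ Cl Cb u1 u2) (i : ℕ) : μ.map (fun ω => ζ (w i ω)) = P := by
  rw [← h.hP, ← h.hl i, Measure.map_map h.nf.mζ (h.hw i)]; rfl

lemma RF.bbm
    (h : RF μ w Pw P f1 f2 η1 η2 ζ B k1 k2 r lam κ Cl Cb u1 u2) (i : ℕ) : BM (bb k1 r lam u1 i) :=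
  (h.F1.bm.comp (measurable_pi_apply i)).sub
    (BM.sum fun l _ => (BM_Wr h.K1 i l).mul (h.F1.bm.comp (measurable_pi_apply _)))

lemma RF.ggm
    (h : RF μ w Pw P f1 f2 η1 η2 ζ B k1 k2 r lam κ Cl Cb u1 u2) (i : ℕ) : BM (gg k1 r lam ζ f1 i) :=
  BM.sum fun l _ => (h.nf.BMz (BM_Wr h.K1 i l)).mul (BM_at h.nf.b1 _)

lemma RF.mw
    (h : RF μ w Pw P f1 f2 η1 η2 ζ B k1 k2 r lam κ Cl Cb u1 u2) : Measurable fun ω i => w i ω := measurable_pi_lambda _ h.hw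

lemma RF.mz
    (h : RF μ w Pw P f1 f2 η1 η2 ζ B k1 k2 r lam κ Cl Cb u1 u2) : Measurable fun ω i => ζ (w i ω) := measurable_pi_lambda _ h.zm

lemma RF.bbE
    (h : RF μ w Pw P f1 f2 η1 η2 ζ B k1 k2 r lam κ Cl Cb u1 u2) (i : ℕ) : ∫ ω, bb k1 r lam u1 i (fun i => ζ (w i ω)) ^ 2 ∂μ ≤ (1 + κ) ^ 2 * Cb :=
  G1 h.K1 h.F1 h.zm h.zi h.zl i

lemma RF.WE
    (h : RF μ w Pw P f1 f2 η1 η2 ζ B k1 k2 r lam κ Cl Cb u1 u2) (i : ℕ) : ∫ ω, ∑ l, Wr k1 r lam (fun i => ζ (w i ω)) i l ^ 2 ∂μ ≤ (1 + κ) ^ 2 * (Cl * lam) :=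
  G2 h.K1 h.zm h.zi h.zl i

lemma RF.ggE
    (h : RF μ w Pw P f1 f2 η1 η2 ζ B k1 k2 r lam κ Cl Cb u1 u2) (i : ℕ) : ∫ ω, gg k1 r lam ζ f1 i (fun i => w i ω) ^ 2 ∂μ ≤ B * ((1 + κ) ^ 2 * (Cl * lam)) := by
  have := h.nf.V h.hw h.hi h.hl (I := Fin r) (s := fun l => (l : ℕ)) Fin.val_injective
    (m := fun l zs => Wr k1 r lam zs i l) (fun l => BM_Wr h.K1 i l)
  exact this.trans (mul_le_mul_of_nonneg_left (h.WE i) h.nf.B0)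

lemma RF.t1
    (h : RF μ w Pw P f1 f2 η1 η2 ζ B k1 k2 r lam κ Cl Cb u1 u2) (n : ℕ) : ∫ ω, |∑ i : Fin n, bb k1 r lam u1 i (fun i => ζ (w i ω)) * f2 (w i ω)| ∂μ ≤
    √(B * (n * ((1 + κ) ^ 2 * Cb))) := by
  refine cs_one (μ := μ) (BM.sum fun (i : Fin n) _ => ((h.bbm i).comp h.mz).mul (h.nf.b2.comp (h.hw i))) ?_
  refine (h.nf.swap.V h.hw h.hi h.hl (I := Fin n) (s := fun l => (l : ℕ)) Fin.val_injective
    (m := fun i zs => bb k1 r lam u1 i zs) (fun i => h.bbm i)).trans ?_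
  refine mul_le_mul_of_nonneg_left ?_ h.nf.B0
  rw [integral_finsetSum _ fun i _ => (((h.bbm _).comp h.mz).pow 2).integrable μ]
  refine (Finset.sum_le_sum fun (i : Fin n) _ => h.bbE i).trans ?_
  simp

lemma RF.t2
    (h : RF μ w Pw P f1 f2 η1 η2 ζ B k1 k2 r lam κ Cl Cb u1 u2) (n : ℕ) : ∫ ω, |∑ i : Fin n, gg k1 r lam ζ f1 i (fun i => w i ω) * f2 (w i ω)| ∂μ ≤
    √(B ^ 2 * (n * ((1 + κ) ^ 2 * (Cl * lam)))) := by
  refine cs_one (μ := μ) (BM.sum fun (i : Fin n) _ => ((h.ggm i).comp h.mw).mul (h.nf.b2.comp (h.hw i))) ?_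
  have := h.nf.swap.Q h.hw h.hi h.hl (I := Fin n) (K := Fin r) (s := fun l => (l : ℕ)) Fin.val_injective
    (s' := fun l => (l : ℕ)) Fin.val_injective
    (m := fun i l zs => Wr k1 r lam zs i l) (fun i l => BM_Wr h.K1 i l)
  refine le_trans (le_of_eq ?_) (this.trans ?_)
  · congr 1; ext ω
    congr 1
    refine Finset.sum_congr rfl fun i _ => ?_
    rw [gg, Finset.sum_mul]
    exact Finset.sum_congr rfl fun l _ => by ring
  refine mul_le_mul_of_nonneg_left ?_ (sq_nonneg B)
  rw [integral_finsetSum _ fun i _ => (BM.sum fun l _ => ((BM_Wr h.K1 _ l).comp h.mz).pow 2).integrable μ]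
  refine (Finset.sum_le_sum fun (i : Fin n) _ => h.WE i).trans ?_
  simp

lemma RF.t3
    (h : RF μ w Pw P f1 f2 η1 η2 ζ B k1 k2 r lam κ Cl Cb u1 u2) (n : ℕ) : ∫ ω, |∑ i : Fin n, bb k1 r lam u1 i (fun i => ζ (w i ω)) * bb k2 r lam u2 i (fun i => ζ (w i ω))| ∂μ ≤
    n * (√((1 + κ) ^ 2 * Cb) * √((1 + κ) ^ 2 * Cb)) := by
  have hb : ∀ i, BM fun ω => bb k1 r lam u1 i (fun i => ζ (w i ω)) * bb k2 r lam u2 i (fun i => ζ (w i ω)) :=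
    fun i => ((h.bbm i).comp h.mz).mul ((h.swap.bbm i).comp h.mz)
  refine (integral_mono ((BM.sum fun (i : Fin n) _ => hb i).norm.integrable μ) ((BM.sum fun (i : Fin n) _ => (hb i).norm).integrable μ)
    fun ω => Finset.abs_sum_le_sum_abs _ _).trans ?_
  rw [integral_finsetSum _ fun i _ => (hb _).norm.integrable μ]
  refine (Finset.sum_le_sum fun (i : Fin n) _ => cs_int ((h.bbm i).comp h.mz) ((h.swap.bbm i).comp h.mz) (h.bbE i) (h.swap.bbE i)).trans ?_
  simp

lemma RF.t4
    (h : RF μ w Pw P f1 f2 η1 η2 ζ B k1 k2 r lam κ Cl Cb u1 u2) (n : ℕ) : ∫ ω, |∑ i : Fin n, bb k1 r lam u1 i (fun i => ζ (w i ω)) * gg k2 r lam ζ f2 i (fun i => w i ω)| ∂μ ≤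
    n * (√((1 + κ) ^ 2 * Cb) * √(B * ((1 + κ) ^ 2 * (Cl * lam)))) := by
  have hb : ∀ i, BM fun ω => bb k1 r lam u1 i (fun i => ζ (w i ω)) * gg k2 r lam ζ f2 i (fun i => w i ω) :=
    fun i => ((h.bbm i).comp h.mz).mul ((h.swap.ggm i).comp h.mw)
  refine (integral_mono ((BM.sum fun (i : Fin n) _ => hb i).norm.integrable μ) ((BM.sum fun (i : Fin n) _ => (hb i).norm).integrable μ)
    fun ω => Finset.abs_sum_le_sum_abs _ _).trans ?_
  rw [integral_finsetSum _ fun i _ => (hb _).norm.integrable μ]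
  refine (Finset.sum_le_sum fun (i : Fin n) _ => cs_int ((h.bbm i).comp h.mz) ((h.swap.ggm i).comp h.mw) (h.bbE i) (h.swap.ggE i)).trans ?_
  simp

lemma gram_sum {I K : Type*} [Fintype I] [Fintype K] (U V : I → K → ℝ) :
    ∑ a, ∑ b, (∑ i, U i a * V i b) ^ 2 ≤
      (∑ i, ∑ j, (∑ a, U i a * U j a) ^ 2 + ∑ i, ∑ j, (∑ a, V i a * V j a) ^ 2) / 2 := by
  have e : ∑ a, ∑ b, (∑ i, U i a * V i b) ^ 2 = ∑ i, ∑ j, (∑ a, U i a * U j a) * (∑ b, V i b * V j b) := by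
    calc _ = ∑ a, ∑ b, ∑ i, ∑ j, (U i a * V i b) * (U j a * V j b) := by simp_rw [sq, Finset.sum_mul_sum]
      _ = ∑ a, ∑ i, ∑ j, ∑ b, (U i a * V i b) * (U j a * V j b) := by
          refine Finset.sum_congr rfl fun a _ => ?_
          rw [Finset.sum_comm]
          exact Finset.sum_congr rfl fun i _ => Finset.sum_comm
      _ = ∑ i, ∑ j, ∑ a, ∑ b, (U i a * V i b) * (U j a * V j b) := by
          rw [Finset.sum_comm]
          exact Finset.sum_congr rfl fun i _ => Finset.sum_comm
      _ = _ := by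
          refine Finset.sum_congr rfl fun i _ => Finset.sum_congr rfl fun j _ => ?_
          rw [Finset.sum_mul_sum]
          exact Finset.sum_congr rfl fun a _ => Finset.sum_congr rfl fun b _ => by ring
  rw [e, ← Finset.sum_add_distrib, Finset.sum_div]
  refine Finset.sum_le_sum fun i _ => ?_
  rw [← Finset.sum_add_distrib, Finset.sum_div]
  refine Finset.sum_le_sum fun j _ => ?_
  nlinarith [sq_nonneg ((∑ a, U i a * U j a) - (∑ b, V i b * V j b))]

lemma RF.t5
    (h : RF μ w Pw P f1 f2 η1 η2 ζ B k1 k2 r lam κ Cl Cb u1 u2) {n : ℕ} (hrn : r ≤ n) : ∫ ω, |∑ i : Fin n, gg k1 r lam ζ f1 i (fun i => w i ω) * gg k2 r lam ζ f2 i (fun i => w i ω)| ∂μ ≤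
    √(B ^ 2 * ((2 + (1 + κ) ^ 2) * (n * ((1 + κ) ^ 2 * (Cl * lam))) + n ^ 2 * (72 * (1 + κ) ^ 8 * (2 * Cl * lam / r)))) := by
  refine cs_one (μ := μ) (BM.sum fun (i : Fin n) _ => ((h.ggm i).comp h.mw).mul ((h.swap.ggm i).comp h.mw)) ?_
  have := h.nf.Q h.hw h.hi h.hl (I := Fin r) (K := Fin r) (s := fun l => (l : ℕ)) Fin.val_injective
    (s' := fun l => (l : ℕ)) Fin.val_injective
    (m := fun a b zs => ∑ i : Fin n, Wr k1 r lam zs i a * Wr k2 r lam zs i b)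
    (fun a b => BM.sum fun i _ => (BM_Wr h.K1 i a).mul (BM_Wr h.K2 i b))
  refine le_trans (le_of_eq ?_) (this.trans ?_)
  · congr 1; ext ω
    congr 1
    simp only [gg, Finset.sum_mul_sum]
    rw [Finset.sum_comm]
    refine Finset.sum_congr rfl fun a _ => ?_
    rw [Finset.sum_comm]
    refine Finset.sum_congr rfl fun l _ => ?_
    rw [Finset.mul_sum, Finset.sum_mul]
    exact Finset.sum_congr rfl fun i _ => by ring
  refine mul_le_mul_of_nonneg_left ?_ (sq_nonneg B)
  have b1 : BM fun ω => ∑ i : Fin n, ∑ j : Fin n, (∑ a, Wr k1 r lam (fun i => ζ (w i ω)) i a * Wr k1 r lam (fun i => ζ (w i ω)) j a) ^ 2 :=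
    BM.sum fun i _ => BM.sum fun j _ => (BM.sum fun a _ => ((BM_Wr h.K1 i a).comp h.mz).mul ((BM_Wr h.K1 j a).comp h.mz)).pow 2
  have b2 : BM fun ω => ∑ i : Fin n, ∑ j : Fin n, (∑ a, Wr k2 r lam (fun i => ζ (w i ω)) i a * Wr k2 r lam (fun i => ζ (w i ω)) j a) ^ 2 :=
    BM.sum fun i _ => BM.sum fun j _ => (BM.sum fun a _ => ((BM_Wr h.K2 i a).comp h.mz).mul ((BM_Wr h.K2 j a).comp h.mz)).pow 2
  have b3 : BM fun ω => ∑ a, ∑ b, (∑ i : Fin n, Wr k1 r lam (fun i => ζ (w i ω)) i a * Wr k2 r lam (fun i => ζ (w i ω)) i b) ^ 2 :=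
    BM.sum fun a _ => BM.sum fun b _ => (BM.sum fun (i : Fin n) _ => ((BM_Wr h.K1 i a).comp h.mz).mul ((BM_Wr h.K2 i b).comp h.mz)).pow 2
  have g1 := G3 h.K1 h.zm h.zi h.zl hrn
  have g2 := G3 h.K2 h.zm h.zi h.zl hrn
  simp only [Finset.sum_range] at g1 g2
  refine (integral_mono (b3.integrable μ) (((b1.add b2).integrable μ).div_const 2) fun ω =>
    gram_sum (fun (i : Fin n) a => Wr k1 r lam (fun i => ζ (w i ω)) i a) (fun (i : Fin n) a => Wr k2 r lam (fun i => ζ (w i ω)) i a)).trans ?_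
  rw [integral_div, integral_add (b1.integrable μ) (b2.integrable μ)]
  linarith

/-- the remainder -/
lemma RF.total
    (h : RF μ w Pw P f1 f2 η1 η2 ζ B k1 k2 r lam κ Cl Cb u1 u2) {n : ℕ} (hrn : r ≤ n) :
    ∫ ω, |∑ i ∈ Finset.range n, ((f1 (w i ω) + (bb k1 r lam u1 i (fun i => ζ (w i ω)) - gg k1 r lam ζ f1 i (fun i => w i ω))) *
      (f2 (w i ω) + (bb k2 r lam u2 i (fun i => ζ (w i ω)) - gg k2 r lam ζ f2 i (fun i => w i ω))) - f1 (w i ω) * f2 (w i ω))| ∂μ ≤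
    2 * √(B * (n * ((1 + κ) ^ 2 * Cb))) + 2 * √(B ^ 2 * (n * ((1 + κ) ^ 2 * (Cl * lam)))) +
      n * (√((1 + κ) ^ 2 * Cb) * √((1 + κ) ^ 2 * Cb)) + 2 * (n * (√((1 + κ) ^ 2 * Cb) * √(B * ((1 + κ) ^ 2 * (Cl * lam))))) +
      √(B ^ 2 * ((2 + (1 + κ) ^ 2) * (n * ((1 + κ) ^ 2 * (Cl * lam))) + n ^ 2 * (72 * (1 + κ) ^ 8 * (2 * Cl * lam / r)))) := by
  have b1 : ∀ i, BM fun ω => bb k1 r lam u1 i (fun i => ζ (w i ω)) := fun i => (h.bbm i).comp h.mz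
  have b2 : ∀ i, BM fun ω => bb k2 r lam u2 i (fun i => ζ (w i ω)) := fun i => (h.swap.bbm i).comp h.mz
  have g1 : ∀ i, BM fun ω => gg k1 r lam ζ f1 i (fun i => w i ω) := fun i => (h.ggm i).comp h.mw
  have g2 : ∀ i, BM fun ω => gg k2 r lam ζ f2 i (fun i => w i ω) := fun i => (h.swap.ggm i).comp h.mw
  have F1 : ∀ i, BM fun ω => f1 (w i ω) := fun i => h.nf.b1.comp (h.hw i)
  have F2 : ∀ i, BM fun ω => f2 (w i ω) := fun i => h.nf.b2.comp (h.hw i)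
  have i1 : Integrable (fun ω => |∑ i : Fin n, bb k1 r lam u1 i (fun i => ζ (w i ω)) * f2 (w i ω)|) μ :=
    (BM.sum fun i _ => (b1 _).mul (F2 _)).norm.integrable μ
  have i2 : Integrable (fun ω => |∑ i : Fin n, bb k2 r lam u2 i (fun i => ζ (w i ω)) * f1 (w i ω)|) μ :=
    (BM.sum fun i _ => (b2 _).mul (F1 _)).norm.integrable μ
  have i3 : Integrable (fun ω => |∑ i : Fin n, gg k1 r lam ζ f1 i (fun i => w i ω) * f2 (w i ω)|) μ :=
    (BM.sum fun i _ => (g1 _).mul (F2 _)).norm.integrable μ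
  have i4 : Integrable (fun ω => |∑ i : Fin n, gg k2 r lam ζ f2 i (fun i => w i ω) * f1 (w i ω)|) μ :=
    (BM.sum fun i _ => (g2 _).mul (F1 _)).norm.integrable μ
  have i5 : Integrable (fun ω => |∑ i : Fin n, bb k1 r lam u1 i (fun i => ζ (w i ω)) * bb k2 r lam u2 i (fun i => ζ (w i ω))|) μ :=
    (BM.sum fun i _ => (b1 _).mul (b2 _)).norm.integrable μ
  have i6 : Integrable (fun ω => |∑ i : Fin n, bb k1 r lam u1 i (fun i => ζ (w i ω)) * gg k2 r lam ζ f2 i (fun i => w i ω)|) μ :=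
    (BM.sum fun i _ => (b1 _).mul (g2 _)).norm.integrable μ
  have i7 : Integrable (fun ω => |∑ i : Fin n, bb k2 r lam u2 i (fun i => ζ (w i ω)) * gg k1 r lam ζ f1 i (fun i => w i ω)|) μ :=
    (BM.sum fun i _ => (b2 _).mul (g1 _)).norm.integrable μ
  have i8 : Integrable (fun ω => |∑ i : Fin n, gg k1 r lam ζ f1 i (fun i => w i ω) * gg k2 r lam ζ f2 i (fun i => w i ω)|) μ :=
    (BM.sum fun i _ => (g1 _).mul (g2 _)).norm.integrable μ
  have hb : BM fun ω => ∑ i ∈ Finset.range n, ((f1 (w i ω) + (bb k1 r lam u1 i (fun i => ζ (w i ω)) - gg k1 r lam ζ f1 i (fun i => w i ω))) *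
      (f2 (w i ω) + (bb k2 r lam u2 i (fun i => ζ (w i ω)) - gg k2 r lam ζ f2 i (fun i => w i ω))) - f1 (w i ω) * f2 (w i ω)) :=
    BM.sum fun i _ => (((F1 i).add ((b1 i).sub (g1 i))).mul ((F2 i).add ((b2 i).sub (g2 i)))).sub ((F1 i).mul (F2 i))
  have key := integral_mono (μ := μ) (hb.norm.integrable μ)
    (((((((i1.add i2).add i3).add i4).add i5).add i6).add i7).add i8) (fun ω => by
      simp only [Pi.add_apply, Real.norm_eq_abs]
      have : (∑ i ∈ Finset.range n, ((f1 (w i ω) + (bb k1 r lam u1 i (fun i => ζ (w i ω)) - gg k1 r lam ζ f1 i (fun i => w i ω))) *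
          (f2 (w i ω) + (bb k2 r lam u2 i (fun i => ζ (w i ω)) - gg k2 r lam ζ f2 i (fun i => w i ω))) - f1 (w i ω) * f2 (w i ω))) =
          (∑ i : Fin n, bb k1 r lam u1 i (fun i => ζ (w i ω)) * f2 (w i ω)) +
          (∑ i : Fin n, bb k2 r lam u2 i (fun i => ζ (w i ω)) * f1 (w i ω)) -
          (∑ i : Fin n, gg k1 r lam ζ f1 i (fun i => w i ω) * f2 (w i ω)) -
          (∑ i : Fin n, gg k2 r lam ζ f2 i (fun i => w i ω) * f1 (w i ω)) +
          (∑ i : Fin n, bb k1 r lam u1 i (fun i => ζ (w i ω)) * bb k2 r lam u2 i (fun i => ζ (w i ω))) -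
          (∑ i : Fin n, bb k1 r lam u1 i (fun i => ζ (w i ω)) * gg k2 r lam ζ f2 i (fun i => w i ω)) -
          (∑ i : Fin n, bb k2 r lam u2 i (fun i => ζ (w i ω)) * gg k1 r lam ζ f1 i (fun i => w i ω)) +
          (∑ i : Fin n, gg k1 r lam ζ f1 i (fun i => w i ω) * gg k2 r lam ζ f2 i (fun i => w i ω)) := by
        simp only [Finset.sum_range, ← Finset.sum_add_distrib, ← Finset.sum_sub_distrib]
        exact Finset.sum_congr rfl fun i _ => by ring
      rw [this]
      refine (abs_add_le _ _).trans (add_le_add ?_ le_rfl)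
      refine (abs_sub _ _).trans (add_le_add ?_ le_rfl)
      refine (abs_sub _ _).trans (add_le_add ?_ le_rfl)
      refine (abs_add_le _ _).trans (add_le_add ?_ le_rfl)
      refine (abs_sub _ _).trans (add_le_add ?_ le_rfl)
      refine (abs_sub _ _).trans (add_le_add ?_ le_rfl)
      exact abs_add_le _ _)
  refine key.trans ?_
  rw [integral_add' (((((((i1.add i2).add i3).add i4).add i5).add i6).add i7)) i8,
    integral_add' ((((((i1.add i2).add i3).add i4).add i5).add i6)) i7,
    integral_add' (((((i1.add i2).add i3).add i4).add i5)) i6,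
    integral_add' ((((i1.add i2).add i3).add i4)) i5,
    integral_add' (((i1.add i2).add i3)) i4,
    integral_add' ((i1.add i2)) i3,
    integral_add' i1 i2]
  have q1 := h.t1 n
  have q2 := h.swap.t1 n
  have q3 := h.t2 n
  have q4 := h.swap.t2 n
  have q5 := h.t3 n
  have q6 := h.t4 n
  have q7 := h.swap.t4 n
  have q8 := h.t5 hrn
  linarith

end rem
end CIProof
end

section

namespace CIProof
set_option linter.unusedSectionVars false
section ci
variable {Ω : Type*} [MeasurableSpace Ω] [StandardBorelSpace Ω] {μ : Measure Ω} [IsProbabilityMeasure μ]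
variable {α β δ : Type*} [MeasurableSpace α] [StandardBorelSpace α] [Nonempty α]
  [MeasurableSpace β] [StandardBorelSpace β] [Nonempty β] [MeasurableSpace δ]

lemma ci_zero {X : Ω → α} {Y : Ω → β} {Z : Ω → δ} (hX : Measurable X) (hY : Measurable Y) (hZ : Measurable Z)
    (hci : CondIndepFun (MeasurableSpace.comap Z inferInstance) hZ.comap_le X Y μ)
    {g : α × δ → ℝ} (hg : BM g) {e : δ → ℝ} (he : BM e)
    (hge : (fun ω => e (Z ω)) =ᵐ[μ] μ[fun ω => g (X ω, Z ω) | MeasurableSpace.comap Z inferInstance])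
    {ψ : δ × β → ℝ} (hψ : BM ψ) :
    ∫ ω, (g (X ω, Z ω) - e (Z ω)) * ψ (Z ω, Y ω) ∂μ = 0 := by
  have h1 := (condIndepFun_iff_condDistrib_prod_ae_eq_prodMkRight hX hY hZ).1 hci.symm
  have hZY : Measurable fun ω => (Z ω, Y ω) := hZ.prodMk hY
  have h2 := compProd_map_condDistrib (μ := μ) (mβ := inferInstance) (X := fun ω => (Z ω, Y ω)) (Y := X) hX.aemeasurable
  have hpr : IsProbabilityMeasure (μ.map fun ω => (Z ω, Y ω)) := Measure.isProbabilityMeasure_map hZY.aemeasurable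
  rw [Measure.compProd_congr h1] at h2
  have hF : BM fun q : (δ × β) × α => (g (q.2, q.1.1) - e q.1.1) * ψ q.1 :=
    ((hg.comp (measurable_snd.prodMk (measurable_fst.comp measurable_fst))).sub
      (he.comp (measurable_fst.comp measurable_fst))).mul (hψ.comp measurable_fst)
  have h3 : ∫ ω, (g (X ω, Z ω) - e (Z ω)) * ψ (Z ω, Y ω) ∂μ =
      ∫ q, (g (q.2, q.1.1) - e q.1.1) * ψ q.1 ∂(μ.map fun ω => ((Z ω, Y ω), X ω)) := by
    rw [integral_map (hZY.prodMk hX).aemeasurable hF.1.aestronglyMeasurable]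
  rw [h3, ← h2, Measure.integral_compProd (hF.integrable _),
    integral_map hZY.aemeasurable (by
      exact (StronglyMeasurable.integral_kernel_prod_right (κ := (condDistrib X Z μ).prodMkRight β)
        (f := fun (a : δ × β) (b : α) => (g (b, a.1) - e a.1) * ψ a) hF.1).aestronglyMeasurable)]
  have h4 := condExp_prod_ae_eq_integral_condDistrib (μ := μ) (X := Z) (Y := X) hZ hX.aemeasurable
    (f := fun q : δ × α => g (q.2, q.1)) (hg.comp measurable_swap).1
    ((hg.comp (hX.prodMk hZ)).integrable μ)
  refine integral_eq_zero_of_ae ?_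
  filter_upwards [h4, hge] with ω h5 h6
  simp only [Kernel.prodMkRight_apply, Pi.zero_apply]
  have hgi : Integrable (fun a => g (a, Z ω)) (condDistrib X Z μ (Z ω)) :=
    (hg.comp (measurable_id.prodMk measurable_const)).integrable _
  rw [integral_mul_const, integral_sub hgi (integrable_const _), ← h5, ← h6]
  simp

end ci
end CIProof
end

section

namespace CIProof
set_option linter.unusedSectionVars false
section nf

lemma BM.of_bound_sq {α : Type*} [MeasurableSpace α] {f : α → ℝ} (hf : BM f) : ∃ C, 0 ≤ C ∧ ∀ x, f x ^ 2 ≤ C := by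
  obtain ⟨_, C, hC⟩ := hf
  refine ⟨C ^ 2, sq_nonneg _, fun x => sq_le_sq' ?_ ?_⟩
  · have := (abs_le.mp (hC x)).1; linarith
  · exact (abs_le.mp (hC x)).2

lemma clip {Ω : Type*} [MeasurableSpace Ω] {μ : Measure Ω} [IsProbabilityMeasure μ] {δ : Type*} [MeasurableSpace δ]
    {Z : Ω → δ} (hZ : Measurable Z) {g : Ω → ℝ} (hg : BM g) {e : δ → ℝ} (hem : Measurable e)
    (he : (fun ω => e (Z ω)) =ᵐ[μ] μ[g | MeasurableSpace.comap Z inferInstance]) :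
    ∃ c : δ → ℝ, BM c ∧ c =ᵐ[μ.map Z] e := by
  obtain ⟨_, C, hC⟩ := hg
  have hC0 : 0 ≤ max C 0 := le_max_right _ _
  have hb := ae_bdd_abs_condExp_of_ae_bdd_abs (m := MeasurableSpace.comap Z inferInstance) (μ := μ) (R := max C 0) (f := g)
    (Eventually.of_forall fun ω => (hC ω).trans (le_max_left _ _))
  refine ⟨fun z => max (-(max C 0)) (min (max C 0) (e z)), BM.of_measurable (C := max C 0)
    (measurable_const.max (measurable_const.min hem)) fun z => ?_, ?_⟩
  · rw [abs_le]
    exact ⟨le_max_left _ _, max_le (by linarith) (min_le_left _ _)⟩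
  · rw [Filter.EventuallyEq, ae_map_iff hZ.aemeasurable (measurableSet_eq_fun (measurable_const.max (measurable_const.min hem)) hem)]
    filter_upwards [hb, he] with ω h1 h2
    rw [← h2] at h1
    have h3 := abs_le.mp h1
    change -(max C 0) ≤ _ ∧ _ ≤ max C 0 at h3
    rw [min_eq_right h3.2, max_eq_right h3.1]

variable {Ω : Type} [MeasurableSpace Ω] [StandardBorelSpace Ω] {μ : Measure Ω} [IsProbabilityMeasure μ]
variable {α β δ : Type} [MeasurableSpace α] [StandardBorelSpace α] [Nonempty α]
  [MeasurableSpace β] [StandardBorelSpace β] [Nonempty β] [MeasurableSpace δ]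

lemma exists_NF {X : Ω → α} {Y : Ω → β} {Z : Ω → δ} (hX : Measurable X) (hY : Measurable Y) (hZ : Measurable Z)
    (hci : CondIndepFun (MeasurableSpace.comap Z inferInstance) hZ.comap_le X Y μ)
    {g1 : α × δ → ℝ} (hg1 : BM g1) {g2 : β → ℝ} (hg2 : BM g2) {e1 e2 : δ → ℝ} (hem1 : Measurable e1) (hem2 : Measurable e2)
    (he1 : (fun ω => e1 (Z ω)) =ᵐ[μ] μ[fun ω => g1 (X ω, Z ω) | MeasurableSpace.comap Z inferInstance])
    (he2 : (fun ω => e2 (Z ω)) =ᵐ[μ] μ[fun ω => g2 (Y ω) | MeasurableSpace.comap Z inferInstance]) :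
    ∃ c1 c2 : δ → ℝ, BM c1 ∧ BM c2 ∧ c1 =ᵐ[μ.map Z] e1 ∧ c2 =ᵐ[μ.map Z] e2 ∧
      ∃ (η1 η2 : (α × δ) × β → (α × δ) × β) (B : ℝ), NF (μ.map fun ω => ((X ω, Z ω), Y ω))
        (fun v => g1 v.1 - c1 v.1.2) (fun v => g2 v.2 - c2 v.1.2) η1 η2 (fun v => v.1.2) B := by
  obtain ⟨c1, hc1, hce1⟩ := clip hZ (hg1.comp (hX.prodMk hZ)) hem1 he1
  obtain ⟨c2, hc2, hce2⟩ := clip hZ (hg2.comp hY) hem2 he2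
  obtain ⟨x0⟩ := (inferInstance : Nonempty α)
  obtain ⟨y0⟩ := (inferInstance : Nonempty β)
  have hζ : Measurable fun v : (α × δ) × β => v.1.2 := measurable_snd.comp measurable_fst
  have b1 : BM fun v : (α × δ) × β => g1 v.1 - c1 v.1.2 := (hg1.comp measurable_fst).sub (hc1.comp hζ)
  have b2 : BM fun v : (α × δ) × β => g2 v.2 - c2 v.1.2 := (hg2.comp measurable_snd).sub (hc2.comp hζ)
  obtain ⟨B1, hB10, hB1⟩ := b1.of_bound_sq
  obtain ⟨B2, hB20, hB2⟩ := b2.of_bound_sq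
  have hm1 : Measurable fun v : (α × δ) × β => ((x0, v.1.2), v.2) := (measurable_const.prodMk hζ).prodMk measurable_snd
  have hm2 : Measurable fun v : (α × δ) × β => (v.1, y0) := measurable_fst.prodMk measurable_const
  have hV : Measurable fun ω => ((X ω, Z ω), Y ω) := (hX.prodMk hZ).prodMk hY
  have hq1 : (fun ω => c1 (Z ω)) =ᵐ[μ] μ[fun ω => g1 (X ω, Z ω) | MeasurableSpace.comap Z inferInstance] :=
    Filter.EventuallyEq.trans (show (fun ω => c1 (Z ω)) =ᵐ[μ] fun ω => e1 (Z ω) from ae_of_ae_map hZ.aemeasurable hce1) he1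
  have hq2 : (fun ω => c2 (Z ω)) =ᵐ[μ] μ[fun ω => g2 (Y ω) | MeasurableSpace.comap Z inferInstance] :=
    Filter.EventuallyEq.trans (show (fun ω => c2 (Z ω)) =ᵐ[μ] fun ω => e2 (Z ω) from ae_of_ae_map hZ.aemeasurable hce2) he2
  refine ⟨c1, c2, hc1, hc2, hce1, hce2, fun v => ((x0, v.1.2), v.2), fun v => (v.1, y0), B1 + B2,
    b1, b2, fun v => (hB1 v).trans (by linarith), fun v => (hB2 v).trans (by linarith), hm1, hm2, hζ,
    fun v => rfl, fun v => rfl, fun v => rfl, fun v => rfl, fun ψ hψ => ?_, fun ψ hψ => ?_⟩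
  · rw [integral_map hV.aemeasurable (b1.mul (hψ.comp hm1)).1.aestronglyMeasurable]
    exact ci_zero hX hY hZ hci hg1 hc1 hq1 (ψ := fun p : δ × β => ψ ((x0, p.1), p.2))
      (hψ.comp ((measurable_const.prodMk measurable_fst).prodMk measurable_snd))
  · rw [integral_map hV.aemeasurable (b2.mul (hψ.comp hm2)).1.aestronglyMeasurable]
    exact ci_zero hY hX hZ hci.symm (g := fun p : β × δ => g2 p.1) (hg2.comp measurable_fst) hc2 hq2
      (ψ := fun p : δ × α => ψ ((p.2, p.1), y0))
      (hψ.comp ((measurable_snd.prodMk measurable_fst).prodMk measurable_const))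

end nf

section a1
variable {DX DY : Type} [MeasurableSpace DX] [MeasurableSpace DY]
    [NormedAddCommGroup DX] [NormedSpace ℝ DX] [NormedAddCommGroup DY] [NormedSpace ℝ DY]
    [BorelSpace DX] [BorelSpace DY] [Nontrivial DX]

lemma a1_ne {kX : DX → DX → ℝ} {kY : DY → DY → ℝ} (h : Assumption1 kX kY) :
    ∃ p q : DX × DY, kX p.1 q.1 * kY p.2 q.2 ≠ 0 := by
  by_contra! hc
  obtain ⟨a, b, hab⟩ := exists_pair_ne DX
  have := h.charac (Measure.dirac (a, 0)) (Measure.dirac (b, 0)) inferInstance inferInstance (fun t => by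
    simp [meanEmbed, hc])
  have h2 := congrArg (fun m => m (Prod.fst ⁻¹' {a})) this
  have hms : MeasurableSet (Prod.fst ⁻¹' {a} : Set (DX × DY)) := measurable_fst (measurableSet_singleton a)
  simp [Measure.dirac_apply' _ hms, hab.symm] at h2

lemma a1_X {kX : DX → DX → ℝ} {kY : DY → DY → ℝ} (h : Assumption1 kX kY) (t : DX) : BM (kX t) := by
  obtain ⟨p, q, hpq⟩ := a1_ne h
  obtain ⟨C, hC⟩ := h.bounded
  have hy : kY p.2 q.2 ≠ 0 := right_ne_zero_of_mul hpq
  have e : ∀ x, kX t x = (kX t x * kY p.2 q.2) / kY p.2 q.2 := fun x => by field_simp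
  refine BM.of_measurable (C := C / |kY p.2 q.2|) (Continuous.measurable ?_) fun x => ?_
  · have : kX t = fun x => (kX t x * kY p.2 q.2) / kY p.2 q.2 := funext e
    rw [this]
    refine Continuous.div_const ?_ _
    have hc : Continuous fun x : DX => (((t, p.2), (x, q.2)) : (DX × DY) × (DX × DY)) := by fun_prop
    exact h.continuous.comp hc
  · rw [e, abs_div]
    exact div_le_div_of_nonneg_right (hC (t, p.2) (x, q.2)) (abs_nonneg _)

lemma a1_Y {kX : DX → DX → ℝ} {kY : DY → DY → ℝ} (h : Assumption1 kX kY) (t : DY) : BM (kY t) := by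
  obtain ⟨p, q, hpq⟩ := a1_ne h
  obtain ⟨C, hC⟩ := h.bounded
  have hy : kX p.1 q.1 ≠ 0 := left_ne_zero_of_mul hpq
  have e : ∀ x, kY t x = (kX p.1 q.1 * kY t x) / kX p.1 q.1 := fun x => by field_simp
  refine BM.of_measurable (C := C / |kX p.1 q.1|) (Continuous.measurable ?_) fun x => ?_
  · have : kY t = fun x => (kX p.1 q.1 * kY t x) / kX p.1 q.1 := funext e
    rw [this]
    refine Continuous.div_const ?_ _
    have hc : Continuous fun x : DY => (((p.1, t), (q.1, x)) : (DX × DY) × (DX × DY)) := by fun_prop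
    exact h.continuous.comp hc
  · rw [e, abs_div]
    exact div_le_div_of_nonneg_right (hC (p.1, t) (q.1, x)) (abs_nonneg _)

end a1
end CIProof
end

section

namespace CIProof
set_option linter.unusedSectionVars false

lemma KF.mono {D : Type} [MeasurableSpace D] {P : Measure D} [IsProbabilityMeasure P] {k : D → D → ℝ} {r : ℕ}
    {lam κ Cl κ' Cl' : ℝ} (h : KF P k r lam κ Cl) (hκ : κ ≤ κ') (hC : Cl ≤ Cl') : KF P k r lam κ' Cl' :=
  ⟨h.pd, h.symm, h.meas, fun z => (h.diag z).trans hκ, h.κ0.trans hκ, h.r2, h.lam0, h.c1, h.Cl0.trans hC,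
    fun ι _ _ hι a => (h.lev ι hι a).trans (mul_le_mul_of_nonneg_right hC h.lam0.le)⟩

lemma BF.mono {D : Type} [MeasurableSpace D] {P : Measure D} [IsProbabilityMeasure P] {k : D → D → ℝ} {r : ℕ}
    {lam : ℝ} {u : D → ℝ} {Cb Cb' : ℝ} (h : BF P k r lam u Cb) (hC : Cb ≤ Cb') : BF P k r lam u Cb' :=
  ⟨h.bm, h.Cb0.trans hC, fun ι _ _ hι => (h.bd ι hι).trans (mul_le_mul_of_nonneg_left hC (by positivity))⟩

lemma exists_KB {d : ℕ} {P : Measure (Fin d → ℝ)} [IsProbabilityMeasure P] {k : (Fin d → ℝ) → (Fin d → ℝ) → ℝ}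
    (hb : BoundedKernel k) (hc : Continuous fun q : (Fin d → ℝ) × (Fin d → ℝ) => k q.1 q.2)
    (hs : ∀ z z', k z z' = k z' z) (hpd : PosDefKernel k) {L Lβ : Lp ℝ 2 P →L[ℝ] Lp ℝ 2 P}
    (hL : ∀ g : Lp ℝ 2 P, (L g : (Fin d → ℝ) → ℝ) =ᵐ[P] fun z => ∫ z', k z z' * g z' ∂P)
    {Q γ β : ℝ} (hQ : 0 < Q) (hT : TraceAssumption P L Q γ) (hβ1 : 1 < β) (hβ2 : β ≤ 2)
    (hLβ : IsFracPower L (β / 2) Lβ) {u : (Fin d → ℝ) → ℝ} (hu : BM u) (g : Lp ℝ 2 P)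
    (hg : (Lβ g : (Fin d → ℝ) → ℝ) =ᵐ[P] u) :
    ∃ κ Cl C : ℝ, ∀ (r : ℕ) (lam : ℝ), 2 ≤ r → 0 < lam → lam ^ (-γ) = r * lam → (r : ℝ)⁻¹ ≤ lam →
      KF P k r lam κ Cl ∧ BF P k r lam u (C * lam ^ β) := by
  obtain ⟨H, i1, i2, i3, i4, φ, hφ, hk⟩ := exists_feature k hpd hs hc
  obtain ⟨C0, hC0⟩ := hb
  have hκ : ∀ z, ‖φ z‖ ^ 2 ≤ C0 := fun z => by
    rw [← real_inner_self_eq_norm_sq, hk]; exact (le_abs_self _).trans (hC0 z z)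
  have hκ0 : 0 ≤ C0 := (abs_nonneg _).trans (hC0 0 0)
  have hL' : ∀ g : Lp ℝ 2 P, (L g : (Fin d → ℝ) → ℝ) =ᵐ[P] fun z => ∫ z', ⟪φ z, φ z'⟫ * g z' ∂P := by
    intro g; simp_rw [hk]; exact hL g
  obtain ⟨C, hC, hB⟩ := bias_main hpd hk hφ hκ hκ0 hL' hβ1 hβ2 hLβ hu g hg
  refine ⟨C0, (6 + 4 * C0) * Q, C, fun r lam hr hlam h1 h2 => ⟨⟨hpd, hs, hc.measurable, fun z => (le_abs_self _).trans (hC0 z z), hκ0, hr, hlam, ?_, by positivity, ?_⟩, ⟨hu, by positivity, ?_⟩⟩⟩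
  · have hr0 : (0 : ℝ) < r := by positivity
    calc (1 : ℝ) = r * (r : ℝ)⁻¹ := by field_simp
      _ ≤ _ := by gcongr
  · intro ι _ _ hι a
    exact hat_diag1 hpd hk hφ hκ hκ0 hL' hQ hT hr hι hlam h1 h2 a
  · intro ι _ _ hι
    have hr0 : (0 : ℝ) < r := by positivity
    have hcd : (r : ℝ) ≤ Fintype.card ι := by exact_mod_cast hι
    have : Nonempty ι := Fintype.card_pos_iff.mp (by omega)
    refine hB ι lam (r * lam) hlam (by positivity) (by gcongr) ?_
    calc (1 : ℝ) = r * (r : ℝ)⁻¹ := by field_simp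
      _ ≤ _ := by gcongr

lemma rls_eq {D : Type} {k : D → D → ℝ} (hpd : PosDefKernel k) (hs : ∀ x y, k x y = k y x) (zs : ℕ → D)
    (tg : ℕ → ℝ) (r : ℕ) (lam : ℝ) (i : ℕ) :
    rls k zs tg r lam (zs i) = ∑ l : Fin r, Wr k r lam zs i l * tg l := by
  have hS := (spd_kmat hpd hs (fun l : Fin r => zs l)).R_symm (c := r * lam)
  have h1 : rls k zs tg r lam (zs i) =
      (Rm (kmat k fun l : Fin r => zs l) (r * lam)).mulVec (fun l : Fin r => tg l) ⬝ᵥ (fun l : Fin r => k (zs l) (zs i)) := rfl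
  have h2 : ∑ l : Fin r, Wr k r lam zs i l * tg l =
      (Rm (kmat k fun l : Fin r => zs l) (r * lam)).mulVec (fun l : Fin r => k (zs l) (zs i)) ⬝ᵥ (fun l : Fin r => tg l) := rfl
  rw [h1, h2, dotProduct_comm, Matrix.dotProduct_mulVec, ← Matrix.mulVec_transpose, hS]

/-- `n r^{-s} → 0`. -/
lemma lim_pow {γ β : ℝ} (hγ0 : 0 ≤ γ) (hβ1 : 1 < β) {rn : ℕ → ℕ}
    (hro : (fun n : ℕ => (n : ℝ) ^ ((β + γ) / (2 * β))) =o[atTop] fun n => (rn n : ℝ)) {s : ℝ}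
    (hs : 2 * β / (β + γ) ≤ s) : Tendsto (fun n : ℕ => (n : ℝ) * (rn n : ℝ) ^ (-s)) atTop (𝓝 0) := by
  have hpos : 0 < 2 * β / (β + γ) := by positivity
  have h0 : Tendsto (fun n : ℕ => ((n : ℝ) ^ ((β + γ) / (2 * β)) / (rn n : ℝ)) ^ (2 * β / (β + γ))) atTop (𝓝 0) := by
    have := (hro.tendsto_div_nhds_zero).rpow_const (p := 2 * β / (β + γ)) (Or.inr hpos.le)
    rwa [Real.zero_rpow hpos.ne'] at this
  refine squeeze_zero (fun n => by positivity) (fun n => ?_) h0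
  rcases Nat.eq_zero_or_pos (rn n) with h | h
  · rw [h]; 
    have : -s ≠ 0 := by linarith
    rw [Nat.cast_zero, Real.zero_rpow this, mul_zero]; positivity
  · have h1 : (1 : ℝ) ≤ rn n := by exact_mod_cast h
    rw [Real.div_rpow (by positivity) (by positivity), ← Real.rpow_mul (by positivity),
      show (β + γ) / (2 * β) * (2 * β / (β + γ)) = 1 by
        have : β + γ ≠ 0 := by positivity
        field_simp, Real.rpow_one, div_eq_mul_inv, ← Real.rpow_neg (by positivity)]
    gcongr

lemma rn_top {γ β : ℝ} (hγ0 : 0 ≤ γ) (hβ1 : 1 < β) {rn : ℕ → ℕ}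
    (hro : (fun n : ℕ => (n : ℝ) ^ ((β + γ) / (2 * β))) =o[atTop] fun n => (rn n : ℝ)) :
    Tendsto (fun n => (rn n : ℝ)) atTop atTop := by
  have h1 : Tendsto (fun n : ℕ => (n : ℝ) ^ ((β + γ) / (2 * β))) atTop atTop :=
    (tendsto_rpow_atTop (by positivity)).comp tendsto_natCast_atTop_atTop
  refine tendsto_atTop_mono' _ ?_ h1
  filter_upwards [hro.bound one_pos] with n hn
  rw [one_mul, Real.norm_of_nonneg (by positivity), Real.norm_of_nonneg (by positivity)] at hn
  exact hn

lemma bound_div {n B T Cl Cb lam r : ℝ} (hn : 0 < n) (hCb : 0 ≤ Cb) :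
    (√n)⁻¹ * (2*√(B*(n*(T^2*Cb))) + 2*√(B^2*(n*(T^2*(Cl*lam)))) + n*(√(T^2*Cb)*√(T^2*Cb)) + 2*(n*(√(T^2*Cb)*√(B*(T^2*(Cl*lam))))) + √(B^2*((2+T^2)*(n*(T^2*(Cl*lam))) + n^2*(72*T^8*(2*Cl*lam/r)))))
    = 2*√(B*T^2*Cb) + 2*√(B^2*T^2*Cl*lam) + √(T^4*(n*Cb^2)) + 2*√(T^4*B*Cl*(n*(Cb*lam))) + √(B^2*((2+T^2)*T^2*Cl*lam + 144*T^8*Cl*(n*(lam/r)))) := by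
  have hs : √n * √n = n := Real.mul_self_sqrt hn.le
  have hs0 : √n ≠ 0 := by positivity
  have e1 : √(B*(n*(T^2*Cb))) = √n * √(B*T^2*Cb) := by rw [← Real.sqrt_mul hn.le]; ring_nf
  have e2 : √(B^2*(n*(T^2*(Cl*lam)))) = √n * √(B^2*T^2*Cl*lam) := by rw [← Real.sqrt_mul hn.le]; ring_nf
  have e3 : √(T^4*(n*Cb^2)) = √n * (√(T^2*Cb)*√(T^2*Cb)) := by
    rw [Real.mul_self_sqrt (by positivity), show T^4*(n*Cb^2) = n * (T^2*Cb)^2 by ring, Real.sqrt_mul hn.le, Real.sqrt_sq (by positivity)]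
  have e4 : √(T^4*B*Cl*(n*(Cb*lam))) = √n * (√(T^2*Cb)*√(B*(T^2*(Cl*lam)))) := by
    rw [← Real.sqrt_mul (by positivity), ← Real.sqrt_mul hn.le]; ring_nf
  have e5 : √(B^2*((2+T^2)*(n*(T^2*(Cl*lam))) + n^2*(72*T^8*(2*Cl*lam/r)))) = √n * √(B^2*((2+T^2)*T^2*Cl*lam + 144*T^8*Cl*(n*(lam/r)))) := by
    rw [← Real.sqrt_mul hn.le]; ring_nf
  rw [e1, e2, e3, e4, e5]
  set a := √n
  rw [← hs]
  field_simp

lemma lim_bound {γ β : ℝ} (hγ0 : 0 ≤ γ) (hγ1 : γ ≤ 1) (hβ1 : 1 < β) (hβ2 : β ≤ 2) {rn : ℕ → ℕ}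
    (hro : (fun n : ℕ => (n : ℝ) ^ ((β + γ) / (2 * β))) =o[atTop] fun n => (rn n : ℝ))
    {B T Cl C : ℝ} {lam : ℕ → ℝ} (hlam : ∀ n, lam n = (rn n : ℝ) ^ (-(1 / (1 + γ)))) :
    Tendsto (fun n : ℕ => 2*√(B*T^2*(C * lam n ^ β)) + 2*√(B^2*T^2*Cl*lam n) + √(T^4*((n:ℝ)*(C * lam n ^ β)^2)) + 2*√(T^4*B*Cl*(n*(C * lam n ^ β *lam n))) + √(B^2*((2+T^2)*T^2*Cl*lam n + 144*T^8*Cl*(n*(lam n/rn n))))) atTop (𝓝 0) := by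
  have hg : 0 < 1 + γ := by positivity
  have hbg : 0 < β + γ := by positivity
  have hl0 : ∀ n, 0 ≤ lam n := fun n => by rw [hlam]; positivity
  have hrt := rn_top hγ0 hβ1 hro
  have l1 : Tendsto lam atTop (𝓝 0) := by
    simp_rw [funext hlam]
    exact (tendsto_rpow_neg_atTop (by positivity : 0 < 1 / (1 + γ))).comp hrt
  have l2 : Tendsto (fun n => lam n ^ β) atTop (𝓝 0) := by
    have := l1.rpow_const (p := β) (Or.inr (by linarith))
    rwa [Real.zero_rpow (by linarith)] at this
  have pw : ∀ n (x : ℝ), lam n ^ x = (rn n : ℝ) ^ (-(x / (1 + γ))) := fun n x => by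
    rw [hlam, ← Real.rpow_mul (by positivity)]; congr 1; ring
  have l3 : Tendsto (fun n : ℕ => (n : ℝ) * (lam n ^ β) ^ 2) atTop (𝓝 0) := by
    have h := lim_pow hγ0 hβ1 hro (s := 2 * β / (1 + γ)) (by gcongr)
    refine h.congr fun n => ?_
    rw [← Real.rpow_natCast, ← Real.rpow_mul (hl0 n), pw]
    congr 3; push_cast; ring
  have l4 : Tendsto (fun n : ℕ => (n : ℝ) * (lam n ^ β * lam n)) atTop (𝓝 0) := by
    have h := lim_pow hγ0 hβ1 hro (s := (β + 1) / (1 + γ)) (by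
      rw [div_le_div_iff₀ hbg hg]; nlinarith [mul_nonneg (sub_nonneg.2 hβ1.le) (by linarith : 0 ≤ β - γ)])
    refine h.congr fun n => ?_
    rw [← pw, Real.rpow_add_one' (hl0 n) (by linarith)]
  have l5 : Tendsto (fun n : ℕ => (n : ℝ) * (lam n / rn n)) atTop (𝓝 0) := by
    have h := lim_pow hγ0 hβ1 hro (s := 1 / (1 + γ) + 1) (by
      rw [show 1 / (1 + γ) + 1 = (2 + γ) / (1 + γ) by rw [div_add_one hg.ne']; congr 1; ring, div_le_div_iff₀ hbg hg]; nlinarith [mul_nonneg hγ0 (by linarith : 0 ≤ 2 - β), sq_nonneg γ])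
    refine h.congr' ?_
    filter_upwards [hrt.eventually_gt_atTop 0] with n hn
    rw [hlam, neg_add, Real.rpow_add hn, Real.rpow_neg_one]
    simp only [div_eq_mul_inv]
  have t1 : Tendsto (fun n : ℕ => 2*√(B*T^2*(C * lam n ^ β))) atTop (𝓝 0) := by
    simpa using (((l2.const_mul C).const_mul (B*T^2)).sqrt).const_mul 2
  have t2 : Tendsto (fun n : ℕ => 2*√(B^2*T^2*Cl*lam n)) atTop (𝓝 0) := by
    simpa using ((l1.const_mul (B^2*T^2*Cl)).sqrt).const_mul 2
  have t3 : Tendsto (fun n : ℕ => √(T^4*((n:ℝ)*(C * lam n ^ β)^2))) atTop (𝓝 0) := by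
    have := ((l3.const_mul (C^2)).const_mul (T^4)).sqrt
    simp only [mul_zero, Real.sqrt_zero] at this
    refine this.congr fun n => ?_
    congr 1; ring
  have t4 : Tendsto (fun n : ℕ => 2*√(T^4*B*Cl*(n*(C * lam n ^ β *lam n)))) atTop (𝓝 0) := by
    have := (((l4.const_mul C).const_mul (T^4*B*Cl)).sqrt).const_mul 2
    simp only [mul_zero, Real.sqrt_zero] at this
    refine this.congr fun n => ?_
    congr 2; ring
  have t5 : Tendsto (fun n : ℕ => √(B^2*((2+T^2)*T^2*Cl*lam n + 144*T^8*Cl*(n*(lam n/rn n))))) atTop (𝓝 0) := by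
    have := (((l1.const_mul ((2+T^2)*T^2*Cl)).add (l5.const_mul (144*T^8*Cl))).const_mul (B^2)).sqrt
    simpa only [mul_zero, add_zero, Real.sqrt_zero] using this
  simpa using (((t1.add t2).add t3).add t4).add t5

end CIProof
end

section

namespace CIProof
set_option linter.unusedSectionVars false

/-- the two-kernel facts, uniformly in the sample size -/
def KB {D : Type} [MeasurableSpace D] (P : Measure D) [IsProbabilityMeasure P] (k : D → D → ℝ) (u : D → ℝ) (γ β κ Cl C : ℝ) : Prop :=
  ∀ (r : ℕ) (lam : ℝ), 2 ≤ r → 0 < lam → lam ^ (-γ) = r * lam → (r : ℝ)⁻¹ ≤ lam →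
      KF P k r lam κ Cl ∧ BF P k r lam u (C * lam ^ β)

section rj
variable {α D δ : Type} [MeasurableSpace α] [MeasurableSpace D] [MeasurableSpace δ]
variable {Ω : Type} [MeasurableSpace Ω] {μ : Measure Ω} [IsProbabilityMeasure μ] {w : ℕ → Ω → (α × D) × δ}
  {Pw : Measure ((α × D) × δ)} [IsProbabilityMeasure Pw] {P : Measure D} [IsProbabilityMeasure P]

lemma rem_j (hw : ∀ i, Measurable (w i)) (hi : iIndepFun w μ) (hl : ∀ i, μ.map (w i) = Pw)
    (hP : Pw.map (fun v => v.1.2) = P) {g1 : α × D → ℝ} {g2 : δ → ℝ} {c1 c2 : D → ℝ}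
    {η1 η2 : (α × D) × δ → (α × D) × δ} {B : ℝ}
    (hnf : NF Pw (fun v => g1 v.1 - c1 v.1.2) (fun v => g2 v.2 - c2 v.1.2) η1 η2 (fun v => v.1.2) B)
    {k1 k2 : D → D → ℝ} {γ β κ1 Cl1 C1 κ2 Cl2 C2 : ℝ} (hγ0 : 0 ≤ γ) (hγ1 : γ ≤ 1) (hβ1 : 1 < β) (hβ2 : β ≤ 2)
    (h1 : KB P k1 c1 γ β κ1 Cl1 C1) (h2 : KB P k2 c2 γ β κ2 Cl2 C2)
    {rn : ℕ → ℕ} (hrn : ∀ n, rn n ≤ n)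
    (hro : (fun n : ℕ => (n : ℝ) ^ ((β + γ) / (2 * β))) =o[atTop] fun n => (rn n : ℝ))
    {lam : ℕ → ℝ} (hlam : ∀ n, lam n = (rn n : ℝ) ^ (-(1 / (1 + γ))))
    {T : ℕ → Ω → ℝ} (hT : ∀ n ω, T n ω = ∑ i ∈ Finset.range n,
      ((g1 (w i ω).1 - rls k1 (fun l => (w l ω).1.2) (fun l => g1 (w l ω).1) (rn n) (lam n) (w i ω).1.2) *
        (g2 (w i ω).2 - rls k2 (fun l => (w l ω).1.2) (fun l => g2 (w l ω).2) (rn n) (lam n) (w i ω).1.2) -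
        (g1 (w i ω).1 - c1 (w i ω).1.2) * (g2 (w i ω).2 - c2 (w i ω).1.2))) :
    ∃ b : ℕ → ℝ, Tendsto b atTop (𝓝 0) ∧ ∀ᶠ n in atTop, BM (T n) ∧ (√(n : ℝ))⁻¹ * ∫ ω, |T n ω| ∂μ ≤ b n := by
  have hg : 0 < 1 + γ := by positivity
  refine ⟨_, lim_bound (B := B) (T := 1 + max κ1 κ2) (Cl := max Cl1 Cl2) (C := max C1 C2) hγ0 hγ1 hβ1 hβ2 hro hlam, ?_⟩
  filter_upwards [(rn_top hγ0 hβ1 hro).eventually_ge_atTop 2, eventually_gt_atTop 0] with n hr2 hn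
  have hr0 : (0 : ℝ) < rn n := by linarith
  have hr2' : 2 ≤ rn n := by exact_mod_cast hr2
  have hl0 : 0 < lam n := by rw [hlam]; positivity
  have e1 : lam n ^ (-γ) = rn n * lam n := by
    rw [hlam, ← Real.rpow_mul hr0.le, mul_comm (rn n : ℝ), ← Real.rpow_add_one hr0.ne']
    congr 1; field_simp; ring
  have e2 : (rn n : ℝ)⁻¹ ≤ lam n := by
    rw [hlam, ← Real.rpow_neg_one]
    refine Real.rpow_le_rpow_of_exponent_le (by linarith) ?_
    rw [neg_le_neg_iff, div_le_one hg]; linarith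
  obtain ⟨K1, F1⟩ := h1 _ _ hr2' hl0 e1 e2
  obtain ⟨K2, F2⟩ := h2 _ _ hr2' hl0 e1 e2
  have hlb : 0 < lam n ^ β := Real.rpow_pos_of_pos hl0 _
  have R : RF μ w Pw P (fun v => g1 v.1 - c1 v.1.2) (fun v => g2 v.2 - c2 v.1.2) η1 η2 (fun v => v.1.2) B
      k1 k2 (rn n) (lam n) (max κ1 κ2) (max Cl1 Cl2) (max C1 C2 * lam n ^ β) c1 c2 :=
    ⟨hnf, hw, hi, hl, hP, K1.mono (le_max_left _ _) (le_max_left _ _), K2.mono (le_max_right _ _) (le_max_right _ _),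
      F1.mono (by gcongr; exact le_max_left _ _), F2.mono (by gcongr; exact le_max_right _ _)⟩
  have id1 : ∀ ω i, g1 (w i ω).1 - rls k1 (fun l => (w l ω).1.2) (fun l => g1 (w l ω).1) (rn n) (lam n) (w i ω).1.2 =
      (g1 (w i ω).1 - c1 (w i ω).1.2) + (bb k1 (rn n) (lam n) c1 i (fun i => (w i ω).1.2) -
        gg k1 (rn n) (lam n) (fun v => v.1.2) (fun v : (α × D) × δ => g1 v.1 - c1 v.1.2) i (fun i => w i ω)) := by
    intro ω i
    rw [show (w i ω).1.2 = (fun l => (w l ω).1.2) i from rfl, rls_eq K1.pd K1.symm]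
    simp only [bb, gg, mul_sub, Finset.sum_sub_distrib]
    ring
  have id2 : ∀ ω i, g2 (w i ω).2 - rls k2 (fun l => (w l ω).1.2) (fun l => g2 (w l ω).2) (rn n) (lam n) (w i ω).1.2 =
      (g2 (w i ω).2 - c2 (w i ω).1.2) + (bb k2 (rn n) (lam n) c2 i (fun i => (w i ω).1.2) -
        gg k2 (rn n) (lam n) (fun v => v.1.2) (fun v : (α × D) × δ => g2 v.2 - c2 v.1.2) i (fun i => w i ω)) := by
    intro ω i
    rw [show (w i ω).1.2 = (fun l => (w l ω).1.2) i from rfl, rls_eq K2.pd K2.symm]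
    simp only [bb, gg, mul_sub, Finset.sum_sub_distrib]
    ring
  have hTe := funext (hT n)
  simp_rw [id1, id2] at hTe
  have b1 := fun i => (R.bbm i).comp R.mz
  have b2 := fun i => (R.swap.bbm i).comp R.mz
  have gg1 := fun i => (R.ggm i).comp R.mw
  have gg2 := fun i => (R.swap.ggm i).comp R.mw
  have f1 := fun i => R.nf.b1.comp (R.hw i)
  have f2 := fun i => R.nf.b2.comp (R.hw i)
  refine ⟨?_, ?_⟩
  · rw [hTe]
    exact BM.sum fun i _ => (((f1 i).add ((b1 i).sub (gg1 i))).mul ((f2 i).add ((b2 i).sub (gg2 i)))).sub ((f1 i).mul (f2 i))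
  · have hn' : (0 : ℝ) < n := by exact_mod_cast hn
    rw [← bound_div hn' R.F1.Cb0]
    refine mul_le_mul_of_nonneg_left ?_ (by positivity)
    rw [hTe]
    exact R.total (hrn n)

end rj
end CIProof
end

section

namespace CIProof
set_option linter.unusedSectionVars false

section clt
variable {A : Type} [MeasurableSpace A] {Pw : Measure A} [IsProbabilityMeasure Pw]
variable {Ω : Type} [MeasurableSpace Ω] {μ : Measure Ω} [IsProbabilityMeasure μ] {w : ℕ → Ω → A} {J : ℕ}

lemma clt_one (hw : ∀ i, Measurable (w i)) (hi : iIndepFun w μ) (hl : ∀ i, μ.map (w i) = Pw)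
    {f : A → ℝ} (hf : BM f) (h0 : ∫ v, f v ∂Pw = 0) :
    Tendsto (fun n : ℕ => charFun (μ.map fun ω => (√(n : ℝ))⁻¹ * ∑ i ∈ Finset.range n, f (w i ω)) 1) atTop
      (𝓝 (charFun (gaussianReal 0 (Real.toNNReal (∫ ω, f (w 0 ω) ^ 2 ∂μ))) 1)) := by
  have hm : ∀ i, Measurable fun ω => f (w i ω) := fun i => hf.measurable.comp (hw i)
  have e0 : μ[fun ω => f (w 0 ω)] = 0 := by
    rw [← h0, ← hl 0, integral_map (hw 0).aemeasurable hf.1.aestronglyMeasurable]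
  have hv : Var[fun ω => f (w 0 ω); μ] = ∫ ω, f (w 0 ω) ^ 2 ∂μ := variance_of_integral_eq_zero (hm 0).aemeasurable e0
  have hb : BM fun ω => f (w 0 ω) := hf.comp (hw 0)
  have h := tendstoInDistribution_inv_sqrt_mul_sum_sub (P := μ) (X := fun i ω => f (w i ω)) (Y := id)
    (P' := gaussianReal 0 (Real.toNNReal (∫ ω, f (w 0 ω) ^ 2 ∂μ)))
    ⟨aemeasurable_id, by rw [hv, Measure.map_id]⟩ (by
      obtain ⟨C, hC⟩ := hb.2
      exact MemLp.of_bound hb.1.aestronglyMeasurable C (Eventually.of_forall hC))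
    (hi.comp (fun _ => f) fun _ => hf.measurable)
    (fun i => ⟨(hm i).aemeasurable, (hm 0).aemeasurable, by
      have : ∀ i, μ.map (fun ω => f (w i ω)) = Pw.map f := fun i => by
        rw [← hl i, Measure.map_map hf.measurable (hw i)]; rfl
      rw [this, this]⟩)
  have h2 := ProbabilityMeasure.tendsto_iff_tendsto_charFun.1 h.tendsto 1
  simp only [ProbabilityMeasure.coe_mk, Measure.map_id, e0, mul_zero, sub_zero] at h2
  exact h2

lemma charFun_lin {Ω' : Type*} [MeasurableSpace Ω'] (ρ : Measure Ω') {V : Ω' → Fin J → ℝ} (hV : Measurable V) (a : EuclideanSpace ℝ (Fin J)) :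
    charFun (ρ.map fun ω => WithLp.toLp 2 (V ω)) a = charFun (ρ.map fun ω => ∑ j, a j * V ω j) 1 := by
  have m1 : Measurable fun ω => (WithLp.toLp 2 (V ω) : EuclideanSpace ℝ (Fin J)) := (PiLp.continuous_toLp 2 _).measurable.comp hV
  have m2 : Measurable fun ω => ∑ j, a j * V ω j := Finset.measurable_fun_sum _ fun j _ => ((measurable_pi_apply j).comp hV).const_mul _
  rw [charFun_apply, charFun_apply, integral_map m1.aemeasurable (by fun_prop), integral_map m2.aemeasurable (by fun_prop)]
  congr 1; ext ω; congr 2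
  simp [PiLp.inner_apply]

lemma clt_multi (hw : ∀ i, Measurable (w i)) (hi : iIndepFun w μ) (hl : ∀ i, μ.map (w i) = Pw)
    {f : Fin J → A → ℝ} (hf : ∀ j, BM (f j)) (h0 : ∀ j, ∫ v, f j v ∂Pw = 0)
    {S : Matrix (Fin J) (Fin J) ℝ} (hS : ∀ i j, S i j = ∫ ω, f i (w 0 ω) * f j (w 0 ω) ∂μ)
    {ν : Measure (Fin J → ℝ)} [IsProbabilityMeasure ν] (hν : IsCenteredGaussian S ν) :
    MeasureTheory.TendstoInDistribution (fun (n : ℕ) ω (j : Fin J) => (√(n : ℝ))⁻¹ * ∑ i ∈ Finset.range n, f j (w i ω)) atTop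
      (fun v => v) (fun _ => μ) ν := by
  have hm : ∀ n : ℕ, Measurable fun ω (j : Fin J) => (√(n : ℝ))⁻¹ * ∑ i ∈ Finset.range n, f j (w i ω) := fun n =>
    measurable_pi_lambda _ fun j => (Finset.measurable_fun_sum _ fun i _ => (hf j).measurable.comp (hw i)).const_mul _
  have hmE : Measurable fun v : Fin J → ℝ => (WithLp.toLp 2 v : EuclideanSpace ℝ (Fin J)) := (PiLp.continuous_toLp 2 _).measurable
  have key : MeasureTheory.TendstoInDistribution (fun (n : ℕ) ω => (WithLp.toLp 2 fun (j : Fin J) => (√(n : ℝ))⁻¹ * ∑ i ∈ Finset.range n, f j (w i ω) : EuclideanSpace ℝ (Fin J))) atTop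
      (fun v => WithLp.toLp 2 v) (fun _ => μ) ν := by
    refine ⟨fun n => (hmE.comp (hm n)).aemeasurable, hmE.aemeasurable, ?_⟩
    refine ProbabilityMeasure.tendsto_iff_tendsto_charFun.2 fun a => ?_
    simp only [ProbabilityMeasure.coe_mk]
    rw [charFun_lin ν (V := fun v => v) measurable_id a]
    have hF : BM fun v => ∑ j, a j * f j v := BM.sum fun j _ => (hf j).const_mul (a j)
    have h := clt_one hw hi hl hF (by
      rw [integral_finsetSum _ fun j _ => ((hf j).const_mul (a j)).integrable Pw]
      simp [integral_const_mul, h0])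
    have e1 : ∑ i, ∑ j, a i * S i j * a j = ∫ ω, (∑ j, a j * f j (w 0 ω)) ^ 2 ∂μ := by
      have : ∀ ω, (∑ j, a j * f j (w 0 ω)) ^ 2 = ∑ i, ∑ j, a i * a j * (f i (w 0 ω) * f j (w 0 ω)) := fun ω => by
        rw [sq, Finset.sum_mul_sum]
        exact Finset.sum_congr rfl fun i _ => Finset.sum_congr rfl fun j _ => by ring
      simp_rw [this]
      have hij : ∀ i j, BM fun ω => a i * a j * (f i (w 0 ω) * f j (w 0 ω)) := fun i j =>
        (((hf i).comp (hw 0)).mul ((hf j).comp (hw 0))).const_mul _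
      rw [integral_finsetSum _ fun i _ => (BM.sum fun j _ => hij i j).integrable μ]
      refine Finset.sum_congr rfl fun i _ => ?_
      rw [integral_finsetSum _ fun j _ => (hij i j).integrable μ]
      refine Finset.sum_congr rfl fun j _ => ?_
      rw [integral_const_mul, hS]; ring
    have e2 := hν.2 a
    rw [e1] at e2
    rw [← e2] at h
    refine h.congr fun n => ?_
    rw [charFun_lin μ (hm n) a]
    congr 2; ext ω
    simp_rw [Finset.mul_sum]
    rw [Finset.sum_comm]
    exact Finset.sum_congr rfl fun i _ => Finset.sum_congr rfl fun j _ => by ring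
  exact key.continuous_comp (g := fun x => WithLp.ofLp x) (PiLp.continuous_ofLp 2 _)

lemma clt_slutsky (hw : ∀ i, Measurable (w i)) (hi : iIndepFun w μ) (hl : ∀ i, μ.map (w i) = Pw)
    {f : Fin J → A → ℝ} (hf : ∀ j, BM (f j)) (h0 : ∀ j, ∫ v, f j v ∂Pw = 0)
    {S : Matrix (Fin J) (Fin J) ℝ} (hS : ∀ i j, S i j = ∫ ω, f i (w 0 ω) * f j (w 0 ω) ∂μ)
    {ν : Measure (Fin J → ℝ)} (hν : IsCenteredGaussian S ν) {T : Fin J → ℕ → Ω → ℝ}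
    (hT : ∀ j, ∃ b : ℕ → ℝ, Tendsto b atTop (𝓝 0) ∧ ∀ᶠ n in atTop, BM (T j n) ∧ (√(n : ℝ))⁻¹ * ∫ ω, |T j n ω| ∂μ ≤ b n)
    {W : ℕ → Ω → Fin J → ℝ} (hW : ∀ n ω j, W n ω j = (√(n : ℝ))⁻¹ * (∑ i ∈ Finset.range n, f j (w i ω) + T j n ω)) :
    CIPaper.TendstoInDistribution μ W ν := by
  classical
  have := hν.1
  have hc := clt_multi hw hi hl hf h0 hS hν
  choose b hb hTb using hT
  have hev : ∀ᶠ n in atTop, ∀ j, BM (T j n) ∧ (√(n : ℝ))⁻¹ * ∫ ω, |T j n ω| ∂μ ≤ b j n := eventually_all.2 hTb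
  let R : ℕ → Ω → Fin J → ℝ := fun n ω j => if ∀ j, BM (T j n) then (√(n : ℝ))⁻¹ * T j n ω else 0
  have hR : ∀ n j, BM fun ω => R n ω j := fun n j => by
    by_cases h : ∀ j, BM (T j n)
    · simp only [R, if_pos h]; exact (h j).const_mul _
    · simp only [R, if_neg h]; exact BM.const _
  have hRm : ∀ n, Measurable (R n) := fun n => measurable_pi_lambda _ fun j => (hR n j).measurable
  have hmeas : TendstoInMeasure μ (fun n ω => R n ω) atTop (fun _ => 0) := by
    refine tendstoInMeasure_of_tendsto_eLpNorm (p := 1) one_ne_zero (fun n => (hRm n).aestronglyMeasurable) aestronglyMeasurable_const ?_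
    have hsum : Tendsto (fun n => ENNReal.ofReal (∑ j, b j n)) atTop (𝓝 0) := by
      have := ENNReal.tendsto_ofReal (tendsto_finsetSum Finset.univ fun j _ => hb j)
      simpa using this
    refine tendsto_of_tendsto_of_tendsto_of_le_of_le' tendsto_const_nhds hsum (Eventually.of_forall fun _ => zero_le) ?_
    filter_upwards [hev] with n hn
    have hI : Integrable (R n) μ := Integrable.of_eval fun j => (hR n j).integrable μ
    rw [eLpNorm_one_eq_lintegral_enorm]
    have : ∫⁻ ω, ‖(R n - (fun _ => 0 : Ω → Fin J → ℝ)) ω‖ₑ ∂μ = ENNReal.ofReal (∫ ω, ‖R n ω‖ ∂μ) := by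
      rw [ofReal_integral_norm_eq_lintegral_enorm hI]; simp
    rw [this]
    refine ENNReal.ofReal_le_ofReal ?_
    calc ∫ ω, ‖R n ω‖ ∂μ ≤ ∫ ω, ∑ j, |R n ω j| ∂μ := by
          refine integral_mono hI.norm ((BM.sum fun j _ => (hR n j).norm).integrable μ) fun ω => ?_
          refine (pi_norm_le_iff_of_nonneg (Finset.sum_nonneg fun j _ => abs_nonneg _)).2 fun j => ?_
          exact Finset.single_le_sum (f := fun j => |R n ω j|) (fun j _ => abs_nonneg _) (Finset.mem_univ j)
      _ = ∑ j, ∫ ω, |R n ω j| ∂μ := integral_finsetSum _ fun j _ => (hR n j).norm.integrable μ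
      _ ≤ ∑ j, b j n := by
          refine Finset.sum_le_sum fun j _ => ?_
          simp only [R, if_pos fun j => (hn j).1, abs_mul, integral_const_mul]
          rw [abs_of_nonneg (by positivity)]
          exact (hn j).2
  have hfin := tendstoInDistribution_of_tendstoInMeasure_sub
    (fun (n : ℕ) ω (j : Fin J) => (√(n : ℝ))⁻¹ * ∑ i ∈ Finset.range n, f j (w i ω) + R n ω j) (fun v => v) hc (by
      refine hmeas.congr (fun n => Eventually.of_forall fun ω => ?_) (Eventually.of_forall fun ω => rfl)
      ext j; simp) (fun n => by
      refine (measurable_pi_lambda _ fun j => ((Finset.measurable_fun_sum _ fun i _ => (hf j).measurable.comp (hw i)).const_mul _).add (hR n j).measurable).aemeasurable)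
  intro F
  have h2 := ProbabilityMeasure.tendsto_iff_forall_integral_tendsto.1 hfin.tendsto F
  simp only [ProbabilityMeasure.coe_mk] at h2
  rw [Measure.map_id'] at h2
  refine h2.congr' ?_
  filter_upwards [hev] with n hn
  rw [integral_map (hfin.forall_aemeasurable n) F.continuous.aestronglyMeasurable]
  congr 1; ext ω; congr 1; ext j
  rw [hW]
  simp only [R, if_pos fun j => (hn j).1]
  ring

end clt
end CIProof
end

/-- Proposition 3, part 1: CLT for `√n · S̃_{n,r_n}` under `H₀`. -/
theorem statement_11
    (dx dy dz : ℕ) (hdx : 1 ≤ dx) (hdy : 1 ≤ dy) (hdz : 1 ≤ dz)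
    {Ω : Type} [MeasurableSpace Ω] [StandardBorelSpace Ω] [Nonempty Ω]
    (μ : Measure Ω) [IsProbabilityMeasure μ]
    (X : Ω → Fin dx → ℝ) (Z : Ω → Fin dz → ℝ) (Y : Ω → Fin dy → ℝ)
    (hX : Measurable X) (hZ : Measurable Z) (hY : Measurable Y)
    (p J : ℕ) (hp : 1 ≤ p) (hJ : 1 ≤ J)
    (kX : ((Fin dx → ℝ) × (Fin dz → ℝ)) → ((Fin dx → ℝ) × (Fin dz → ℝ)) → ℝ) (kY : (Fin dy → ℝ) → (Fin dy → ℝ) → ℝ)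
    (hk : Assumption1 kX kY)
    (e1 : ((Fin dx → ℝ) × (Fin dz → ℝ)) → (Fin dz → ℝ) → ℝ) (e2 : (Fin dy → ℝ) → (Fin dz → ℝ) → ℝ)
    (he1m : ∀ t1, Measurable (e1 t1)) (he2m : ∀ t2, Measurable (e2 t2))
    (he1 : ∀ t1, (fun ω => e1 t1 (Z ω)) =ᵐ[μ]
      μ[fun ω' => kX t1 (X ω', Z ω') | MeasurableSpace.comap Z inferInstance])
    (he2 : ∀ t2, (fun ω => e2 t2 (Z ω)) =ᵐ[μ]
      μ[fun ω' => kY t2 (Y ω') | MeasurableSpace.comap Z inferInstance])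
    (xS : ℕ → Ω → Fin dx → ℝ) (zS : ℕ → Ω → Fin dz → ℝ) (yS : ℕ → Ω → Fin dy → ℝ)
    (hxS : ∀ i, Measurable (xS i)) (hzS : ∀ i, Measurable (zS i)) (hyS : ∀ i, Measurable (yS i))
    (hiid : iIndepFun (fun i ω => ((xS i ω, zS i ω), yS i ω)) μ)
    (hlaw : ∀ i, μ.map (fun ω => ((xS i ω, zS i ω), yS i ω)) =
      μ.map fun ω => ((X ω, Z ω), Y ω))
    (kZ1 kZ2 : Fin J → (Fin dz → ℝ) → (Fin dz → ℝ) → ℝ)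
    (hkZ1bdd : ∀ j, BoundedKernel (kZ1 j)) (hkZ2bdd : ∀ j, BoundedKernel (kZ2 j))
    (hkZ1cont : ∀ j, Continuous fun q : (Fin dz → ℝ) × (Fin dz → ℝ) => kZ1 j q.1 q.2)
    (hkZ2cont : ∀ j, Continuous fun q : (Fin dz → ℝ) × (Fin dz → ℝ) => kZ2 j q.1 q.2)
    (hkZ1symm : ∀ j z z', kZ1 j z z' = kZ1 j z' z)
    (hkZ2symm : ∀ j z z', kZ2 j z z' = kZ2 j z' z)
    (hkZ1pd : ∀ j, PosDefKernel (kZ1 j)) (hkZ2pd : ∀ j, PosDefKernel (kZ2 j))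
    (L1 L2 : Fin J → (Lp ℝ 2 (μ.map Z) →L[ℝ] Lp ℝ 2 (μ.map Z)))
    (hL1 : ∀ (j : Fin J) (g : Lp ℝ 2 (μ.map Z)),
      (L1 j g : (Fin dz → ℝ) → ℝ) =ᵐ[μ.map Z] fun z => ∫ z', kZ1 j z z' * g z' ∂(μ.map Z))
    (hL2 : ∀ (j : Fin J) (g : Lp ℝ 2 (μ.map Z)),
      (L2 j g : (Fin dz → ℝ) → ℝ) =ᵐ[μ.map Z] fun z => ∫ z', kZ2 j z z' * g z' ∂(μ.map Z))
    (Q γ : ℝ) (hQ : 0 < Q) (hγ0 : 0 ≤ γ) (hγ1 : γ ≤ 1)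
    (hA2 : ∀ j, TraceAssumption (μ.map Z) (L1 j) Q γ ∧ TraceAssumption (μ.map Z) (L2 j) Q γ)
    (β : ℝ) (hβ1 : 1 < β) (hβ2 : β ≤ 2)
    (Lβ1 Lβ2 : Fin J → (Lp ℝ 2 (μ.map Z) →L[ℝ] Lp ℝ 2 (μ.map Z)))
    (hLβ1 : ∀ j, IsFracPower (L1 j) (β / 2) (Lβ1 j))
    (hLβ2 : ∀ j, IsFracPower (L2 j) (β / 2) (Lβ2 j))
    (he1mem : ∀ t1, MemLp (e1 t1) 2 (μ.map Z)) (he2mem : ∀ t2, MemLp (e2 t2) 2 (μ.map Z))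
    (hA3r1 : ∀ (j : Fin J) (t1 : ((Fin dx → ℝ) × (Fin dz → ℝ))), MemLp.toLp (e1 t1) (he1mem t1) ∈ Set.range ⇑(Lβ1 j))
    (hA3r2 : ∀ (j : Fin J) (t2 : Fin dy → ℝ), MemLp.toLp (e2 t2) (he2mem t2) ∈ Set.range ⇑(Lβ2 j))
    (σ0 L0 : ℝ) (hσ0 : 0 < σ0) (hL0 : 0 < L0)
    (hmom1 : ∀ (t1 : ((Fin dx → ℝ) × (Fin dz → ℝ))) (l : ℕ), 2 ≤ l → ∀ᵐ ω ∂μ,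
      (μ[fun ω' => |kX t1 (X ω', Z ω') - e1 t1 (Z ω')| ^ l |
        MeasurableSpace.comap Z inferInstance]) ω ≤ (l.factorial : ℝ) * σ0 ^ 2 * L0 ^ (l - 2) / 2)
    (hmom2 : ∀ (t2 : Fin dy → ℝ) (l : ℕ), 2 ≤ l → ∀ᵐ ω ∂μ,
      (μ[fun ω' => |kY t2 (Y ω') - e2 t2 (Z ω')| ^ l |
        MeasurableSpace.comap Z inferInstance]) ω ≤ (l.factorial : ℝ) * σ0 ^ 2 * L0 ^ (l - 2) / 2)
    (rn : ℕ → ℕ) (hrn : ∀ n, rn n ≤ n)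
    (hro : (fun n : ℕ => (n : ℝ) ^ ((β + γ) / (2 * β))) =o[atTop] fun n => (rn n : ℝ))
    (t : Fin J → (((Fin dx → ℝ) × (Fin dz → ℝ)) × (Fin dy → ℝ)))
    (hH0 : CondIndepFun (MeasurableSpace.comap Z inferInstance) hZ.comap_le X Y μ)
    (ν : Measure (Fin J → ℝ)) (hν : IsCenteredGaussian (covMat μ kX kY e1 e2 xS zS yS t) ν) :
    TendstoInDistribution μ
      (fun n ω => Real.sqrt n • STilde kX kY kZ1 kZ2 xS zS yS t n (rn n) ((rn n : ℝ) ^ (-(1 / (1 + γ)))) ω) ν := by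

  classical
  have hPZ : IsProbabilityMeasure (μ.map Z) := Measure.isProbabilityMeasure_map hZ.aemeasurable
  have hV : Measurable fun ω => ((X ω, Z ω), Y ω) := (hX.prodMk hZ).prodMk hY
  have hPw : IsProbabilityMeasure (μ.map fun ω => ((X ω, Z ω), Y ω)) := Measure.isProbabilityMeasure_map hV.aemeasurable
  have : Nonempty (Fin dx) := ⟨⟨0, hdx⟩⟩
  have hNF := fun j => CIProof.exists_NF hX hY hZ hH0 (CIProof.a1_X hk (t j).1) (CIProof.a1_Y hk (t j).2)
    (he1m (t j).1) (he2m (t j).2) (he1 (t j).1) (he2 (t j).2)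
  choose c1 c2 hc1 hc2 hce1 hce2 η1 η2 B hnf using hNF
  have hKB1 : ∀ j, ∃ κ Cl C, CIProof.KB (μ.map Z) (kZ1 j) (c1 j) γ β κ Cl C := fun j => by
    obtain ⟨g, hg⟩ := hA3r1 j (t j).1
    refine CIProof.exists_KB (hkZ1bdd j) (hkZ1cont j) (hkZ1symm j) (hkZ1pd j) (hL1 j) hQ (hA2 j).1 hβ1 hβ2 (hLβ1 j) (hc1 j) g ?_
    rw [hg]
    exact (MemLp.coeFn_toLp _).trans (hce1 j).symm
  have hKB2 : ∀ j, ∃ κ Cl C, CIProof.KB (μ.map Z) (kZ2 j) (c2 j) γ β κ Cl C := fun j => by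
    obtain ⟨g, hg⟩ := hA3r2 j (t j).2
    refine CIProof.exists_KB (hkZ2bdd j) (hkZ2cont j) (hkZ2symm j) (hkZ2pd j) (hL2 j) hQ (hA2 j).2 hβ1 hβ2 (hLβ2 j) (hc2 j) g ?_
    rw [hg]
    exact (MemLp.coeFn_toLp _).trans (hce2 j).symm
  choose κ1 Cl1 C1 hB1 using hKB1
  choose κ2 Cl2 C2 hB2 using hKB2
  have hw : ∀ i, Measurable fun ω => ((xS i ω, zS i ω), yS i ω) := fun i => ((hxS i).prodMk (hzS i)).prodMk (hyS i)
  have hζ : Measurable fun v : ((Fin dx → ℝ) × (Fin dz → ℝ)) × (Fin dy → ℝ) => v.1.2 := measurable_snd.comp measurable_fst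
  have hP : (μ.map fun ω => ((X ω, Z ω), Y ω)).map (fun v => v.1.2) = μ.map Z := by
    rw [Measure.map_map hζ hV]; rfl
  have hzl : ∀ i, μ.map (zS i) = μ.map Z := fun i => by
    rw [← hP, ← hlaw i, Measure.map_map hζ (hw i)]; rfl
  refine CIProof.clt_slutsky (f := fun j v => (kX (t j).1 v.1 - c1 j v.1.2) * (kY (t j).2 v.2 - c2 j v.1.2))
    (T := fun j n ω => ∑ i ∈ Finset.range n,
      ((kX (t j).1 (xS i ω, zS i ω) - rls (kZ1 j) (fun l => zS l ω) (fun l => kX (t j).1 (xS l ω, zS l ω)) (rn n)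
          ((rn n : ℝ) ^ (-(1 / (1 + γ)))) (zS i ω)) *
        (kY (t j).2 (yS i ω) - rls (kZ2 j) (fun l => zS l ω) (fun l => kY (t j).2 (yS l ω)) (rn n)
          ((rn n : ℝ) ^ (-(1 / (1 + γ)))) (zS i ω)) -
        (kX (t j).1 (xS i ω, zS i ω) - c1 j (zS i ω)) * (kY (t j).2 (yS i ω) - c2 j (zS i ω))))
    hw hiid hlaw (fun j => (hnf j).b1.mul (hnf j).b2) (fun j => ?_) (fun i j => ?_) hν (fun j => ?_) (fun n ω j => ?_)
  · have h := (hnf j).s1 _ (hnf j).b2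
    simp_rw [(hnf j).i2] at h
    exact h
  · have hae : ∀ j, ∀ᵐ ω ∂μ, uStat kX kY e1 e2 xS zS yS t 0 j ω =
        (kX (t j).1 (xS 0 ω, zS 0 ω) - c1 j (zS 0 ω)) * (kY (t j).2 (yS 0 ω) - c2 j (zS 0 ω)) := fun j => by
      have a1 : ∀ᵐ ω ∂μ, c1 j (zS 0 ω) = e1 (t j).1 (zS 0 ω) :=
        ae_of_ae_map (hzS 0).aemeasurable (by rw [hzl 0]; exact hce1 j)
      have a2 : ∀ᵐ ω ∂μ, c2 j (zS 0 ω) = e2 (t j).2 (zS 0 ω) :=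
        ae_of_ae_map (hzS 0).aemeasurable (by rw [hzl 0]; exact hce2 j)
      filter_upwards [a1, a2] with ω h1 h2
      rw [uStat, h1, h2]
    change ∫ ω, uStat kX kY e1 e2 xS zS yS t 0 i ω * uStat kX kY e1 e2 xS zS yS t 0 j ω ∂μ = _
    refine integral_congr_ae ?_
    filter_upwards [hae i, hae j] with ω h1 h2
    rw [h1, h2]
  · exact CIProof.rem_j (w := fun i ω => ((xS i ω, zS i ω), yS i ω)) hw hiid hlaw hP (hnf j) hγ0 hγ1 hβ1 hβ2 (hB1 j) (hB2 j) hrn hro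
      (lam := fun n => (rn n : ℝ) ^ (-(1 / (1 + γ)))) (fun n => rfl) (fun n ω => rfl)
  · simp only [Pi.smul_apply, smul_eq_mul, STilde, uTildeStat]
    rw [← mul_assoc, ← Finset.sum_add_distrib, ← div_eq_mul_inv, Real.sqrt_div_self, one_div]
    congr 1
    exact Finset.sum_congr rfl fun i _ => by ring
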